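/- The polyhedral complex Δ is Cohen–Macaulay over k (i.e. H^i_G(Δ) = 0 for every face G ∈ Δ and every i < dim Δ) if and only if the quotient ring k[Q]/I_Δ is a Cohen–Macaulay ring. -/

import Mathlib

attribute [local instance] Classical.propDecidable

set_option synthInstance.maxHeartbeats 1000000
set_option maxHeartbeats 4000000

noncomputable section

open DirectSum

namespace ZMS

/-- The ambient lattice `ℤ^d`. -/
abbrev L (d : ℕ) : Type := Fin d → ℤ

variable (k : Type) [Field k] {d : ℕ} (Q : AddSubmonoid (L d))

/-- `Q ⊆ ℤ^d` is a normal affine semigroup. -/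
structure IsNormalAffineSemigroup (Q : AddSubmonoid (L d)) : Prop where
  fg : Q.FG
  generates : AddSubgroup.closure (Q : Set (L d)) = ⊤
  pointed : ∀ x ∈ Q, -x ∈ Q → x = 0
  saturated : ∀ (x : L d) (n : ℕ), 0 < n → n • x ∈ Q → x ∈ Q

/-- The affine semigroup ring `k[Q]`. -/
abbrev kQ : Type := AddMonoidAlgebra k Q

/-- The monomial `x^q` in `k[Q]`. -/
def mono (q : Q) : kQ k Q := AddMonoidAlgebra.single q 1

/-- A monomial (i.e. `ℤ^d`-graded) ideal of `k[Q]`. -/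
def IsMonomialIdeal (W : Ideal (kQ k Q)) : Prop :=
  ∃ S : Set Q, W = Ideal.span (mono k Q '' S)

/-- An ideal is irreducible if it is not the intersection of two ideals
properly containing it. -/
def IsIrreducibleIdeal (W : Ideal (kQ k Q)) : Prop :=
  ∀ W₁ W₂ : Ideal (kQ k Q), W = W₁ ⊓ W₂ → W = W₁ ∨ W = W₂

/-- A face of `Q`: the zero set in `Q` of a linear functional nonnegative on `Q`. -/
def IsFace (F : AddSubmonoid (L d)) : Prop :=
  ∃ lam : L d →ₗ[ℤ] ℤ, (∀ x ∈ Q, 0 ≤ lam x) ∧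
    (F : Set (L d)) = {x | x ∈ Q ∧ lam x = 0}

/-- The dimension of (the real cone spanned by) a face. -/
def faceDim (F : AddSubmonoid (L d)) : ℕ :=
  Module.finrank ℤ (AddSubgroup.closure (F : Set (L d)))

/-- `G'` is a facet of `G`. -/
def IsFacetOf (G' G : AddSubmonoid (L d)) : Prop :=
  IsFace Q G' ∧ IsFace Q G ∧ G' ≤ G ∧ faceDim G' + 1 = faceDim G

/-- The monomial prime ideal of the face `F`, i.e. the kernel of `k[Q] → k[F]`. -/
def facePrime (F : AddSubmonoid (L d)) : Ideal (kQ k Q) :=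
  Ideal.span {m | ∃ q : Q, (q : L d) ∉ F ∧ m = mono k Q q}

lemma facePrime_mono {F G : AddSubmonoid (L d)} (h : G ≤ F) :
    facePrime k Q F ≤ facePrime k Q G := by
  apply Ideal.span_mono
  rintro m ⟨q, hq, rfl⟩
  exact ⟨q, fun hm => hq (h hm), rfl⟩

/-- The semigroup ring `k[F]` of a face `F`, as a quotient of `k[Q]`. -/
abbrev faceRing (F : AddSubmonoid (L d)) : Type := kQ k Q ⧸ facePrime k Q F

/-- The `k[Q]`-linear quotient map between quotients of `k[Q]`. -/
def fMap {I J : Ideal (kQ k Q)} (h : I ≤ J) :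
    (kQ k Q ⧸ I) →ₗ[kQ k Q] (kQ k Q ⧸ J) :=
  Submodule.mapQ _ _ LinearMap.id (by simpa using h)

/-- Lattice points in the relative interior of a face `F`. -/
def relint (F : AddSubmonoid (L d)) : Set (L d) :=
  {a | a ∈ F ∧ ∀ G, IsFace Q G → G ≤ F → G ≠ F → a ∉ G}

/-- The canonical module `ω_{k[F]}`, the span in `k[F]` of the monomials whose
exponents lie in the relative interior of `F`. -/
def canonicalModule (F : AddSubmonoid (L d)) : Submodule (kQ k Q) (faceRing k Q F) :=
  Submodule.span (kQ k Q)
    {x | ∃ q : Q, (q : L d) ∈ relint Q F ∧ x = Ideal.Quotient.mk (facePrime k Q F) (mono k Q q)}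

/-- The `ℤ^d`-degree-`a` component of a quotient of `k[Q]` by a monomial ideal. -/
def quotDeg (W : Ideal (kQ k Q)) (a : L d) : Submodule k (kQ k Q ⧸ W) :=
  Submodule.span k {x | ∃ q : Q, (q : L d) = a ∧ x = Ideal.Quotient.mk W (mono k Q q)}

/-- Isomorphism of `ℤ^d`-graded `k[Q]`-modules between the quotients of `k[Q]` by two
monomial ideals. -/
def GradedQuotIso (W W' : Ideal (kQ k Q)) : Prop :=
  ∃ e : (kQ k Q ⧸ W) ≃ₗ[kQ k Q] (kQ k Q ⧸ W'),
    (∀ (a : L d) (x), x ∈ quotDeg k Q W a → e x ∈ quotDeg k Q W' a) ∧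
    (∀ (a : L d) (x), x ∈ quotDeg k Q W' a → e.symm x ∈ quotDeg k Q W a)

/-- The `ℤ^d`-degree-`a` component of a direct sum of quotients of `k[Q]` by
monomial ideals. -/
def sumDeg {ι : Type} (W : ι → Ideal (kQ k Q)) (a : L d) :
    Submodule k (⨁ j, kQ k Q ⧸ W j) :=
  Submodule.span k {x | ∃ (q : Q) (j : ι), (q : L d) = a ∧
    x = DirectSum.lof (kQ k Q) ι (fun j => kQ k Q ⧸ W j) j
          (Ideal.Quotient.mk (W j) (mono k Q q))}


/-- The maximal monomial ideal of `k[Q]`. -/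
def maxIdeal : Ideal (kQ k Q) :=
  Ideal.span {m | ∃ q : Q, (q : L d) ≠ 0 ∧ m = mono k Q q}

/-- `k[Q]/I` is a Cohen--Macaulay ring: there is a regular sequence inside the
graded maximal ideal whose length equals the Krull dimension.  (For finitely
generated graded algebras over a field this is equivalent to the usual
definition of Cohen--Macaulayness.) -/
def RingIsCM (I : Ideal (kQ k Q)) : Prop :=
  ∃ rs : List (kQ k Q ⧸ I),
    (∀ r ∈ rs, r ∈ (maxIdeal k Q).map (Ideal.Quotient.mk I)) ∧
    RingTheory.Sequence.IsRegular (kQ k Q ⧸ I) rs ∧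
    (rs.length : WithBot (WithTop ℕ)) = ringKrullDim (kQ k Q ⧸ I)

/-- A finitely generated graded `k[Q]`-module `M` is Cohen--Macaulay:
there is an `M`-regular sequence in the graded maximal ideal whose length is
the Krull dimension of `M` (i.e. of `k[Q]/ann M`). -/
def ModuleIsCM (N : Type) [AddCommGroup N] [Module (kQ k Q) N] : Prop :=
  ∃ rs : List (kQ k Q),
    (∀ r ∈ rs, r ∈ maxIdeal k Q) ∧
    RingTheory.Sequence.IsRegular N rs ∧
    (rs.length : WithBot (WithTop ℕ)) =
      ringKrullDim (kQ k Q ⧸ Module.annihilator (kQ k Q) N)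

section Zeeman

variable (Δ : Finset (AddSubmonoid (L d)))
variable (ε : AddSubmonoid (L d) → AddSubmonoid (L d) → ℤ)
/-- `Δ` is a polyhedral subcomplex of `ℝ_{≥0} Q`: a collection of faces of `Q`
closed under taking faces. -/
def IsPolyhedralComplex : Prop :=
  (∀ F ∈ Δ, IsFace Q F) ∧ (∀ F ∈ Δ, ∀ G, IsFace Q G → G ≤ F → G ∈ Δ)

/-- `ε` is an incidence function on the faces of `ℝ_{≥0} Q`. -/
def IsIncidence : Prop :=
  (∀ G' G, IsFacetOf Q G' G → ε G' G = 1 ∨ ε G' G = -1) ∧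
  (∀ G₁ G₂ G₃ G₄, G₂ ≠ G₃ → IsFacetOf Q G₁ G₂ → IsFacetOf Q G₂ G₄ →
    IsFacetOf Q G₁ G₃ → IsFacetOf Q G₃ G₄ →
    ε G₁ G₂ * ε G₂ G₄ + ε G₁ G₃ * ε G₃ G₄ = 0)

/-- The dimension of the polyhedral complex `Δ`. -/
abbrev cxDim : ℕ := Δ.sup faceDim

/-- The radical monomial ideal `I_Δ`, spanned by all monomials lying on no face of `Δ`. -/
def complexIdeal : Ideal (kQ k Q) :=
  Ideal.span {m | ∃ q : Q, (∀ F ∈ Δ, (q : L d) ∉ F) ∧ m = mono k Q q}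


end Zeeman

section Zeeman

variable (Δ : Finset (AddSubmonoid (L d)))
variable (ε : AddSubmonoid (L d) → AddSubmonoid (L d) → ℤ)
/-- The `p`-dimensional faces of `Δ_G = {F ∈ Δ | F ⊇ G}`. -/
abbrev cofaces (G : AddSubmonoid (L d)) (p : ℕ) : Type :=
  {F : {F // F ∈ Δ} // G ≤ (F : AddSubmonoid (L d)) ∧ faceDim (F : AddSubmonoid (L d)) = p}

/-- The degree-`p` part of the complex `C^•(Δ_G)` of `k`-vector spaces. -/
abbrev cochain (G : AddSubmonoid (L d)) (p : ℕ) : Type := cofaces Δ G p → k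

/-- The differential of `C^•(Δ_G)`, given by the incidence function `ε`. -/
def cochainDiff (G : AddSubmonoid (L d)) (p : ℕ) :
    cochain k Δ G p →ₗ[k] cochain k Δ G (p+1) :=
  LinearMap.pi fun F' => ∑ F : cofaces Δ G p,
    (if IsFacetOf Q (F.1 : AddSubmonoid (L d)) (F'.1 : AddSubmonoid (L d))
     then ((ε (F.1 : AddSubmonoid (L d)) (F'.1 : AddSubmonoid (L d)) : ℤ) : k)
     else 0) • LinearMap.proj F

/-- Cocycles of `C^•(Δ_G)` in degree `p`. -/
def cocycles (G : AddSubmonoid (L d)) (p : ℕ) : Submodule k (cochain k Δ G p) :=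
  LinearMap.ker (cochainDiff k Q Δ ε G p)

/-- Coboundaries of `C^•(Δ_G)` in degree `p`. -/
def cobound (G : AddSubmonoid (L d)) : (p : ℕ) → Submodule k (cochain k Δ G p)
  | 0 => ⊥
  | (p+1) => LinearMap.range (cochainDiff k Q Δ ε G p)

/-- The local cohomology `H^p_G(Δ)` of `Δ` near `G`, with coefficients in `k`. -/
abbrev Hloc (G : AddSubmonoid (L d)) (p : ℕ) : Type :=
  ↥(cocycles k Q Δ ε G p) ⧸
    Submodule.comap (cocycles k Q Δ ε G p).subtype (cobound k Q Δ ε G p)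

/-- Extension of cochains by zero along `C^•(Δ_G) ⊆ C^•(Δ_{G'})` (for `G' ≤ G`). -/
def cochainExt (G G' : AddSubmonoid (L d)) (p : ℕ) :
    cochain k Δ G p →ₗ[k] cochain k Δ G' p :=
  LinearMap.pi fun F => if h : G ≤ (F.1 : AddSubmonoid (L d))
    then LinearMap.proj (⟨F.1, h, F.2.2⟩ : cofaces Δ G p) else 0


end Zeeman


/-! ### Cochain complexes on finite posets with an incidence function -/

/-- Incidence data on a finite poset. -/
structure PD (P : Type) [Fintype P] [PartialOrder P] where
  cov : P → P → Prop
  ep : P → P → ℤ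
  dim : P → ℕ
  cov_le : ∀ {F G}, cov F G → F ≤ G
  cov_dim : ∀ {F G}, cov F G → dim F + 1 = dim G
  dd : ∀ F G, ∑ H, (if cov F H ∧ cov H G then ep F H * ep H G else 0) = 0

/-- A functor from a poset to modules. -/
structure Shf (A : Type) [CommRing A] (P : Type) [PartialOrder P] where
  V : P → Type
  [grp : ∀ F, AddCommGroup (V F)]
  [mdl : ∀ F, Module A (V F)]
  rho : ∀ {F G}, F ≤ G → V F →ₗ[A] V G
  comp : ∀ {F G H} (h₁ : F ≤ G) (h₂ : G ≤ H) (x : V F), rho h₂ (rho h₁ x) = rho (h₁.trans h₂) x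

attribute [instance] Shf.grp Shf.mdl

section Poset

variable {P : Type} [Fintype P] [PartialOrder P] {A : Type} [CommRing A]

/-- The constant functor. -/
abbrev constShf (P : Type) [PartialOrder P] (A : Type) [CommRing A] (W : Type) [AddCommGroup W] [Module A W] : Shf A P where
  V := fun _ => W
  rho := fun _ => LinearMap.id
  comp := by intros; rfl

/-- The differential. -/
def dif (S : PD P) (V : Shf A P) : (∀ F, V.V F) →ₗ[A] (∀ F, V.V F) :=
  LinearMap.pi fun G => ∑ F : P, if h : S.cov F G then
    S.ep F G • (V.rho (S.cov_le h)).comp (LinearMap.proj F) else 0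

lemma dif_apply (S : PD P) (V : Shf A P) (c : ∀ F, V.V F) (G : P) :
    dif S V c G = ∑ F : P, if h : S.cov F G then S.ep F G • V.rho (S.cov_le h) (c F) else 0 := by
  simp only [dif, LinearMap.pi_apply, LinearMap.sum_apply]
  refine Finset.sum_congr rfl fun F _ => ?_
  split_ifs <;> simp

lemma dif_congr (S : PD P) (V : Shf A P) {c c' : ∀ F, V.V F} {G : P}
    (h : ∀ F, S.cov F G → c F = c' F) : dif S V c G = dif S V c' G := by
  rw [dif_apply, dif_apply]
  refine Finset.sum_congr rfl fun F _ => ?_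
  split_ifs with hc
  · rw [h F hc]
  · rfl

lemma dif_zero_of (S : PD P) (V : Shf A P) {c : ∀ F, V.V F} {G : P}
    (h : ∀ F, S.cov F G → c F = 0) : dif S V c G = 0 := by
  rw [dif_congr S V (c' := 0) (by simpa using h)]
  simp

lemma dif_dif (S : PD P) (V : Shf A P) (c : ∀ F, V.V F) : dif S V (dif S V c) = 0 := by
  funext G
  rw [dif_apply]
  have : ∀ H : P, (if h : S.cov H G then S.ep H G • V.rho (S.cov_le h) (dif S V c H) else 0)
      = ∑ F : P, (if h : F ≤ G then
        (if S.cov F H ∧ S.cov H G then S.ep F H * S.ep H G else 0) • V.rho h (c F) else 0) := by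
    intro H
    split_ifs with hH
    · rw [dif_apply, map_sum, Finset.smul_sum]
      refine Finset.sum_congr rfl fun F _ => ?_
      split_ifs with h1 h2 h3 h4 h5
      · rw [map_zsmul, V.comp, smul_smul, mul_comm]
      · exact absurd ⟨h1, hH⟩ h3
      · exact absurd ((S.cov_le h1).trans (S.cov_le hH)) h2
      · exact absurd h5.1 h1
      · simp
      · simp
    · symm
      refine Finset.sum_eq_zero fun F _ => ?_
      split_ifs with h2 h3
      · exact absurd h3.2 hH
      · simp
      · rfl
  rw [Finset.sum_congr rfl fun H _ => this H, Finset.sum_comm]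
  refine Finset.sum_eq_zero fun F _ => ?_
  by_cases h : F ≤ G
  · simp only [dif_pos h]
    rw [← Finset.sum_smul, S.dd, zero_smul]
  · simp [h]

/-- Restriction of cochains. -/
def res (V : Shf A P) (Z : Set P) : (∀ F, V.V F) →ₗ[A] (∀ F, V.V F) :=
  LinearMap.pi fun F => if F ∈ Z then LinearMap.proj F else 0

lemma res_mem (V : Shf A P) {Z : Set P} (c : ∀ F, V.V F) {F : P} (h : F ∈ Z) : res V Z c F = c F := by
  simp [res, h]

lemma res_notMem (V : Shf A P) {Z : Set P} (c : ∀ F, V.V F) {F : P} (h : F ∉ Z) : res V Z c F = 0 := by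
  simp [res, h]

/-- Exactness on `Z`, up to powers of `t`. -/
def TEx (S : PD P) (V : Shf A P) (t : A) (Z : Set P) : Prop :=
  ∀ c : (∀ F, V.V F), (∀ F, F ∉ Z → c F = 0) → (∀ F ∈ Z, dif S V c F = 0) →
    ∃ (N : ℕ) (b : ∀ F, V.V F), (∀ F, F ∉ Z → b F = 0) ∧ ∀ F ∈ Z, dif S V b F = t ^ N • c F

/-- Convexity in the poset. -/
def Cvx (Z : Set P) : Prop := ∀ F ∈ Z, ∀ H ∈ Z, ∀ G, F ≤ G → G ≤ H → G ∈ Z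

/-- `U` is up-closed in `Z`. -/
def UpIn (U Z : Set P) : Prop := ∀ F ∈ U, ∀ G ∈ Z, F ≤ G → G ∈ U

lemma dif_res_dif (S : PD P) (V : Shf A P) {Z : Set P} (hZ : Cvx Z) {b : ∀ F, V.V F}
    (hb : ∀ F, F ∉ Z → b F = 0) {F : P} (hF : F ∈ Z) : dif S V (res V Z (dif S V b)) F = 0 := by
  have := congrFun (dif_dif S V b) F
  rw [Pi.zero_apply] at this
  rw [← this]
  refine dif_congr S V fun G hG => ?_
  by_cases hGZ : G ∈ Z
  · rw [res_mem V _ hGZ]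
  · rw [res_notMem V _ hGZ]
    symm
    refine dif_zero_of S V fun H hH => ?_
    refine hb H fun hHZ => hGZ (hZ H hHZ F hF G (S.cov_le hH) (S.cov_le hG))

lemma TEx.glue {S : PD P} {V : Shf A P} {t : A} {Z U : Set P} (hZ : Cvx Z) (hUZ : U ⊆ Z)
    (hU : UpIn U Z) (h1 : TEx S V t U) (h2 : TEx S V t (Z \ U)) : TEx S V t Z := by
  intro c hc hdc
  obtain ⟨N1, b1, hb1, hd1⟩ := h2 (res V (Z \ U) c) (fun F hF => res_notMem V _ hF) (by
    intro F hF
    rw [← hdc F hF.1]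
    refine dif_congr S V fun G hG => ?_
    by_cases hGZ : G ∈ Z
    · have : G ∉ U := fun hGU => hF.2 (hU G hGU F hF.1 (S.cov_le hG))
      rw [res_mem V (Z := Z \ U) _ ⟨hGZ, this⟩]
    · rw [hc G hGZ, res_notMem V (Z := Z \ U) _ (fun h => hGZ h.1)])
  have hb1Z : ∀ F, F ∉ Z → b1 F = 0 := fun F hF => hb1 F fun h => hF h.1
  obtain ⟨N2, b2, hb2, hd2⟩ := h1 (res V U (t ^ N1 • c - dif S V b1))
    (fun F hF => res_notMem V _ hF) (by
    intro F hF
    have e : dif S V (res V U (t ^ N1 • c - dif S V b1)) F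
        = dif S V (t ^ N1 • c - res V Z (dif S V b1)) F := by
      refine dif_congr S V fun G hG => ?_
      by_cases hGU : G ∈ U
      · rw [res_mem V _ hGU, Pi.sub_apply, Pi.sub_apply, res_mem V _ (hUZ hGU)]
      · rw [res_notMem V _ hGU, Pi.sub_apply]
        by_cases hGZ : G ∈ Z
        · rw [res_mem V _ hGZ, hd1 G ⟨hGZ, hGU⟩, res_mem V (Z := Z \ U) _ ⟨hGZ, hGU⟩, Pi.smul_apply, sub_self]
        · rw [res_notMem V _ hGZ, Pi.smul_apply, hc G hGZ]; simp
    rw [e, map_sub, map_smul, Pi.sub_apply, Pi.smul_apply, hdc F (hUZ hF),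
      dif_res_dif S V hZ hb1Z (hUZ hF)]
    simp)
  refine ⟨N2 + N1, t ^ N2 • b1 + b2, fun F hF => ?_, fun F hF => ?_⟩
  · rw [Pi.add_apply, Pi.smul_apply, hb1Z F hF, hb2 F fun h => hF (hUZ h)]; simp
  · rw [map_add, map_smul, Pi.add_apply, Pi.smul_apply]
    by_cases hFU : F ∈ U
    · rw [hd2 F hFU, res_mem V _ hFU, Pi.sub_apply, Pi.smul_apply, smul_sub, pow_add, mul_smul]
      abel
    · rw [hd1 F ⟨hF, hFU⟩, res_mem V (Z := Z \ U) _ ⟨hF, hFU⟩, pow_add, mul_smul,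
        dif_zero_of S V (c := b2) fun G hG => hb2 G fun hGU => hFU (hU G hGU F hF (S.cov_le hG)),
        add_zero]

lemma TEx.top_part {S : PD P} {V : Shf A P} {t : A} {Z U : Set P} (hZ : Cvx Z) (hUZ : U ⊆ Z)
    (hU : UpIn U Z) (h1 : TEx S V t Z) (h2 : TEx S V t (Z \ U)) : TEx S V t U := by
  intro y hy hdy
  obtain ⟨N, x, hx, hdx⟩ := h1 y (fun F hF => hy F fun h => hF (hUZ h)) (by
    intro F hF
    by_cases hFU : F ∈ U
    · exact hdy F hFU
    · exact dif_zero_of S V fun G hG => hy G fun hGU => hFU (hU G hGU F hF (S.cov_le hG)))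
  obtain ⟨M, w, hw, hdw⟩ := h2 (res V (Z \ U) x) (fun F hF => res_notMem V _ hF) (by
    intro F hF
    have : dif S V x F = 0 := by rw [hdx F hF.1, hy F hF.2, smul_zero]
    rw [← this]
    refine dif_congr S V fun G hG => ?_
    by_cases hGZ : G ∈ Z
    · have : G ∉ U := fun hGU => hF.2 (hU G hGU F hF.1 (S.cov_le hG))
      rw [res_mem V (Z := Z \ U) _ ⟨hGZ, this⟩]
    · rw [hx G hGZ, res_notMem V (Z := Z \ U) _ (fun h => hGZ h.1)])
  have hwZ : ∀ F, F ∉ Z → w F = 0 := fun F hF => hw F fun h => hF h.1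
  refine ⟨M + N, res V U (t ^ M • x - dif S V w), fun F hF => res_notMem V _ hF, fun F hF => ?_⟩
  have e : dif S V (res V U (t ^ M • x - dif S V w)) F
      = dif S V (t ^ M • x - res V Z (dif S V w)) F := by
    refine dif_congr S V fun G hG => ?_
    by_cases hGU : G ∈ U
    · rw [res_mem V _ hGU, Pi.sub_apply, Pi.sub_apply, res_mem V _ (hUZ hGU)]
    · rw [res_notMem V _ hGU, Pi.sub_apply]
      by_cases hGZ : G ∈ Z
      · rw [res_mem V _ hGZ, hdw G ⟨hGZ, hGU⟩, res_mem V (Z := Z \ U) _ ⟨hGZ, hGU⟩, Pi.smul_apply, sub_self]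
      · rw [res_notMem V _ hGZ, Pi.smul_apply, hx G hGZ]; simp
  rw [e, map_sub, map_smul, Pi.sub_apply, Pi.smul_apply, dif_res_dif S V hZ hwZ (hUZ hF),
    hdx F (hUZ hF), sub_zero, smul_smul, pow_add]

lemma TEx.empty (S : PD P) (V : Shf A P) (t : A) : TEx S V t ∅ :=
  fun _ _ _ => ⟨0, 0, fun _ _ => rfl, fun _ hF => absurd hF (Set.notMem_empty _)⟩

lemma TEx.fibers {S : PD P} {V : Shf A P} {t : A} {T : Type} [PartialOrder T] (psi : P → T) :
    ∀ (n : ℕ) (Z : Set P), Z.ncard = n → Cvx Z →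
    (∀ F ∈ Z, ∀ G ∈ Z, F ≤ G → psi F ≤ psi G) →
    (∀ E ∈ psi '' Z, TEx S V t {F | F ∈ Z ∧ psi F = E}) → TEx S V t Z := by
  intro n
  induction n using Nat.strong_induction_on with
  | _ n ih =>
    intro Z hn hZ hmono hfib
    rcases Z.eq_empty_or_nonempty with rfl | hne
    · exact TEx.empty S V t
    obtain ⟨E, hE⟩ := (Set.toFinite (psi '' Z)).exists_maximal (hne.image psi)
    set U : Set P := {F | F ∈ Z ∧ psi F = E} with hUdef
    have hUZ : U ⊆ Z := fun F h => h.1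
    have hUp : UpIn U Z := by
      rintro F ⟨hF, hFE⟩ G hG hle
      refine ⟨hG, ?_⟩
      have h1 := hmono F hF G hG hle
      rw [hFE] at h1
      exact le_antisymm (hE.2 ⟨G, hG, rfl⟩ h1) h1
    refine TEx.glue hZ hUZ hUp (hfib E hE.1) ?_
    refine ih (Z \ U).ncard ?_ (Z \ U) rfl ?_ ?_ ?_
    · rw [← hn]
      refine Set.ncard_lt_ncard ?_ (Set.toFinite _)
      refine ⟨Set.sdiff_subset, fun h => ?_⟩
      obtain ⟨F, hF, hFE⟩ := hE.1
      exact (h hF).2 ⟨hF, hFE⟩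
    · intro F hF H hH G h1 h2
      have hG := hZ F hF.1 H hH.1 G h1 h2
      exact ⟨hG, fun hGU => hH.2 (hUp G hGU H hH.1 h2)⟩
    · exact fun F hF G hG => hmono F hF.1 G hG.1
    · rintro E' ⟨F, hF, rfl⟩
      have hne : psi F ≠ E := fun h => hF.2 ⟨hF.1, h⟩
      have : {G | G ∈ Z \ U ∧ psi G = psi F} = {G | G ∈ Z ∧ psi G = psi F} := by
        ext G
        constructor
        · exact fun h => ⟨h.1.1, h.2⟩
        · exact fun h => ⟨⟨h.1, fun hU => hne (h.2.symm.trans hU.2)⟩, h.2⟩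
      rw [this]
      exact hfib _ ⟨F, hF.1, rfl⟩

lemma smul_pow_bound {W : Type} [AddCommGroup W] [Module A W] {t : A} {x : W} {n m : ℕ} (h : n ≤ m)
    (hx : t ^ n • x = 0) : t ^ m • x = 0 := by
  obtain ⟨j, rfl⟩ := Nat.exists_eq_add_of_le h
  rw [pow_add, mul_comm, mul_smul, hx, smul_zero]

lemma TEx.of_const {S : PD P} {V : Shf A P} {t : A} {Y : Set P} {E : P} (hY : ∀ F ∈ Y, F ≤ E)
    (hc : TEx S (constShf P A (V.V E)) t Y)
    (hinj : ∀ F, ∀ hF : F ∈ Y, ∀ x : V.V F, V.rho (hY F hF) x = 0 → ∃ n : ℕ, t ^ n • x = 0)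
    (hsurj : ∀ F, ∀ hF : F ∈ Y, ∀ w : V.V E, ∃ (n : ℕ) (x : V.V F),
      V.rho (hY F hF) x = t ^ n • w) : TEx S V t Y := by
  intro c hc0 hdc
  set c' : P → V.V E := fun F => if h : F ∈ Y then V.rho (hY F h) (c F) else 0 with hc'
  have key : ∀ (b : ∀ F, V.V F), (∀ F, F ∉ Y → b F = 0) → ∀ G, ∀ hG : G ∈ Y,
      V.rho (hY G hG) (dif S V b G) = dif S (constShf P A (V.V E))
        (fun F => if h : F ∈ Y then V.rho (hY F h) (b F) else (0 : V.V E)) G := by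
    intro b hb G hG
    rw [dif_apply, dif_apply, map_sum]
    refine Finset.sum_congr rfl fun F _ => ?_
    split_ifs with h1 h2
    · rw [map_zsmul, V.comp]; rfl
    · rw [hb F h2]; simp
    · simp
  obtain ⟨N, b', hb', hdb'⟩ := hc c' (fun F hF => by simp only [hc']; rw [dif_neg hF]) (by
    intro G hG
    rw [hc', ← key c hc0 G hG, hdc G hG, map_zero])
  have hs : ∀ F, ∃ (n : ℕ), ∀ m, n ≤ m → ∃ x : V.V F, (F ∉ Y → x = 0) ∧ ∀ hF : F ∈ Y,
      V.rho (hY F hF) x = t ^ m • (b' F : V.V E) := by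
    intro F
    by_cases hF : F ∈ Y
    · obtain ⟨n, x, hx⟩ := hsurj F hF (b' F)
      refine ⟨n, fun m hm => ⟨t ^ (m - n) • x, fun h => absurd hF h, fun _ => ?_⟩⟩
      rw [map_smul, hx, smul_smul, ← pow_add, Nat.sub_add_cancel hm]
    · exact ⟨0, fun m _ => ⟨0, fun _ => rfl, fun h => absurd h hF⟩⟩
  choose n hn using hs
  have hM : ∀ F, n F ≤ ∑ F, n F := fun F => Finset.single_le_sum (fun _ _ => Nat.zero_le _) (Finset.mem_univ F)
  choose b hb0 hb using fun F => hn F (∑ F, n F) (hM F)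
  set M := ∑ F, n F with hMdef
  have hz : ∀ F, ∃ n : ℕ, F ∈ Y → t ^ n • (dif S V b F - t ^ (M + N) • c F) = 0 := by
    intro F
    by_cases hF : F ∈ Y
    · obtain ⟨n, hn⟩ := hinj F hF (dif S V b F - t ^ (M + N) • c F) (by
        rw [map_sub, key b hb0 F hF, map_smul]
        have : dif S (constShf P A (V.V E))
          (fun F => if h : F ∈ Y then V.rho (hY F h) (b F) else (0 : V.V E)) F
          = dif S (constShf P A (V.V E)) (t ^ M • b') F := by
          refine dif_congr _ _ fun G _ => ?_
          by_cases hG : G ∈ Y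
          · simp only [dif_pos hG, Pi.smul_apply]; exact hb G hG
          · simp only [dif_neg hG, Pi.smul_apply, hb' G hG, smul_zero]
        rw [this, map_smul, Pi.smul_apply, hdb' F hF, smul_smul, ← pow_add, sub_eq_zero]
        simp only [hc', dif_pos hF])
      exact ⟨n, fun _ => hn⟩
    · exact ⟨0, fun h => absurd h hF⟩
  choose m hm using hz
  refine ⟨(∑ F, m F) + (M + N), t ^ (∑ F, m F) • b, fun F hF => ?_, fun F hF => ?_⟩
  · rw [Pi.smul_apply, hb0 F hF, smul_zero]
  · have := smul_pow_bound (Finset.single_le_sum (f := m) (fun _ _ => Nat.zero_le _) (Finset.mem_univ F)) (hm F hF)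
    rw [map_smul, Pi.smul_apply, pow_add, mul_smul]
    rw [smul_sub, sub_eq_zero] at this
    exact this

/-- Exactness in degree `i` on `Z`, up to powers of `t`. -/
def TExD (S : PD P) (V : Shf A P) (t : A) (Z : Set P) (i : ℕ) : Prop :=
  ∀ c : (∀ F, V.V F), (∀ F, F ∉ Z → c F = 0) → (∀ F, S.dim F ≠ i → c F = 0) →
    (∀ F ∈ Z, dif S V c F = 0) →
    ∃ (N : ℕ) (b : ∀ F, V.V F), (∀ F, F ∉ Z → b F = 0) ∧ (∀ F, S.dim F + 1 ≠ i → b F = 0) ∧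
      ∀ F ∈ Z, dif S V b F = t ^ N • c F

lemma TEx.deg {S : PD P} {V : Shf A P} {t : A} {Z : Set P} (h : TEx S V t Z) (i : ℕ) :
    TExD S V t Z i := by
  intro c hc hci hdc
  obtain ⟨N, b, hb, hd⟩ := h c hc hdc
  refine ⟨N, res V {F | S.dim F + 1 = i} b, fun F hF => ?_, fun F hF => res_notMem V _ hF, fun F hF => ?_⟩
  · by_cases h : F ∈ {F | S.dim F + 1 = i}
    · rw [res_mem V _ h, hb F hF]
    · rw [res_notMem V _ h]
  · by_cases hFi : S.dim F = i
    · rw [← hd F hF]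
      refine dif_congr S V fun G hG => res_mem V _ ?_
      simp [S.cov_dim hG, hFi]
    · rw [hci F hFi, smul_zero]
      refine dif_zero_of S V fun G hG => res_notMem V _ ?_
      simp [S.cov_dim hG, hFi]

/-- Exactness in degrees `< n`. -/
def Pn (S : PD P) (V : Shf A P) (n : ℕ) : Prop := ∀ i < n, TExD S V 1 Set.univ i

/-- A short exact sequence `0 → V → V → W → 0` of functors, with first map multiplication by `r`. -/
structure SES (V W : Shf A P) (r : A) where
  p : ∀ F, V.V F →ₗ[A] W.V F
  nat : ∀ {F G} (h : F ≤ G) (x : V.V F), p G (V.rho h x) = W.rho h (p F x)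
  surj : ∀ F, Function.Surjective (p F)
  ker : ∀ F x, p F x = 0 → ∃ y, x = r • y
  kill : ∀ F (x : V.V F), p F (r • x) = 0
  inj : ∀ F (x : V.V F), r • x = 0 → x = 0

variable {S : PD P} {V W : Shf A P} {r : A}

lemma SES.dif_nat (T : SES V W r) (c : ∀ F, V.V F) (F : P) :
    T.p F (dif S V c F) = dif S W (fun G => T.p G (c G)) F := by
  rw [dif_apply, dif_apply, map_sum]
  refine Finset.sum_congr rfl fun G _ => ?_
  split_ifs with h
  · rw [map_zsmul, T.nat]
  · simp

lemma SES.lift (T : SES V W r) (Z : Set P) (z : ∀ F, W.V F) (hz : ∀ F, F ∉ Z → z F = 0) :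
    ∃ w : ∀ F, V.V F, (∀ F, F ∉ Z → w F = 0) ∧ ∀ F, T.p F (w F) = z F := by
  choose w hw using fun F => T.surj F (z F)
  refine ⟨res V Z w, fun F hF => res_notMem V _ hF, fun F => ?_⟩
  by_cases hF : F ∈ Z
  · rw [res_mem V _ hF, hw]
  · rw [res_notMem V _ hF, hz F hF, map_zero]

lemma SES.lift_ker (T : SES V W r) (Z : Set P) (z : ∀ F, V.V F) (hz : ∀ F, F ∉ Z → z F = 0)
    (hk : ∀ F, T.p F (z F) = 0) :
    ∃ w : ∀ F, V.V F, (∀ F, F ∉ Z → w F = 0) ∧ z = r • w := by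
  choose w hw using fun F => T.ker F (z F) (hk F)
  refine ⟨w, fun F hF => T.inj F _ (by rw [← hw, hz F hF]), funext fun F => hw F⟩

lemma dif_deg (S : PD P) (V : Shf A P) {i : ℕ} {c : ∀ F, V.V F} (hc : ∀ F, S.dim F ≠ i → c F = 0) {F : P}
    (hF : S.dim F ≠ i + 1) : dif S V c F = 0 :=
  dif_zero_of S V fun G hG => hc G fun h => hF (by rw [← h, S.cov_dim hG])

lemma dif_deg' (S : PD P) (V : Shf A P) {i : ℕ} {c : ∀ F, V.V F} (hc : ∀ F, S.dim F + 1 ≠ i → c F = 0) {F : P}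
    (hF : S.dim F ≠ i) : dif S V c F = 0 :=
  dif_zero_of S V fun G hG => hc G fun h => hF (by rw [← h, S.cov_dim hG])

lemma Pn_iff {n : ℕ} : Pn S V n ↔ ∀ i < n, ∀ c : (∀ F, V.V F), (∀ F, S.dim F ≠ i → c F = 0) →
    dif S V c = 0 → ∃ b : ∀ F, V.V F, (∀ F, S.dim F + 1 ≠ i → b F = 0) ∧ dif S V b = c := by
  constructor
  · intro h i hi c hc hd
    obtain ⟨N, b, -, hb, hdb⟩ := h i hi c (fun F hF => absurd (Set.mem_univ F) hF) hc
      (fun F _ => congrFun hd F)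
    exact ⟨b, hb, funext fun F => by rw [hdb F (Set.mem_univ F), one_pow, one_smul]⟩
  · intro h i hi c _ hc hd
    obtain ⟨b, hb, hdb⟩ := h i hi c hc (funext fun F => hd F (Set.mem_univ F))
    exact ⟨0, b, fun F hF => absurd (Set.mem_univ F) hF, hb, fun F _ => by
      rw [hdb, one_pow, one_smul]⟩

lemma SES.Pn_quot (T : SES V W r) {n : ℕ} (h : Pn S V (n + 1)) : Pn S W n := by
  rw [Pn_iff] at h ⊢
  intro i hi z hz hdz
  obtain ⟨w, hw, hpw⟩ := T.lift {F | S.dim F = i} z hz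
  obtain ⟨u, hu, hdu⟩ := T.lift_ker {F | S.dim F = i + 1} (dif S V w) (fun F hF => dif_deg S V hw hF)
    (fun F => by rw [T.dif_nat, funext hpw, hdz]; rfl)
  obtain ⟨v, hv, hdv⟩ := h (i + 1) (by omega) u hu (funext fun F => T.inj F _ (by
    have := congrFun (dif_dif S V w) F
    rw [hdu, map_smul] at this
    exact this))
  obtain ⟨y, hy, hdy⟩ := h i (by omega) (w - r • v) (fun F hF => by
      rw [Pi.sub_apply, Pi.smul_apply, hw F hF, hv F (by omega)]; simp) (by
      rw [map_sub, map_smul, hdv, hdu, sub_self])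
  refine ⟨fun F => T.p F (y F), fun F hF => by show T.p F (y F) = 0; rw [hy F hF, map_zero], ?_⟩
  funext F
  rw [← T.dif_nat, hdy, Pi.sub_apply, Pi.smul_apply, map_sub, T.kill, hpw, sub_zero]

lemma SES.Pn_of_quot (T : SES V W r) {n : ℕ} (h : Pn S W n)
    (htors : ∀ c : (∀ F, V.V F), dif S V c = 0 → ∃ (N : ℕ) (b : ∀ F, V.V F), dif S V b = r ^ N • c) :
    Pn S V (n + 1) := by
  rw [Pn_iff] at h ⊢
  intro i hi z hz hdz
  -- one step division
  have step : ∀ (c : ∀ F, V.V F), (∀ F, S.dim F ≠ i → c F = 0) →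
      (∃ b : ∀ F, V.V F, (∀ F, S.dim F + 1 ≠ i → b F = 0) ∧ dif S V b = r • c) →
      (∃ b : ∀ F, V.V F, (∀ F, S.dim F + 1 ≠ i → b F = 0) ∧ dif S V b = c) := by
    rintro c hc ⟨y, hy, hdy⟩
    obtain ⟨w, hw, hdw⟩ : ∃ b : ∀ F, W.V F, (∀ F, S.dim F + 1 + 1 ≠ i → b F = 0) ∧
        dif S W b = fun F => T.p F (y F) := by
      rcases i with _ | i
      · refine ⟨0, fun _ _ => rfl, ?_⟩
        funext F
        rw [hy F (by omega), map_zero, map_zero]; rfl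
      · obtain ⟨w, hw, hdw⟩ := h i (by omega) (fun F => T.p F (y F))
          (fun F hF => by rw [hy F (by omega), map_zero]) (by
          funext F
          rw [← T.dif_nat, hdy, Pi.smul_apply, T.kill]; rfl)
        exact ⟨w, fun F hF => hw F (by omega), hdw⟩
    obtain ⟨w', hw', hpw'⟩ := T.lift {F | S.dim F + 1 + 1 = i} w hw
    obtain ⟨v, hv, hyv⟩ := T.lift_ker {F | S.dim F + 1 = i} (y - dif S V w') (fun F hF => by
        have : dif S V w' F = 0 := dif_zero_of S V fun G hG => hw' G fun h' => hF (by
          have := S.cov_dim hG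
          simp only [Set.mem_ofPred_eq] at h' ⊢; omega)
        rw [Pi.sub_apply, hy F hF, this, sub_zero]) (fun F => by
        rw [Pi.sub_apply, map_sub, T.dif_nat, funext hpw', hdw, sub_self])
    refine ⟨v, hv, funext fun F => ?_⟩
    rw [← sub_eq_zero]
    apply T.inj
    have e : dif S V (y - dif S V w') F = dif S V (r • v) F := by rw [hyv]
    rw [map_sub, dif_dif, sub_zero, hdy, map_smul] at e
    rw [smul_sub, sub_eq_zero]
    exact e.symm
  obtain ⟨N, b, hb⟩ := htors z hdz
  have hb' : ∃ b : ∀ F, V.V F, (∀ F, S.dim F + 1 ≠ i → b F = 0) ∧ dif S V b = r ^ N • z := by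
    refine ⟨res V {F | S.dim F + 1 = i} b, fun F hF => res_notMem V _ hF, ?_⟩
    funext F
    by_cases hF : S.dim F = i
    · rw [← hb]
      exact dif_congr S V fun G hG => res_mem V _ (by simp [S.cov_dim hG, hF])
    · rw [Pi.smul_apply, hz F hF, smul_zero]
      exact dif_zero_of S V fun G hG => res_notMem V _ (by simp [S.cov_dim hG, hF])
  clear hb b
  induction N with
  | zero => simpa using hb'
  | succ N ih =>
    refine ih (step (r ^ N • z) (fun F hF => by rw [Pi.smul_apply, hz F hF, smul_zero]) ?_)
    rwa [smul_smul, ← pow_succ']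

end Poset


section B2
/-! ### Minkowski and Weyl and basic facts on faces -/

lemma minkowski_weyl (T : Finset (L d)) : ∃ Lam : Finset (L d →ₗ[ℤ] ℤ), ∀ x : L d,
    (∀ l ∈ Lam, 0 ≤ l x) ↔ ∃ n : ℕ, 0 < n ∧ n • x ∈ AddSubmonoid.closure (T : Set (L d)) := by
  induction T using Finset.induction_on with
  | empty =>
    refine ⟨(Finset.univ.image fun i : Fin d => (LinearMap.proj i : L d →ₗ[ℤ] ℤ)) ∪
      (Finset.univ.image fun i : Fin d => -(LinearMap.proj i : L d →ₗ[ℤ] ℤ)), fun x => ?_⟩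
    constructor
    · intro h
      refine ⟨1, one_pos, ?_⟩
      have : x = 0 := by
        funext i
        have h1 := h (LinearMap.proj i) (Finset.mem_union_left _ (Finset.mem_image_of_mem _ (Finset.mem_univ i)))
        have h2 := h (-LinearMap.proj i) (Finset.mem_union_right _ (Finset.mem_image.2 ⟨i, Finset.mem_univ i, rfl⟩))
        simp only [LinearMap.neg_apply, LinearMap.proj_apply, Pi.zero_apply] at h1 h2 ⊢
        omega
      rw [this, smul_zero]
      exact zero_mem _
    · rintro ⟨n, hn, h⟩
      simp only [Finset.coe_empty, AddSubmonoid.closure_empty, AddSubmonoid.mem_bot] at h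
      have : x = 0 := by
        rcases smul_eq_zero.1 h with h | h
        · omega
        · exact h
      simp [this]
  | insert v T hv ih =>
    obtain ⟨Lam, hL⟩ := ih
    refine ⟨(Lam.filter fun l => 0 ≤ l v) ∪
      ((Lam ×ˢ Lam).filter fun p => 0 < p.1 v ∧ p.2 v < 0).image
        (fun p => (-(p.2 v)) • p.1 + (p.1 v) • p.2), fun x => ?_⟩
    have hpos : ∀ w ∈ AddSubmonoid.closure (T : Set (L d)), ∀ l ∈ Lam, 0 ≤ l w := by
      intro w hw
      exact (hL w).2 ⟨1, one_pos, by simpa using hw⟩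
    constructor
    · intro h
      have h1 : ∀ l ∈ Lam, 0 ≤ l v → 0 ≤ l x := fun l hl hlv =>
        h l (Finset.mem_union_left _ (Finset.mem_filter.2 ⟨hl, hlv⟩))
      have h2 : ∀ l ∈ Lam, ∀ m ∈ Lam, 0 < l v → m v < 0 → 0 ≤ (-(m v)) * l x + l v * m x := by
        intro l hl m hm hlv hmv
        have := h _ (Finset.mem_union_right _ (Finset.mem_image.2 ⟨(l, m),
          Finset.mem_filter.2 ⟨Finset.mem_product.2 ⟨hl, hm⟩, hlv, hmv⟩, rfl⟩))
        simpa using this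
      -- find `n, t`
      obtain ⟨n, t, hn, hnt⟩ : ∃ n t : ℕ, 0 < n ∧ ∀ l ∈ Lam, 0 ≤ l (n • x - t • v) := by
        by_cases hneg : ∃ m ∈ Lam, m v < 0 ∧ m x < 0
        · obtain ⟨m', hm', hm'v, hm'x⟩ := hneg
          obtain ⟨m0, hm0, hmax⟩ := (Lam.filter fun m => m v < 0).exists_max_image
            (fun m => (m x : ℚ) / (m v : ℚ)) ⟨m', Finset.mem_filter.2 ⟨hm', hm'v⟩⟩
          rw [Finset.mem_filter] at hm0
          have hc : ∀ m ∈ Lam, m v < 0 → m x * m0 v ≤ m0 x * m v := by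
            intro m hm hmv
            have := hmax m (Finset.mem_filter.2 ⟨hm, hmv⟩)
            have a1 : (m v : ℚ) < 0 := by exact_mod_cast hmv
            have a2 : (m0 v : ℚ) < 0 := by exact_mod_cast hm0.2
            rw [← neg_div_neg_eq, ← neg_div_neg_eq (m0 x : ℚ), div_le_div_iff₀ (by linarith) (by linarith)] at this
            have : (m x * m0 v : ℚ) ≤ m0 x * m v := by linarith
            exact_mod_cast this
          have hm0x : m0 x < 0 := by
            have := hc m' hm' hm'v
            by_contra hcon
            have h3 : 0 < m' x * m0 v := mul_pos_of_neg_of_neg hm'x hm0.2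
            have h4 : m0 x * m' v ≤ 0 := mul_nonpos_of_nonneg_of_nonpos (by omega) hm'v.le
            omega
          refine ⟨(m0 v).natAbs, (m0 x).natAbs, by have := hm0.2; omega, fun l hl => ?_⟩
          rw [map_sub, map_nsmul, map_nsmul, nsmul_eq_mul, nsmul_eq_mul,
            Int.natCast_natAbs, Int.natCast_natAbs, abs_of_neg hm0.2, abs_of_neg hm0x]
          rcases lt_trichotomy (l v) 0 with hlv | hlv | hlv
          · have := hc l hl hlv
            nlinarith
          · rw [hlv]
            have := h1 l hl hlv.ge
            have := hm0.2
            nlinarith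
          · have := h2 l hl m0 hm0.1 hlv hm0.2
            nlinarith
        · push Not at hneg
          refine ⟨1, 0, one_pos, fun l hl => ?_⟩
          simp only [one_smul, zero_smul, sub_zero]
          by_cases hlv : 0 ≤ l v
          · exact h1 l hl hlv
          · exact hneg l hl (by omega)
      obtain ⟨m, hm, hmem⟩ := (hL _).1 hnt
      refine ⟨m * n, Nat.mul_pos hm hn, ?_⟩
      have e : (m * n) • x = m • (n • x - t • v) + (m * t) • v := by
        rw [smul_sub, mul_smul, mul_smul]; abel
      rw [e]
      refine add_mem (AddSubmonoid.closure_mono (by simp) hmem) (nsmul_mem (AddSubmonoid.subset_closure (by simp)) _)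
    · rintro ⟨n, hn, hx⟩
      rw [Finset.coe_insert, Set.insert_eq, AddSubmonoid.closure_union, AddSubmonoid.mem_sup] at hx
      obtain ⟨y, hy, w, hw, hyw⟩ := hx
      rw [AddSubmonoid.mem_closure_singleton] at hy
      obtain ⟨t, rfl⟩ := hy
      have key : ∀ l : L d →ₗ[ℤ] ℤ, 0 ≤ l v → 0 ≤ l w → 0 ≤ l x := by
        intro l h1 h2
        have : (n : ℤ) * l x = t * l v + l w := by
          have := congrArg l hyw
          rw [map_add, map_nsmul, map_nsmul, nsmul_eq_mul, nsmul_eq_mul] at this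
          exact this.symm
        have h3 : 0 ≤ (n : ℤ) * l x := by rw [this]; positivity
        exact nonneg_of_mul_nonneg_right h3 (by exact_mod_cast hn)
      intro l hl
      rcases Finset.mem_union.1 hl with hl | hl
      · rw [Finset.mem_filter] at hl
        exact key l hl.2 (hpos w hw l hl.1)
      · obtain ⟨⟨a, b⟩, hab, rfl⟩ := Finset.mem_image.1 hl
        simp only [Finset.mem_filter, Finset.mem_product] at hab
        obtain ⟨⟨ha, hb⟩, hav, hbv⟩ := hab
        refine key _ ?_ ?_
        · simp only [LinearMap.add_apply, LinearMap.smul_apply, smul_eq_mul]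
          nlinarith
        · simp only [LinearMap.add_apply, LinearMap.smul_apply, smul_eq_mul]
          have h1 := hpos w hw a ha
          have h2 := hpos w hw b hb
          have h3 : 0 ≤ -(b v) := by omega
          positivity

/-- `Lam` is a finite set of inequalities describing `Q`. -/
def HR (Q : AddSubmonoid (L d)) (Lam : Finset (L d →ₗ[ℤ] ℤ)) : Prop :=
  ∀ x, x ∈ Q ↔ ∀ l ∈ Lam, 0 ≤ l x

lemma exists_HR (hQ : IsNormalAffineSemigroup Q) : ∃ Lam, HR Q Lam := by
  obtain ⟨T, hT⟩ := hQ.fg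
  obtain ⟨Lam, h⟩ := minkowski_weyl T
  refine ⟨Lam, fun x => ?_⟩
  rw [h, hT]
  constructor
  · exact fun hx => ⟨1, one_pos, by simpa using hx⟩
  · rintro ⟨n, hn, hx⟩
    exact hQ.saturated x n hn hx

variable {Q}

lemma IsFace.le {F : AddSubmonoid (L d)} (hF : IsFace Q F) : F ≤ Q := by
  obtain ⟨l, -, h⟩ := hF
  intro x hx
  have : x ∈ (F : Set (L d)) := hx
  rw [h] at this
  exact this.1

lemma IsFace.exposed {F : AddSubmonoid (L d)} (hF : IsFace Q F) : ∃ l : L d →ₗ[ℤ] ℤ,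
    (∀ x ∈ Q, 0 ≤ l x) ∧ ∀ x, x ∈ F ↔ x ∈ Q ∧ l x = 0 := by
  obtain ⟨l, h1, h⟩ := hF
  refine ⟨l, h1, fun x => ?_⟩
  rw [← SetLike.mem_coe, h]; rfl

lemma IsFace.left {F : AddSubmonoid (L d)} (hF : IsFace Q F) {x y : L d} (hx : x ∈ Q) (hy : y ∈ Q)
    (h : x + y ∈ F) : x ∈ F := by
  obtain ⟨l, h1, h2⟩ := hF.exposed
  rw [h2] at h ⊢
  have := h.2
  rw [map_add] at this
  have a := h1 x hx
  have b := h1 y hy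
  exact ⟨hx, by omega⟩

lemma IsFace.right {F : AddSubmonoid (L d)} (hF : IsFace Q F) {x y : L d} (hx : x ∈ Q) (hy : y ∈ Q)
    (h : x + y ∈ F) : y ∈ F := hF.left hy hx (by rwa [add_comm])

lemma IsFace.of_nsmul {F : AddSubmonoid (L d)} (hF : IsFace Q F) {x : L d} (hx : x ∈ Q) {n : ℕ} (hn : 0 < n)
    (h : n • x ∈ F) : x ∈ F := by
  obtain ⟨m, rfl⟩ := Nat.exists_eq_succ_of_ne_zero hn.ne'
  rw [succ_nsmul] at h
  exact hF.right (nsmul_mem hx m) hx h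

/-- The face of `Q` cut out by a functional nonnegative on `Q`. -/
def fc (Q : AddSubmonoid (L d)) (l : L d →ₗ[ℤ] ℤ) : AddSubmonoid (L d) :=
  Q ⊓ (LinearMap.ker l).toAddSubmonoid

lemma mem_fc {l : L d →ₗ[ℤ] ℤ} {x : L d} : x ∈ fc Q l ↔ x ∈ Q ∧ l x = 0 := by
  simp [fc, AddSubmonoid.mem_inf]

lemma isFace_fc {l : L d →ₗ[ℤ] ℤ} (h : ∀ x ∈ Q, 0 ≤ l x) : IsFace Q (fc Q l) :=
  ⟨l, h, by ext x; exact mem_fc⟩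

lemma IsFace.inf {F G : AddSubmonoid (L d)} (hF : IsFace Q F) (hG : IsFace Q G) : IsFace Q (F ⊓ G) := by
  obtain ⟨l, h1, h2⟩ := hF.exposed
  obtain ⟨m, h3, h4⟩ := hG.exposed
  refine ⟨l + m, fun x hx => add_nonneg (h1 x hx) (h3 x hx), ?_⟩
  ext x
  simp only [AddSubmonoid.coe_inf, Set.mem_inter_iff, SetLike.mem_coe, h2, h4, Set.mem_ofPred_eq,
    LinearMap.add_apply]
  constructor
  · rintro ⟨⟨a, b⟩, -, c⟩; exact ⟨a, by omega⟩
  · rintro ⟨a, b⟩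
    have := h1 x a
    have := h3 x a
    exact ⟨⟨a, by omega⟩, a, by omega⟩

/-- The type of faces of `Q`. -/
abbrev Face (Q : AddSubmonoid (L d)) : Type := {F : AddSubmonoid (L d) // IsFace Q F}

lemma finite_face (hQ : Q.FG) : Finite (Face Q) := by
  obtain ⟨T, hT⟩ := hQ
  have key : ∀ F : AddSubmonoid (L d), IsFace Q F →
      F = AddSubmonoid.closure ((T.filter fun t => t ∈ F : Finset (L d)) : Set (L d)) := by
    intro F hF
    apply le_antisymm
    · intro x hx
      have hxQ : x ∈ AddSubmonoid.closure (T : Set (L d)) := by rw [hT]; exact hF.le hx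
      revert hx
      refine AddSubmonoid.closure_induction (motive := fun x _ => x ∈ F → x ∈ AddSubmonoid.closure
        ((T.filter fun t => t ∈ F : Finset (L d)) : Set (L d))) ?_ ?_ ?_ hxQ
      · intro t ht htF
        exact AddSubmonoid.subset_closure (by simpa using ⟨ht, htF⟩)
      · intro _; exact zero_mem _
      · intro x y hx hy ihx ihy hxy
        rw [hT] at hx hy
        exact add_mem (ihx (hF.left hx hy hxy)) (ihy (hF.right hx hy hxy))
    · rw [AddSubmonoid.closure_le]
      intro t ht
      simp only [Finset.coe_filter, Set.mem_ofPred_eq] at ht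
      exact ht.2
  refine Finite.of_injective (β := T.powerset) (fun F => ⟨T.filter fun t => t ∈ F.1, by simp⟩) ?_
  intro F G h
  have h' : (T.filter fun t => t ∈ F.1) = T.filter fun t => t ∈ G.1 := congrArg Subtype.val h
  apply Subtype.ext
  rw [key F.1 F.2, key G.1 G.2, h']

variable {Lam : Finset (L d →ₗ[ℤ] ℤ)}

lemma HR.nonneg (h : HR Q Lam) {x : L d} (hx : x ∈ Q) {l : L d →ₗ[ℤ] ℤ} (hl : l ∈ Lam) : 0 ≤ l x :=
  (h x).1 hx l hl

lemma HR.push (h : HR Q Lam) {q x : L d} (hq : q ∈ Q) (hx : ∀ l ∈ Lam, l q = 0 → 0 ≤ l x) :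
    ∃ N0 : ℕ, ∀ N, N0 ≤ N → N • q + x ∈ Q := by
  refine ⟨∑ l ∈ Lam, (l x).natAbs, fun N hN => (h _).2 fun l hl => ?_⟩
  rw [map_add, map_nsmul, nsmul_eq_mul]
  rcases (h.nonneg hq hl).eq_or_lt with h0 | h0
  · rw [← h0, mul_zero, zero_add]; exact hx l hl h0.symm
  · have h1 : (l x).natAbs ≤ N :=
      (Finset.single_le_sum (f := fun l : L d →ₗ[ℤ] ℤ => (l x).natAbs) (fun _ _ => Nat.zero_le _) hl).trans hN
    have h2 : (N : ℤ) ≤ N * l q := by nlinarith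
    omega

/-- `q` is a point in the relative interior of `E`. -/
def Gen (Lam : Finset (L d →ₗ[ℤ] ℤ)) (E : AddSubmonoid (L d)) (q : L d) : Prop :=
  q ∈ E ∧ ∀ l ∈ Lam, l q = 0 → ∀ x ∈ E, l x = 0

lemma HR.le_of_gen (h : HR Q Lam) {E G : AddSubmonoid (L d)} (hE : IsFace Q E) (hG : IsFace Q G)
    {q : L d} (hq : Gen Lam E q) (hqG : q ∈ G) : E ≤ G := by
  intro x hx
  obtain ⟨N0, hN⟩ := h.push (x := -x) (hE.le hq.1) (fun l hl h0 => by
    rw [map_neg, hq.2 l hl h0 x hx]; simp)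
  refine hG.right (hN N0 le_rfl) (hE.le hx) ?_
  rw [neg_add_cancel_right]
  exact nsmul_mem hqG _

lemma HR.exists_gen (h : HR Q Lam) {E : AddSubmonoid (L d)} (hE : IsFace Q E) : ∃ q, Gen Lam E q := by
  have : ∀ l : L d →ₗ[ℤ] ℤ, ∃ e ∈ E, l e = 0 → ∀ x ∈ E, l x = 0 := by
    intro l
    by_cases hl : ∃ e ∈ E, l e ≠ 0
    · obtain ⟨e, he, hne⟩ := hl
      exact ⟨e, he, fun h => absurd h hne⟩
    · push Not at hl
      exact ⟨0, zero_mem _, fun _ => hl⟩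
  choose e he1 he2 using this
  refine ⟨∑ l ∈ Lam, e l, sum_mem fun l _ => he1 l, fun l hl h0 => he2 l ?_⟩
  rw [map_sum, Finset.sum_eq_zero_iff_of_nonneg (fun m _ => h.nonneg (hE.le (he1 m)) hl)] at h0
  exact h0 l hl

lemma HR.gen_add (h : HR Q Lam) {E : AddSubmonoid (L d)} (hE : IsFace Q E) {q x : L d}
    (hq : Gen Lam E q) (hx : x ∈ E) : Gen Lam E (q + x) := by
  refine ⟨add_mem hq.1 hx, fun l hl h0 => hq.2 l hl ?_⟩
  rw [map_add] at h0
  have := h.nonneg (hE.le hx) hl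
  have := h.nonneg (hE.le hq.1) hl
  omega

lemma HR.gen_of_nsmul (h : HR Q Lam) {E : AddSubmonoid (L d)} (hE : IsFace Q E) {q : L d} (hq : q ∈ Q)
    {n : ℕ} (hn : 0 < n) (hg : Gen Lam E (n • q)) : Gen Lam E q := by
  refine ⟨hE.of_nsmul hq hn hg.1, fun l hl h0 => hg.2 l hl ?_⟩
  rw [map_nsmul, h0, smul_zero]

lemma HR.exists_face_gen (h : HR Q Lam) {q : L d} (hq : q ∈ Q) : ∃ E, IsFace Q E ∧ Gen Lam E q := by
  refine ⟨fc Q (∑ l ∈ Lam.filter (fun l => l q = 0), l), isFace_fc ?_, mem_fc.2 ⟨hq, ?_⟩, ?_⟩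
  · intro x hx
    rw [LinearMap.sum_apply]
    exact Finset.sum_nonneg fun l hl => h.nonneg hx (Finset.mem_filter.1 hl).1
  · rw [LinearMap.sum_apply]
    exact Finset.sum_eq_zero fun l hl => (Finset.mem_filter.1 hl).2
  · intro l hl h0 x hx
    rw [mem_fc, LinearMap.sum_apply, Finset.sum_eq_zero_iff_of_nonneg
      (fun l hl => h.nonneg hx.1 (Finset.mem_filter.1 hl).1)] at hx
    exact hx.2 l (Finset.mem_filter.2 ⟨hl, h0⟩)

lemma HR.isFace_zero (h : HR Q Lam) (hQ : IsNormalAffineSemigroup Q) : IsFace Q ⊥ := by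
  obtain ⟨E, hE, hg⟩ := h.exists_face_gen (zero_mem Q)
  convert hE
  symm
  rw [eq_bot_iff]
  intro x hx
  refine hQ.pointed x (hE.le hx) ((h _).2 fun l hl => ?_)
  rw [map_neg, hg.2 l hl (map_zero l) x hx]; simp

end B2


section B3
/-! ### Dimensions of faces -/

lemma faceDim_eq (F : AddSubmonoid (L d)) :
    faceDim F = Module.finrank ℤ (Submodule.span ℤ (F : Set (L d))) := by
  have h : (Submodule.span ℤ (F : Set (L d))).toAddSubgroup = AddSubgroup.closure (F : Set (L d)) :=
    Submodule.span_int_eq_addSubgroupClosure _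
  rw [faceDim, ← h]
  rfl

lemma rk_nullity {M N : Type} [AddCommGroup M] [AddCommGroup N] [Module.Finite ℤ M] (f : M →ₗ[ℤ] N) :
    Module.finrank ℤ (LinearMap.range f) + Module.finrank ℤ (LinearMap.ker f) = Module.finrank ℤ M := by
  rw [← (LinearMap.ker f).finrank_quotient_add_finrank, f.quotKerEquivRange.finrank_eq]

lemma rk_R1 {A B : Submodule ℤ (L d)} (hAB : A ≤ B) (mu : L d →ₗ[ℤ] ℤ) (hA : ∀ x ∈ A, mu x = 0)
    {b : L d} (hb : b ∈ B) (hmb : mu b ≠ 0) : Module.finrank ℤ A + 1 ≤ Module.finrank ℤ B := by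
  have h := rk_nullity (mu.comp B.subtype)
  have h1 : 1 ≤ Module.finrank ℤ (LinearMap.range (mu.comp B.subtype)) := by
    rw [Nat.one_le_iff_ne_zero]
    intro h0
    rw [Module.finrank_eq_zero_iff] at h0
    obtain ⟨a, ha, h2⟩ := h0 ⟨mu b, ⟨⟨b, hb⟩, rfl⟩⟩
    have h3 : a * mu b = 0 := congrArg Subtype.val h2
    rw [mul_eq_zero] at h3
    tauto
  have h2 : Module.finrank ℤ A ≤ Module.finrank ℤ (LinearMap.ker (mu.comp B.subtype)) := by
    let f : A →ₗ[ℤ] LinearMap.ker (mu.comp B.subtype) :=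
      LinearMap.codRestrict _ (Submodule.inclusion hAB) (fun x => hA x x.2)
    refine LinearMap.finrank_le_finrank_of_injective (f := f) ?_
    intro x y hxy
    have h9 := congrArg Subtype.val (congrArg Subtype.val hxy)
    exact Subtype.ext h9
  omega

lemma rk_R3 {A B : Submodule ℤ (L d)} (hAB : A ≤ B) (h : Module.finrank ℤ B ≤ Module.finrank ℤ A)
    {x : L d} (hx : x ∈ B) : ∃ n : ℤ, n ≠ 0 ∧ n • x ∈ A := by
  have h1 := rk_nullity (A.mkQ.comp B.subtype)
  have h2 : Module.finrank ℤ A ≤ Module.finrank ℤ (LinearMap.ker (A.mkQ.comp B.subtype)) := by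
    let f : A →ₗ[ℤ] LinearMap.ker (A.mkQ.comp B.subtype) :=
      LinearMap.codRestrict _ (Submodule.inclusion hAB) (fun x => by simp)
    refine LinearMap.finrank_le_finrank_of_injective (f := f) ?_
    intro x y hxy
    have h9 := congrArg Subtype.val (congrArg Subtype.val hxy)
    exact Subtype.ext h9
  have h3 : Module.finrank ℤ (LinearMap.range (A.mkQ.comp B.subtype)) = 0 := by omega
  rw [Module.finrank_eq_zero_iff] at h3
  obtain ⟨n, hn, h4⟩ := h3 ⟨A.mkQ x, ⟨⟨x, hx⟩, rfl⟩⟩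
  refine ⟨n, hn, ?_⟩
  have h5 : n • A.mkQ x = 0 := congrArg Subtype.val h4
  rw [← map_smul] at h5
  simpa using h5

lemma rk_R2 {A : Submodule ℤ (L d)} {X : Set (L d)} (h : ∀ x ∈ X, ∃ n : ℤ, n ≠ 0 ∧ n • x ∈ A) :
    Module.finrank ℤ (Submodule.span ℤ X) ≤ Module.finrank ℤ A := by
  have h1 : ∀ x ∈ Submodule.span ℤ X, ∃ n : ℤ, n ≠ 0 ∧ n • x ∈ A := by
    intro x hx
    induction hx using Submodule.span_induction with
    | mem x hx => exact h x hx
    | zero => exact ⟨1, one_ne_zero, by simp⟩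
    | add x y _ _ hx hy =>
      obtain ⟨n, hn, hx⟩ := hx
      obtain ⟨m, hm, hy⟩ := hy
      refine ⟨n * m, mul_ne_zero hn hm, ?_⟩
      rw [smul_add]
      refine add_mem ?_ ?_
      · rw [mul_comm, mul_smul]; exact A.smul_mem _ hx
      · rw [mul_smul]; exact A.smul_mem _ hy
    | smul a x _ hx =>
      obtain ⟨n, hn, hx⟩ := hx
      exact ⟨n, hn, by rw [smul_comm]; exact A.smul_mem _ hx⟩
  have h2 := rk_nullity (A.mkQ.comp (Submodule.span ℤ X).subtype)
  have h3 : Module.finrank ℤ (LinearMap.range (A.mkQ.comp (Submodule.span ℤ X).subtype)) = 0 := by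
    rw [Module.finrank_eq_zero_iff]
    rintro ⟨_, ⟨x, rfl⟩⟩
    obtain ⟨n, hn, hx⟩ := h1 x x.2
    refine ⟨n, hn, Subtype.ext ?_⟩
    show n • A.mkQ x.1 = 0
    rw [← map_smul]
    simpa using hx
  have h4 : Module.finrank ℤ (LinearMap.ker (A.mkQ.comp (Submodule.span ℤ X).subtype)) ≤ Module.finrank ℤ A := by
    let f : LinearMap.ker (A.mkQ.comp (Submodule.span ℤ X).subtype) →ₗ[ℤ] A :=
      LinearMap.codRestrict _ ((Submodule.span ℤ X).subtype.comp (Submodule.subtype _))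
        (fun x => (Submodule.Quotient.mk_eq_zero A).1 x.2)
    refine LinearMap.finrank_le_finrank_of_injective (f := f) ?_
    intro x y hxy
    have h9 := congrArg Subtype.val hxy
    exact Subtype.ext (Subtype.ext h9)
  omega

lemma rk_sup_one (A : Submodule ℤ (L d)) (v : L d) :
    Module.finrank ℤ (A ⊔ Submodule.span ℤ {v} : Submodule ℤ (L d)) ≤ Module.finrank ℤ A + 1 := by
  have h : (A ⊔ Submodule.span ℤ {v} : Submodule ℤ (L d)) =
      LinearMap.range (A.subtype.coprod (LinearMap.toSpanSingleton ℤ (L d) v)) := by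
    rw [LinearMap.range_coprod, Submodule.range_subtype, LinearMap.range_toSpanSingleton]
  rw [h]
  refine (LinearMap.finrank_range_le _).trans ?_
  rw [Module.finrank_prod, Module.finrank_self]

variable {Q}

lemma faceDim_lt {F E : AddSubmonoid (L d)} (hF : IsFace Q F) (hE : IsFace Q E) (h : F < E) :
    faceDim F < faceDim E := by
  obtain ⟨mu, h1, h2⟩ := hF.exposed
  obtain ⟨e, he, hne⟩ := SetLike.exists_of_lt h
  rw [faceDim_eq, faceDim_eq]
  refine rk_R1 (Submodule.span_mono (fun x hx => h.le hx)) mu ?_ (b := e) (Submodule.subset_span he) ?_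
  · intro x hx
    have : Submodule.span ℤ (F : Set (L d)) ≤ LinearMap.ker mu := by
      rw [Submodule.span_le]
      intro y hy
      exact ((h2 y).1 hy).2
    exact this hx
  · intro h0
    exact hne ((h2 e).2 ⟨hE.le he, h0⟩)

lemma faceDim_le {F E : AddSubmonoid (L d)} (hF : IsFace Q F) (hE : IsFace Q E) (h : F ≤ E) :
    faceDim F ≤ faceDim E := by
  rcases h.eq_or_lt with rfl | h
  · exact le_rfl
  · exact (faceDim_lt hF hE h).le

lemma face_eq_of_le {F E : AddSubmonoid (L d)} (hF : IsFace Q F) (hE : IsFace Q E) (h : F ≤ E)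
    (hd : faceDim E ≤ faceDim F) : F = E := by
  by_contra hne
  have := faceDim_lt hF hE (lt_of_le_of_ne h hne)
  omega

variable {Lam : Finset (L d →ₗ[ℤ] ℤ)}

lemma HR.sep (h : HR Q Lam) {G : AddSubmonoid (L d)} (hG : IsFace Q G) {g e : L d} (hg : g ∈ G)
    (he : e ∈ Q) (hne : e ∉ G) : ∃ l ∈ Lam, l g = 0 ∧ 0 < l e := by
  by_contra hcon
  push Not at hcon
  obtain ⟨N, hN⟩ := h.push (q := g) (x := -e) (hG.le hg) (fun l hl h0 => by
    rw [map_neg]; have := hcon l hl h0; omega)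
  refine hne (hG.right (hN N le_rfl) he ?_)
  rw [neg_add_cancel_right]
  exact nsmul_mem hg _

lemma HR.ratio (h : HR Q Lam) {g e x : L d} (hg : g ∈ Q) (he : e ∈ Q) (hx : x ∈ Q)
    (hex : ∃ l ∈ Lam, l g = 0 ∧ 0 < l e) :
    ∃ l0 ∈ Lam, l0 g = 0 ∧ 0 < l0 e ∧ ∃ N : ℕ, N • g + (l0 e • x - l0 x • e) ∈ Q := by
  obtain ⟨l', hl', hl'g, hl'e⟩ := hex
  obtain ⟨l0, hl0, hmin⟩ := (Lam.filter fun l => l g = 0 ∧ 0 < l e).exists_min_image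
    (fun l => (l x : ℚ) / (l e : ℚ)) ⟨l', Finset.mem_filter.2 ⟨hl', hl'g, hl'e⟩⟩
  rw [Finset.mem_filter] at hl0
  obtain ⟨hl0, h0g, h0e⟩ := hl0
  obtain ⟨N, hN⟩ := h.push (q := g) (x := l0 e • x - l0 x • e) hg (by
    intro l hl hlg
    rw [map_sub, map_smul, map_smul, smul_eq_mul, smul_eq_mul]
    rcases (h.nonneg he hl).eq_or_lt with h1 | h1
    · rw [← h1, mul_zero, sub_zero]
      exact mul_nonneg h0e.le (h.nonneg hx hl)
    · have := hmin l (Finset.mem_filter.2 ⟨hl, hlg, h1⟩)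
      rw [div_le_div_iff₀ (by exact_mod_cast h0e) (by exact_mod_cast h1)] at this
      have : l0 x * l e ≤ l x * l0 e := by exact_mod_cast this
      nlinarith)
  exact ⟨l0, hl0, h0g, h0e, N, hN N le_rfl⟩

lemma zsmul_mem_of_nonneg {F : AddSubmonoid (L d)} {x : L d} (hx : x ∈ F) {n : ℤ} (hn : 0 ≤ n) : n • x ∈ F := by
  lift n to ℕ using hn
  rw [natCast_zsmul]
  exact nsmul_mem hx n

/-- A maximal proper subface has codimension one. -/
lemma HR.faceDim_max (h : HR Q Lam) {G E : AddSubmonoid (L d)} (hG : IsFace Q G) (hE : IsFace Q E) (hlt : G < E)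
    (hmax : ∀ F, IsFace Q F → G ≤ F → F < E → F = G) : faceDim G + 1 = faceDim E := by
  obtain ⟨g, hg⟩ := h.exists_gen hG
  obtain ⟨e, he⟩ := h.exists_gen hE
  have heG : e ∉ G := fun h' => hlt.not_ge (h.le_of_gen hE hG he h')
  have h1 : faceDim E ≤ faceDim G + 1 := by
    rw [faceDim_eq, faceDim_eq]
    refine le_trans (rk_R2 (A := Submodule.span ℤ (G : Set (L d)) ⊔ Submodule.span ℤ {e}) ?_)
      (rk_sup_one _ e)
    intro x hx
    obtain ⟨l0, hl0, h0g, h0e, N, hN⟩ := h.ratio (hG.le hg.1) (hE.le he.1) (hE.le hx)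
      (h.sep hG hg.1 (hE.le he.1) heG)
    have h0x := h.nonneg (hE.le hx) hl0
    refine ⟨l0 e, h0e.ne', ?_⟩
    have hw : N • g + (l0 e • x - l0 x • e) ∈ E := by
      refine hE.left hN (zsmul_mem_of_nonneg (hE.le he.1) h0x) ?_
      have : N • g + (l0 e • x - l0 x • e) + l0 x • e = N • g + l0 e • x := by abel
      rw [this]
      exact add_mem (nsmul_mem (hlt.le hg.1) _) (zsmul_mem_of_nonneg hx h0e.le)
    have hEG : E ⊓ fc Q l0 = G := by
      refine hmax _ (hE.inf (isFace_fc fun y hy => h.nonneg hy hl0)) (le_inf hlt.le ?_)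
        (lt_of_le_of_ne inf_le_left ?_)
      · intro y hy
        exact mem_fc.2 ⟨hG.le hy, hg.2 l0 hl0 h0g y hy⟩
      · intro heq
        have : e ∈ E ⊓ fc Q l0 := by rw [heq]; exact he.1
        have := (mem_fc.1 this.2).2
        omega
    have hwG : N • g + (l0 e • x - l0 x • e) ∈ G := by
      rw [← hEG]
      refine ⟨hw, mem_fc.2 ⟨hN, ?_⟩⟩
      rw [map_add, map_nsmul, h0g, map_sub, map_smul, map_smul, smul_eq_mul, smul_eq_mul]
      simp [mul_comm]
    have e1 : l0 e • x = (N • g + (l0 e • x - l0 x • e)) - N • g + l0 x • e := by abel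
    rw [e1]
    refine add_mem (Submodule.mem_sup_left (sub_mem (Submodule.subset_span hwG) ?_))
      (Submodule.mem_sup_right ?_)
    · exact Submodule.subset_span (nsmul_mem hg.1 N)
    · exact Submodule.smul_mem _ _ (Submodule.mem_span_singleton_self e)
  have := faceDim_lt hG hE hlt
  omega

lemma HR.exists_facet (h : HR Q Lam) [Finite (Face Q)] {G E : AddSubmonoid (L d)} (hG : IsFace Q G) (hE : IsFace Q E)
    (hlt : G < E) : ∃ F, G ≤ F ∧ IsFacetOf Q F E := by
  obtain ⟨F, hF⟩ := (Set.toFinite {F : Face Q | G ≤ F.1 ∧ F.1 < E}).exists_maximal ⟨⟨G, hG⟩, le_rfl, hlt⟩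
  refine ⟨F.1, hF.1.1, F.2, hE, hF.1.2.le, h.faceDim_max F.2 hE hF.1.2 ?_⟩
  intro F' hF' hle hlt'
  exact le_antisymm (hF.2 (y := ⟨F', hF'⟩) ⟨hF.1.1.trans hle, hlt'⟩ hle) hle

lemma IsFacetOf.lt {F E : AddSubmonoid (L d)} (h : IsFacetOf Q F E) : F < E := by
  refine lt_of_le_of_ne h.2.2.1 ?_
  rintro rfl
  have := h.2.2.2
  omega

lemma HR.diamond_ex (h : HR Q Lam) {G F E : AddSubmonoid (L d)} (hGF : IsFacetOf Q G F) (hFE : IsFacetOf Q F E) :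
    ∃ F2, F2 ≠ F ∧ IsFacetOf Q G F2 ∧ IsFacetOf Q F2 E := by
  obtain ⟨hG, hF, hle1, hd1⟩ := id hGF
  obtain ⟨-, hE, hle2, hd2⟩ := id hFE
  obtain ⟨g, hg⟩ := h.exists_gen hG
  obtain ⟨f, hf⟩ := h.exists_gen hF
  obtain ⟨e, he⟩ := h.exists_gen hE
  have hfG : f ∉ G := fun h' => hGF.lt.not_ge (h.le_of_gen hF hG hf h')
  have heF : e ∉ F := fun h' => hFE.lt.not_ge (h.le_of_gen hE hF he h')
  obtain ⟨l0, hl0, h0g, h0f, N, hN⟩ := h.ratio (hG.le hg.1) (hF.le hf.1) (hE.le he.1)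
      (h.sep hG hg.1 (hF.le hf.1) hfG)
  have h0e := h.nonneg (hE.le he.1) hl0
  have hF2 : IsFace Q (E ⊓ fc Q l0) := hE.inf (isFace_fc fun y hy => h.nonneg hy hl0)
  have hw : N • g + (l0 f • e - l0 e • f) ∈ E ⊓ fc Q l0 := by
    refine ⟨hE.left hN (zsmul_mem_of_nonneg (hF.le hf.1) h0e) ?_, mem_fc.2 ⟨hN, ?_⟩⟩
    · have : N • g + (l0 f • e - l0 e • f) + l0 e • f = N • g + l0 f • e := by abel
      rw [this]
      exact add_mem (nsmul_mem (hle2 (hle1 hg.1)) _) (zsmul_mem_of_nonneg he.1 h0f.le)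
    · rw [map_add, map_nsmul, h0g, map_sub, map_smul, map_smul, smul_eq_mul, smul_eq_mul]
      simp [mul_comm]
  have hwF : N • g + (l0 f • e - l0 e • f) ∉ F := by
    intro hwF
    have h2 : N • g + l0 f • e ∈ F := by
      have : N • g + l0 f • e = N • g + (l0 f • e - l0 e • f) + l0 e • f := by abel
      rw [this]
      exact add_mem hwF (zsmul_mem_of_nonneg hf.1 h0e)
    have h3 := hF.right (nsmul_mem (hG.le hg.1) N) (zsmul_mem_of_nonneg (hE.le he.1) h0f.le) h2
    obtain ⟨n, hn⟩ := Int.eq_ofNat_of_zero_le h0f.le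
    rw [hn, natCast_zsmul] at h3
    exact heF (hF.of_nsmul (hE.le he.1) (by omega) h3)
  have hfF2 : f ∉ E ⊓ fc Q l0 := by
    intro h'
    have := (mem_fc.1 h'.2).2
    omega
  have hGF2 : G < E ⊓ fc Q l0 := by
    refine lt_of_le_of_ne (le_inf (hle1.trans hle2) fun y hy => mem_fc.2 ⟨hG.le hy, hg.2 l0 hl0 h0g y hy⟩) ?_
    intro heq
    rw [← heq] at hw
    exact hwF (hle1 hw)
  have hF2E : E ⊓ fc Q l0 < E := by
    refine lt_of_le_of_ne inf_le_left fun heq => hfF2 ?_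
    rw [heq]
    exact hle2 hf.1
  have a1 := faceDim_lt hG hF2 hGF2
  have a2 := faceDim_lt hF2 hE hF2E
  refine ⟨E ⊓ fc Q l0, ?_, ⟨hG, hF2, hGF2.le, by omega⟩, ⟨hF2, hE, hF2E.le, by omega⟩⟩
  intro heq
  rw [heq] at hw
  exact hwF hw

lemma HR.diamond_le (h : HR Q Lam) {G F1 F2 F3 E : AddSubmonoid (L d)}
    (h1 : IsFacetOf Q G F1) (h2 : IsFacetOf Q G F2) (h3 : IsFacetOf Q G F3)
    (k1 : IsFacetOf Q F1 E) (k2 : IsFacetOf Q F2 E) (k3 : IsFacetOf Q F3 E)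
    (h12 : F1 ≠ F2) (h13 : F1 ≠ F3) (h23 : F2 ≠ F3) : False := by
  obtain ⟨f1, hf1⟩ := h.exists_gen h1.2.1
  obtain ⟨f2, hf2⟩ := h.exists_gen h2.2.1
  obtain ⟨f3, hf3⟩ := h.exists_gen h3.2.1
  obtain ⟨m1, m1n, hm1⟩ := h1.2.1.exposed
  obtain ⟨m2, m2n, hm2⟩ := h2.2.1.exposed
  obtain ⟨m3, m3n, hm3⟩ := h3.2.1.exposed
  have key : ∀ {F F' : AddSubmonoid (L d)} {f : L d} {m : L d →ₗ[ℤ] ℤ}, IsFacetOf Q G F → IsFacetOf Q G F' → Gen Lam F f →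
      F ≠ F' → (∀ x ∈ Q, 0 ≤ m x) → (∀ x, x ∈ F' ↔ x ∈ Q ∧ m x = 0) → 0 < m f := by
    intro F F' f m hF hF' hf hne hn hm
    refine lt_of_le_of_ne (hn f (hF.2.1.le hf.1)) fun h0 => hne ?_
    have hfF' : f ∈ F' := (hm f).2 ⟨hF.2.1.le hf.1, h0.symm⟩
    refine face_eq_of_le hF.2.1 hF'.2.1 (h.le_of_gen hF.2.1 hF'.2.1 hf hfF') ?_
    have := hF.2.2.2
    have := hF'.2.2.2
    omega
  have p12 := key h1 h2 hf1 h12 m2n hm2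
  have p13 := key h1 h3 hf1 h13 m3n hm3
  have p21 := key h2 h1 hf2 h12.symm m1n hm1
  have p23 := key h2 h3 hf2 h23 m3n hm3
  have p31 := key h3 h1 hf3 h13.symm m1n hm1
  have p32 := key h3 h2 hf3 h23.symm m2n hm2
  have z11 : m1 f1 = 0 := ((hm1 _).1 hf1.1).2
  have z22 : m2 f2 = 0 := ((hm2 _).1 hf2.1).2
  have z33 : m3 f3 = 0 := ((hm3 _).1 hf3.1).2
  have zG : ∀ {F : AddSubmonoid (L d)} {m : L d →ₗ[ℤ] ℤ}, G ≤ F → (∀ x, x ∈ F ↔ x ∈ Q ∧ m x = 0) →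
      ∀ x ∈ Submodule.span ℤ (G : Set (L d)), m x = 0 := by
    intro F m hle hm x hx
    have : Submodule.span ℤ (G : Set (L d)) ≤ LinearMap.ker m := by
      rw [Submodule.span_le]
      intro y hy
      exact ((hm y).1 (hle hy)).2
    exact this hx
  set A0 := Submodule.span ℤ (G : Set (L d)) with hA0
  have hr1 : Module.finrank ℤ A0 + 1 ≤ Module.finrank ℤ (A0 ⊔ Submodule.span ℤ {f1} : Submodule ℤ (L d)) :=
    rk_R1 le_sup_left m2 (zG h2.2.2.1 hm2) (b := f1)
      (Submodule.mem_sup_right (Submodule.mem_span_singleton_self f1)) p12.ne'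
  have hr2 : Module.finrank ℤ (A0 ⊔ Submodule.span ℤ {f1} : Submodule ℤ (L d)) + 1 ≤
      Module.finrank ℤ ((A0 ⊔ Submodule.span ℤ {f1}) ⊔ Submodule.span ℤ {f2} : Submodule ℤ (L d)) := by
    refine rk_R1 le_sup_left m1 ?_ (b := f2)
      (Submodule.mem_sup_right (Submodule.mem_span_singleton_self f2)) p21.ne'
    intro x hx
    obtain ⟨y, hy, z, hz, rfl⟩ := Submodule.mem_sup.1 hx
    obtain ⟨c, rfl⟩ := Submodule.mem_span_singleton.1 hz
    rw [map_add, map_smul, z11, zG h1.2.2.1 hm1 y hy]; simp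
  have hle : (A0 ⊔ Submodule.span ℤ {f1}) ⊔ Submodule.span ℤ {f2} ≤ Submodule.span ℤ (E : Set (L d)) := by
    refine sup_le (sup_le (Submodule.span_mono fun x hx => k1.2.2.1 (h1.2.2.1 hx)) ?_) ?_
    · rw [Submodule.span_singleton_le_iff_mem]
      exact Submodule.subset_span (k1.2.2.1 hf1.1)
    · rw [Submodule.span_singleton_le_iff_mem]
      exact Submodule.subset_span (k2.2.2.1 hf2.1)
  have d1 := h1.2.2.2
  have d2 := k1.2.2.2
  rw [faceDim_eq, ← hA0] at d1
  rw [faceDim_eq E] at d2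
  obtain ⟨n, hn, hmem⟩ := rk_R3 hle (by omega) (x := f3) (Submodule.subset_span (k3.2.2.1 hf3.1))
  obtain ⟨y, hy, z, hz, hyz⟩ := Submodule.mem_sup.1 hmem
  obtain ⟨b, rfl⟩ := Submodule.mem_span_singleton.1 hz
  obtain ⟨y, hy', z, hz, rfl⟩ := Submodule.mem_sup.1 hy
  obtain ⟨a, rfl⟩ := Submodule.mem_span_singleton.1 hz
  have e1 := congrArg m1 hyz
  have e2 := congrArg m2 hyz
  have e3 := congrArg m3 hyz
  simp only [map_add, map_smul, smul_eq_mul] at e1 e2 e3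
  rw [zG h1.2.2.1 hm1 y hy', z11] at e1
  rw [zG h2.2.2.1 hm2 y hy', z22] at e2
  rw [zG h3.2.2.1 hm3 y hy', z33] at e3
  simp only [mul_zero, zero_add, add_zero] at e1 e2 e3
  rcases lt_or_gt_of_ne hn with hn | hn
  · have q1 : n * m1 f3 < 0 := mul_neg_of_neg_of_pos hn p31
    have q2 : n * m2 f3 < 0 := mul_neg_of_neg_of_pos hn p32
    have hb : b < 0 := by
      by_contra hb
      have := mul_nonneg (not_lt.1 hb) p21.le
      omega
    have ha : a < 0 := by
      by_contra ha
      have := mul_nonneg (not_lt.1 ha) p12.le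
      omega
    have := mul_neg_of_neg_of_pos ha p13
    have := mul_neg_of_neg_of_pos hb p23
    omega
  · have q1 : 0 < n * m1 f3 := mul_pos hn p31
    have q2 : 0 < n * m2 f3 := mul_pos hn p32
    have hb : 0 < b := by
      by_contra hb
      have := mul_nonpos_of_nonpos_of_nonneg (not_lt.1 hb) p21.le
      omega
    have ha : 0 < a := by
      by_contra ha
      have := mul_nonpos_of_nonpos_of_nonneg (not_lt.1 ha) p12.le
      omega
    have := mul_pos ha p13
    have := mul_pos hb p23
    omega

/-- The incidence data on the face poset. -/
def facePD (h : HR Q Lam) [Fintype (Face Q)] {ε : AddSubmonoid (L d) → AddSubmonoid (L d) → ℤ} (hε : IsIncidence Q ε) :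
    PD (Face Q) where
  cov F G := IsFacetOf Q F.1 G.1
  ep F G := ε F.1 G.1
  dim F := faceDim F.1
  cov_le h := h.2.2.1
  cov_dim h := h.2.2.2
  dd F G := by
    by_cases hex : ∃ H : Face Q, IsFacetOf Q F.1 H.1 ∧ IsFacetOf Q H.1 G.1
    · obtain ⟨H, h1, h2⟩ := hex
      obtain ⟨H2, hne, h3, h4⟩ := h.diamond_ex h1 h2
      have hne' : H ≠ ⟨H2, h4.1⟩ := fun h => hne (congrArg Subtype.val h).symm
      rw [Fintype.sum_eq_add H ⟨H2, h4.1⟩ hne']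
      · rw [if_pos ⟨h1, h2⟩, if_pos ⟨h3, h4⟩]
        exact hε.2 _ _ _ _ hne.symm h1 h2 h3 h4
      · rintro x ⟨hx1, hx2⟩
        rw [if_neg]
        rintro ⟨h5, h6⟩
        refine h.diamond_le h1 h3 h5 h2 h4 h6 hne.symm (fun h => hx1 (Subtype.ext h.symm))
          (fun h => hx2 (Subtype.ext h.symm))
    · refine Finset.sum_eq_zero fun H _ => if_neg fun h => hex ⟨H, h⟩

end B3


section B4
/-! ### Acyclicity of the sets of faces visible from a point -/

variable {Q} {Lam : Finset (L d →ₗ[ℤ] ℤ)}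

/-- Faces `F` of `E` with `a ∈ E - F`. -/
def XE (E : Face Q) (a : L d) : Set (Face Q) := {F | F ≤ E ∧ ∃ f ∈ F.1, a + f ∈ E.1}

/-- Faces `F` of `E` with `a ∈ relint E - F`. -/
def YE (Lam : Finset (L d →ₗ[ℤ] ℤ)) (E : Face Q) (a : L d) : Set (Face Q) :=
  {F | F ≤ E ∧ ∃ f ∈ F.1, Gen Lam E.1 (a + f)}

lemma XE_up {E F G : Face Q} {a : L d} (hF : F ∈ XE E a) (hFG : F ≤ G) (hG : G ≤ E) : G ∈ XE E a := by
  obtain ⟨-, f, hf, h⟩ := hF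
  exact ⟨hG, f, hFG hf, h⟩

lemma YE_up {E F G : Face Q} {a : L d} (hF : F ∈ YE Lam E a) (hFG : F ≤ G) (hG : G ≤ E) : G ∈ YE Lam E a := by
  obtain ⟨-, f, hf, h⟩ := hF
  exact ⟨hG, f, hFG hf, h⟩

lemma YE_sub_XE {E E' : Face Q} {a : L d} (h : E' ≤ E) : YE Lam E' a ⊆ XE E a := by
  rintro F ⟨hF, f, hf, hg⟩
  exact ⟨hF.trans h, f, hf, h hg.1⟩

lemma XE_cvx (E : Face Q) (a : L d) : Cvx (XE E a) := by
  intro F hF H hH G hFG hGH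
  exact XE_up hF hFG (hGH.trans hH.1)

lemma HR.exists_YE (h : HR Q Lam) {F : Face Q} {a f : L d} (hf : f ∈ F.1) (haf : a + f ∈ Q) :
    ∃ E' : Face Q, F ∈ YE Lam E' a ∧ ∀ E : Face Q, F ≤ E → a + f ∈ E.1 → E' ≤ E := by
  obtain ⟨f', hf'⟩ := h.exists_gen F.2
  obtain ⟨E', hE', hg⟩ := h.exists_face_gen (add_mem haf (F.2.le hf'.1))
  refine ⟨⟨E', hE'⟩, ⟨h.le_of_gen F.2 hE' hf' (hE'.right haf (F.2.le hf'.1) hg.1), f + f', add_mem hf hf'.1, ?_⟩, ?_⟩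
  · rwa [← add_assoc]
  · intro E hFE haE
    exact h.le_of_gen hE' E.2 hg (add_mem haE (hFE hf'.1))

lemma HR.YE_mono (h : HR Q Lam) {F G E1 E2 : Face Q} {a : L d} (hF : F ∈ YE Lam E1 a) (hG : G ∈ YE Lam E2 a)
    (hFG : F ≤ G) : E1 ≤ E2 := by
  obtain ⟨-, f, hf, hgf⟩ := hF
  obtain ⟨hGE, g, hg, hgg⟩ := hG
  refine h.le_of_gen E1.2 E2.2 hgf (E2.2.left (y := g) (E1.2.le hgf.1) (G.2.le hg) ?_)
  have : a + f + g = (a + g) + f := by abel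
  rw [this]
  exact add_mem hgg.1 (hGE (hFG hf))

/-- The face `E` with `F ∈ YE E a`. -/
def psiF (Lam : Finset (L d →ₗ[ℤ] ℤ)) (a : L d) (F : Face Q) : Face Q :=
  if h : ∃ E, F ∈ YE Lam E a then h.choose else F

lemma HR.psiF_eq (h : HR Q Lam) {a : L d} {F E : Face Q} (hF : F ∈ YE Lam E a) : psiF Lam a F = E := by
  have hex : ∃ E, F ∈ YE Lam E a := ⟨E, hF⟩
  rw [psiF, dif_pos hex]
  exact le_antisymm (h.YE_mono hex.choose_spec hF le_rfl) (h.YE_mono hF hex.choose_spec le_rfl)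

variable [Fintype (Face Q)] {A : Type} [CommRing A]

lemma HR.TEx_union (h : HR Q Lam) {S : PD (Face Q)} {V : Shf A (Face Q)} {t : A} {a : L d} {Z : Set (Face Q)}
    (hZ : Cvx Z) (hex : ∀ F ∈ Z, ∃ E, F ∈ YE Lam E a ∧ YE Lam E a ⊆ Z ∧ TEx S V t (YE Lam E a)) :
    TEx S V t Z := by
  refine TEx.fibers (psiF Lam a) _ Z rfl hZ ?_ ?_
  · intro F hF G hG hFG
    obtain ⟨E, hE, -⟩ := hex F hF
    obtain ⟨E', hE', -⟩ := hex G hG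
    rw [h.psiF_eq hE, h.psiF_eq hE']
    exact h.YE_mono hE hE' hFG
  · rintro _ ⟨F, hF, rfl⟩
    obtain ⟨E, hE, hsub, ht⟩ := hex F hF
    rw [h.psiF_eq hE]
    convert ht using 1
    ext G
    constructor
    · rintro ⟨hG, hGE⟩
      obtain ⟨E', hE', -⟩ := hex G hG
      rw [h.psiF_eq hE'] at hGE
      rwa [← hGE]
    · exact fun hG => ⟨hsub hG, h.psiF_eq hG⟩

lemma HR.neg_mem_of_le (h : HR Q Lam) {S : PD (Face Q)} {V : Shf A (Face Q)} {t : A} {E : Face Q} {a : L d} (ha : -a ∉ E.1)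
    (ih : ∀ E' : Face Q, E' < E → -a ∉ E'.1 → TEx S V t (YE Lam E' a)) :
    TEx S V t (XE E a) ↔ TEx S V t (YE Lam E a) := by
  have hup : UpIn (YE Lam E a) (XE E a) := fun F hF G hG hFG => YE_up hF hFG hG.1
  have hsub : YE Lam E a ⊆ XE E a := YE_sub_XE le_rfl
  have hrest : TEx S V t (XE E a \ YE Lam E a) := by
    refine h.TEx_union (a := a) ?_ ?_
    · intro F hF H hH G hFG hGH
      refine ⟨XE_cvx E a F hF.1 H hH.1 G hFG hGH, fun hG => hH.2 (YE_up hG hGH hH.1.1)⟩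
    · rintro F ⟨⟨hFE, f, hf, haf⟩, hFY⟩
      obtain ⟨E', hE', hle⟩ := h.exists_YE hf (E.2.le haf)
      have hle' := hle E hFE haf
      have hlt : E' < E := lt_of_le_of_ne hle' (by rintro rfl; exact hFY hE')
      refine ⟨E', hE', fun G hG => ⟨YE_sub_XE hle' hG, fun hGE => ?_⟩, ih E' hlt (fun hh => ha (hle' hh))⟩
      exact hlt.not_ge (h.YE_mono hGE hG le_rfl)
  exact ⟨fun hX => TEx.top_part (XE_cvx E a) hsub hup hX hrest,
    fun hY => TEx.glue (XE_cvx E a) hsub hup hY hrest⟩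

lemma HR.of_nsmul (h : HR Q Lam) {x : L d} {n : ℕ} (hn : 0 < n) (hx : n • x ∈ Q) : x ∈ Q := by
  rw [h] at hx ⊢
  intro l hl
  have := hx l hl
  rw [map_nsmul, nsmul_eq_mul] at this
  exact nonneg_of_mul_nonneg_right this (by exact_mod_cast hn)

lemma HR.XE_nsmul (h : HR Q Lam) (E : Face Q) (a : L d) {N : ℕ} (hN : 0 < N) : XE E (N • a) = XE E a := by
  ext F
  constructor
  · rintro ⟨hF, f, hf, hfa⟩
    obtain ⟨m, rfl⟩ := Nat.exists_eq_succ_of_ne_zero hN.ne'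
    have h1 : (m + 1) • (a + f) ∈ E.1 := by
      have : (m + 1) • (a + f) = ((m + 1) • a + f) + m • f := by
        rw [nsmul_add, add_nsmul f m 1, one_nsmul]; abel
      rw [this]
      exact add_mem hfa (nsmul_mem (hF hf) m)
    exact ⟨hF, f, hf, E.2.of_nsmul (h.of_nsmul hN (E.2.le h1)) hN h1⟩
  · rintro ⟨hF, f, hf, hfa⟩
    refine ⟨hF, N • f, nsmul_mem hf N, ?_⟩
    rw [← nsmul_add]
    exact nsmul_mem hfa N

lemma HR.YE_step (h : HR Q Lam) {E : Face Q} {q : L d} (hq : Gen Lam E.1 q) (a : L d) (n : ℕ) {N : ℕ} (hN : 0 < N)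
    (hdiv : ∀ l ∈ Lam, l q ≠ 0 → l q ∣ (N : ℤ)) :
    YE Lam E (N • a + (n + 1) • q) = XE E (N • a + n • q) := by
  ext F
  constructor
  · rintro ⟨hF, f, hf, hfa⟩
    obtain ⟨m, rfl⟩ := Nat.exists_eq_succ_of_ne_zero hN.ne'
    set x := (m + 1) • (a + f) + (n + 1) • q with hx
    have hxg : Gen Lam E.1 x := by
      have : x = ((m + 1) • a + (n + 1) • q + f) + m • f := by
        rw [hx, nsmul_add, add_nsmul f m 1, one_nsmul]; abel
      rw [this]
      exact h.gen_add E.2 hfa (nsmul_mem (hF hf) m)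
    have hxq : x - q ∈ Q := by
      refine (h _).2 fun l hl => ?_
      rw [map_sub]
      rcases (h.nonneg (E.2.le hq.1) hl).eq_or_lt with h0 | h0
      · rw [← h0, sub_zero]
        exact h.nonneg (E.2.le hxg.1) hl
      · have h1 : l q ∣ l x := by
          rw [hx, map_add, map_nsmul, map_nsmul, nsmul_eq_mul, nsmul_eq_mul]
          exact dvd_add (Dvd.dvd.mul_right (hdiv l hl h0.ne') _) (dvd_mul_left _ _)
        have h2 : 0 < l x := by
          refine lt_of_le_of_ne (h.nonneg (E.2.le hxg.1) hl) fun h3 => ?_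
          have := hxg.2 l hl h3.symm q hq.1
          omega
        have := Int.le_of_dvd h2 h1
        omega
    have hxE : x - q ∈ E.1 := E.2.left hxq (E.2.le hq.1) (by rw [sub_add_cancel]; exact hxg.1)
    refine ⟨hF, (m + 1) • f, nsmul_mem hf _, ?_⟩
    have : (m + 1) • a + n • q + (m + 1) • f = x - q := by
      rw [hx, nsmul_add, add_nsmul q n 1, one_nsmul]; abel
    rw [Nat.succ_eq_add_one, this]
    exact hxE
  · rintro ⟨hF, f, hf, hfa⟩
    refine ⟨hF, f, hf, ?_⟩
    have : N • a + (n + 1) • q + f = q + (N • a + n • q + f) := by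
      rw [add_nsmul q n 1, one_nsmul]; abel
    rw [this]
    exact h.gen_add E.2 hq hfa

lemma HR.sweep (h : HR Q Lam) {S : PD (Face Q)} {V : Shf A (Face Q)} {t : A} {E : Face Q} {a : L d}
    (ha : ¬ Gen Lam E.1 (-a)) (hne : (XE E a).Nonempty)
    (ih : ∀ b, ∀ E' : Face Q, E' < E → -b ∉ E'.1 → TEx S V t (YE Lam E' b)) :
    TEx S V t (XE E a) ↔ TEx S V t {F | F ≤ E} := by
  obtain ⟨q, hq⟩ := h.exists_gen E.2
  obtain ⟨N, hN, hdiv⟩ : ∃ N : ℕ, 0 < N ∧ ∀ l ∈ Lam, l q ≠ 0 → l q ∣ (N : ℤ) := by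
    refine ⟨∏ l ∈ Lam.filter (fun l => l q ≠ 0), (l q).natAbs, ?_, ?_⟩
    · refine Finset.prod_pos fun l hl => ?_
      have := (Finset.mem_filter.1 hl).2
      omega
    · intro l hl h0
      rw [← Int.natAbs_dvd, Int.natCast_dvd_natCast]
      exact Finset.dvd_prod_of_mem (fun l : L d →ₗ[ℤ] ℤ => (l q).natAbs) (Finset.mem_filter.2 ⟨hl, h0⟩)
  have hstep : ∀ n : ℕ, TEx S V t (XE E (N • a + n • q)) ↔ TEx S V t (XE E (N • a)) := by
    intro n
    induction n with
    | zero => simp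
    | succ n ihn =>
      rw [← ihn, ← h.YE_step hq a n hN hdiv]
      refine h.neg_mem_of_le ?_ (ih _)
      intro hmem
      refine ha ?_
      have h1 : Gen Lam E.1 (N • (-a)) := by
        have : N • (-a) = q + (n • q + -(N • a + (n + 1) • q)) := by
          rw [add_nsmul q n 1, one_nsmul, smul_neg]; abel
        rw [this]
        exact h.gen_add E.2 hq (add_mem (nsmul_mem hq.1 n) hmem)
      exact h.gen_of_nsmul E.2 (h.of_nsmul hN (E.2.le h1.1)) hN h1
  obtain ⟨F, hF, f, hf, hfa⟩ := hne
  obtain ⟨M, hM⟩ := h.push (q := q) (x := -(N • f)) (E.2.le hq.1) (fun l hl h0 => by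
    rw [map_neg, map_nsmul, hq.2 l hl h0 f (hF hf)]; simp)
  have hall : XE E (N • a + M • q) = {F | F ≤ E} := by
    ext G
    refine ⟨fun hG => hG.1, fun hG => ⟨hG, 0, zero_mem _, ?_⟩⟩
    have h1 : M • q + -(N • f) ∈ E.1 := by
      refine E.2.left (hM M le_rfl) (nsmul_mem (F.2.le hf) N) ?_
      rw [neg_add_cancel_right]
      exact nsmul_mem hq.1 M
    have h2 : N • a + M • q + 0 = N • (a + f) + (M • q + -(N • f)) := by
      rw [nsmul_add]; abel
    rw [h2]
    exact add_mem (nsmul_mem hfa N) h1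
  rw [← hall, hstep, h.XE_nsmul E a hN]

variable {ε : AddSubmonoid (L d) → AddSubmonoid (L d) → ℤ}

lemma HR.TEx_pair (h : HR Q Lam) (hε : IsIncidence Q ε) (W : Type) [AddCommGroup W] [Module A W] (t : A)
    {G E : Face Q} (hGE : IsFacetOf Q G.1 E.1) :
    TEx (facePD h hε) (constShf (Face Q) A W) t {G, E} := by
  have hne : G ≠ E := fun h => hGE.lt.ne (congrArg Subtype.val h)
  have hncov : ∀ F, (facePD h hε).cov F G → F ≠ G ∧ F ≠ E := by
    intro F hF
    have h1 : F.1 < G.1 := IsFacetOf.lt hF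
    have h2 : G.1 < E.1 := hGE.lt
    constructor
    · rintro rfl; exact lt_irrefl _ h1
    · rintro rfl; exact lt_asymm h1 h2
  have hdE : ∀ c : Face Q → W, (∀ F, F ∉ ({G, E} : Set (Face Q)) → c F = 0) →
      dif (facePD h hε) (constShf (Face Q) A W) c E = ε G.1 E.1 • c G := by
    intro c hc
    rw [dif_apply, Finset.sum_eq_single G]
    · rw [dif_pos (show (facePD h hε).cov G E from hGE)]
      rfl
    · intro F _ hFG
      split_ifs with hF
      · have hFE : F ≠ E := by
          rintro rfl
          exact lt_irrefl _ (IsFacetOf.lt hF)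
        rw [hc F (by simp [hFG, hFE])]
        simp
      · rfl
    · simp
  have hsq : ε G.1 E.1 * ε G.1 E.1 = 1 := by
    rcases hε.1 _ _ hGE with h | h <;> rw [h] <;> norm_num
  intro c hc hd
  have hcG : c G = 0 := by
    have h1 := hd E (by simp)
    rw [hdE c hc] at h1
    have h2 : (ε G.1 E.1 * ε G.1 E.1) • c G = 0 := by rw [mul_smul, h1, smul_zero]
    rwa [hsq, one_smul] at h2
  refine ⟨0, fun F => if F = G then ε G.1 E.1 • c E else 0, ?_, ?_⟩
  · intro F hF
    simp only [Set.mem_insert_iff, Set.mem_singleton_iff, not_or] at hF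
    exact if_neg hF.1
  · intro F hF
    rw [pow_zero, one_smul]
    rcases hF with rfl | hF
    · rw [hcG]
      exact dif_zero_of _ _ fun F' hF' => if_neg (hncov F' hF').1
    · rw [Set.mem_singleton_iff] at hF
      subst hF
      rw [hdE _ (fun F' hF' => by
        simp only [Set.mem_insert_iff, Set.mem_singleton_iff, not_or] at hF'
        exact if_neg hF'.1), if_pos rfl, smul_smul, hsq, one_smul]

lemma HR.acyclic (h : HR Q Lam) (hQ : IsNormalAffineSemigroup Q) (hε : IsIncidence Q ε) (W : Type) [AddCommGroup W] [Module A W] (t : A) :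
    ∀ (n : ℕ) (E : Face Q), faceDim E.1 = n → ∀ a,
      (¬ Gen Lam E.1 (-a) → TEx (facePD h hε) (constShf (Face Q) A W) t (XE E a)) ∧
      (-a ∉ E.1 → TEx (facePD h hε) (constShf (Face Q) A W) t (YE Lam E a)) := by
  intro n
  induction n using Nat.strong_induction_on with
  | _ n ih =>
    intro E hE
    have ih' : ∀ b, ∀ E' : Face Q, E' < E → -b ∉ E'.1 →
        TEx (facePD h hε) (constShf (Face Q) A W) t (YE Lam E' b) := by
      intro b E' hlt hb
      exact (ih (faceDim E'.1) (by rw [← hE]; exact faceDim_lt E'.2 E.2 hlt) E' rfl b).2 hb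
    have hX : ∀ a, ¬ Gen Lam E.1 (-a) → TEx (facePD h hε) (constShf (Face Q) A W) t (XE E a) := by
      intro a ha
      rcases (XE E a).eq_empty_or_nonempty with h0 | h0
      · rw [h0]; exact TEx.empty _ _ _
      rw [h.sweep ha h0 ih']
      by_cases hbot : E.1 = ⊥
      · exfalso
        obtain ⟨F, hF, f, hf, hfa⟩ := h0
        have hf0 : f ∈ E.1 := hF hf
        rw [hbot, AddSubmonoid.mem_bot] at hfa hf0
        rw [hf0, add_zero] at hfa
        refine ha ?_
        rw [hfa, hbot, neg_zero]
        refine ⟨zero_mem _, fun l _ _ x hx => ?_⟩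
        rw [AddSubmonoid.mem_bot] at hx
        rw [hx, map_zero]
      obtain ⟨G, -, hG⟩ := h.exists_facet (h.isFace_zero hQ) E.2 (bot_lt_iff_ne_bot.2 hbot)
      obtain ⟨g, hg⟩ := h.exists_gen hG.1
      have hgE : ¬ Gen Lam E.1 (- -g) := by
        rw [neg_neg]
        intro hh
        exact hG.lt.not_ge (h.le_of_gen E.2 hG.1 hh hg.1)
      have hXg : XE E (-g) = {⟨G, hG.1⟩, E} := by
        ext F
        constructor
        · rintro ⟨hF, f, hf, hfg⟩
          have hgF : g ∈ F.1 := by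
            refine F.2.right (E.2.le hfg) (hG.1.le hg.1) ?_
            rwa [show -g + f + g = f by abel]
          have hGF : G ≤ F.1 := h.le_of_gen hG.1 F.2 hg hgF
          rcases hF.eq_or_lt with rfl | hlt
          · right; rfl
          · left
            apply Subtype.ext
            symm
            refine face_eq_of_le hG.1 F.2 hGF ?_
            have h1 := faceDim_lt F.2 E.2 hlt
            have h2 := hG.2.2.2
            show faceDim F.1 ≤ faceDim G
            omega
        · rintro (rfl | hF)
          · exact ⟨hG.2.2.1, g, hg.1, by rw [neg_add_cancel]; exact zero_mem _⟩
          · rw [Set.mem_singleton_iff] at hF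
            subst hF
            exact ⟨le_rfl, g, hG.2.2.1 hg.1, by rw [neg_add_cancel]; exact zero_mem _⟩
      rw [← h.sweep hgE (by rw [hXg]; exact ⟨E, by simp⟩) ih', hXg]
      exact h.TEx_pair hε W t hG
    intro a
    refine ⟨hX a, fun ha => ?_⟩
    exact (h.neg_mem_of_le ha (ih' a)).1 (hX a fun hg => ha hg.1)

lemma HR.acyclicY (h : HR Q Lam) (hQ : IsNormalAffineSemigroup Q) (hε : IsIncidence Q ε) (W : Type) [AddCommGroup W] [Module A W] (t : A)
    (E : Face Q) {a : L d} (ha : -a ∉ E.1) : TEx (facePD h hε) (constShf (Face Q) A W) t (YE Lam E a) :=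
  (h.acyclic hQ hε W t _ E rfl a).2 ha

end B4


section B5
/-! ### Localisations -/

section LocGen

open scoped Pointwise

variable {P : Type} [PartialOrder P] {A : Type} [CommRing A]

lemma liftOfLE_mk2 {S₁ S₂ : Submonoid A} (h : S₁ ≤ S₂) {M : Type} [AddCommGroup M] [Module A M] (m : M) (s : S₁) :
    LocalizedModule.liftOfLE (M := M) S₁ S₂ h (LocalizedModule.mk m s) = LocalizedModule.mk m ⟨s.1, h s.2⟩ := by
  rw [IsLocalizedModule.mk_eq_mk', IsLocalizedModule.mk_eq_mk', LocalizedModule.liftOfLE, IsLocalizedModule.liftOfLE_mk']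

/-- The functor of localisations of a module. -/
def locShf (SF : P → Submonoid A) (hSF : Monotone SF) (M : Type) [AddCommGroup M] [Module A M] : Shf A P where
  V := fun F => LocalizedModule (SF F) M
  rho := fun {F G} h => LocalizedModule.liftOfLE (SF F) (SF G) (hSF h)
  comp := by
    intro F G H h₁ h₂ x
    induction x using LocalizedModule.induction_on with
    | h m s => simp only [liftOfLE_mk2]

variable {SF : P → Submonoid A} {hSF : Monotone SF} {M : Type} [AddCommGroup M] [Module A M]

lemma locmk_zero {S : Submonoid A} {m : M} {s : S} : LocalizedModule.mk m s = 0 ↔ ∃ u ∈ S, u • m = 0 := by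
  rw [← LocalizedModule.zero_mk 1, LocalizedModule.mk_eq]
  constructor
  · rintro ⟨u, hu⟩
    refine ⟨u.1, u.2, ?_⟩
    rw [smul_zero, smul_zero, one_smul] at hu
    exact hu
  · rintro ⟨u, hu, h⟩
    refine ⟨⟨u, hu⟩, ?_⟩
    rw [smul_zero, smul_zero, one_smul]
    exact h

/-- The short exact sequence of localisations for a regular element. -/
def locSES (r : A) (hr : IsSMulRegular M r) : SES (locShf SF hSF M) (locShf SF hSF (QuotSMulTop r M)) r where
  p := fun F => (LocalizedModule.map (SF F) (Submodule.mkQ (r • (⊤ : Submodule A M)))).restrictScalars A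
  nat := by
    intro F G h x
    induction x using LocalizedModule.induction_on with
    | h m s =>
      show LocalizedModule.map (SF G) (Submodule.mkQ (r • (⊤ : Submodule A M)))
          (LocalizedModule.liftOfLE (SF F) (SF G) (hSF h) (LocalizedModule.mk m s)) =
        LocalizedModule.liftOfLE (SF F) (SF G) (hSF h)
          (LocalizedModule.map (SF F) (Submodule.mkQ (r • (⊤ : Submodule A M))) (LocalizedModule.mk m s))
      rw [LocalizedModule.map_mk, liftOfLE_mk2, liftOfLE_mk2, LocalizedModule.map_mk]
  surj := by
    intro F x
    induction x using LocalizedModule.induction_on with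
    | h m s =>
      obtain ⟨y, rfl⟩ := Submodule.mkQ_surjective _ m
      exact ⟨LocalizedModule.mk y s, LocalizedModule.map_mk _ _ _ _⟩
  ker := by
    intro F x hx
    induction x using LocalizedModule.induction_on with
    | h m s =>
      have hx' : LocalizedModule.mk (Submodule.mkQ (r • (⊤ : Submodule A M)) m) s = 0 :=
        (LocalizedModule.map_mk (SF F) (Submodule.mkQ (r • (⊤ : Submodule A M))) m s).symm.trans hx
      obtain ⟨u, hu, h⟩ := locmk_zero.1 hx'
      rw [← map_smul, Submodule.mkQ_apply, Submodule.Quotient.mk_eq_zero, Submodule.mem_smul_pointwise_iff_exists] at h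
      obtain ⟨y, -, hy⟩ := h
      refine ⟨LocalizedModule.mk y (⟨u, hu⟩ * s), ?_⟩
      show _ = r • LocalizedModule.mk (S := SF F) y (⟨u, hu⟩ * s)
      rw [LocalizedModule.smul'_mk, hy]
      exact (LocalizedModule.mk_cancel_common_left (⟨u, hu⟩ : SF F) s m).symm
  kill := by
    intro F x
    induction x using LocalizedModule.induction_on with
    | h m s =>
      have : r • (LocalizedModule.mk m s : LocalizedModule (SF F) M) = LocalizedModule.mk (r • m) s :=
        LocalizedModule.smul'_mk _ _ _
      show LocalizedModule.map (SF F) (Submodule.mkQ (r • (⊤ : Submodule A M))) (r • (LocalizedModule.mk m s : LocalizedModule (SF F) M)) = 0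
      rw [this, LocalizedModule.map_mk, locmk_zero]
      refine ⟨1, one_mem _, ?_⟩
      rw [one_smul, Submodule.mkQ_apply, Submodule.Quotient.mk_eq_zero]
      exact Submodule.smul_mem_pointwise_smul _ _ _ trivial
  inj := by
    intro F x hx
    induction x using LocalizedModule.induction_on with
    | h m s =>
      have hx' : LocalizedModule.mk (r • m) s = 0 := (LocalizedModule.smul'_mk r m s).symm.trans hx
      obtain ⟨u, hu, h⟩ := locmk_zero.1 hx'
      refine locmk_zero.2 ⟨u, hu, hr ?_⟩
      simp only [smul_zero]
      rw [smul_comm, h]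

end LocGen

section Mono

variable {k} {Q}

lemma mono_add (p q : Q) : mono k Q (p + q) = mono k Q p * mono k Q q := by
  simp [mono, AddMonoidAlgebra.single_mul_single]

lemma mono_zero : mono k Q 0 = 1 := rfl

lemma mono_nsmul (n : ℕ) (q : Q) : mono k Q (n • q) = mono k Q q ^ n := by
  induction n with
  | zero => rw [zero_nsmul, pow_zero, mono_zero]
  | succ n ih => rw [succ_nsmul, mono_add, ih, pow_succ]

variable (k) in
/-- Monomials with exponent in a face. -/
def SFm (F : Face Q) : Submonoid (kQ k Q) where
  carrier := {x | ∃ q : Q, (q : L d) ∈ F.1 ∧ x = mono k Q q}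
  one_mem' := ⟨0, F.1.zero_mem, rfl⟩
  mul_mem' := by
    rintro _ _ ⟨p, hp, rfl⟩ ⟨q, hq, rfl⟩
    exact ⟨p + q, add_mem hp hq, (mono_add p q).symm⟩

lemma SFm_mono : Monotone (SFm k (Q := Q)) := by
  rintro F G h _ ⟨q, hq, rfl⟩
  exact ⟨q, h hq, rfl⟩

variable (k) in
/-- The functor of monomial localisations of a module. -/
abbrev mShf (M : Type) [AddCommGroup M] [Module (kQ k Q) M] : Shf (kQ k Q) (Face Q) := locShf (SFm k) SFm_mono M

variable {Lam : Finset (L d →ₗ[ℤ] ℤ)} {ε : AddSubmonoid (L d) → AddSubmonoid (L d) → ℤ} [Fintype (Face Q)]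

lemma tors_TEx (h : HR Q Lam) (hQ : IsNormalAffineSemigroup Q) (hε : IsIncidence Q ε)
    (M : Type) [AddCommGroup M] [Module (kQ k Q) M] (a : Q) (ha : (a : L d) ≠ 0) :
    TEx (facePD h hε) (mShf k M) (mono k Q a) Set.univ := by
  refine h.TEx_union (a := a) (fun _ _ _ _ _ _ _ => trivial) ?_
  intro F _
  obtain ⟨E, hE, -⟩ := h.exists_YE (F := F) (a := a) (f := 0) F.1.zero_mem (by simp)
  refine ⟨E, hE, Set.subset_univ _, ?_⟩
  refine TEx.of_const (E := E) (fun F hF => hF.1) (h.acyclicY hQ hε _ _ E ?_) ?_ ?_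
  · intro hc
    exact ha (hQ.pointed a a.2 (E.2.le hc))
  · rintro F ⟨hFE, f, hf, hg⟩ x hx
    induction x using LocalizedModule.induction_on with
    | h m s =>
      have hx' := (liftOfLE_mk2 (SFm_mono hFE) m s).symm.trans hx
      obtain ⟨_, ⟨e, he, rfl⟩, hu⟩ := locmk_zero.1 hx'
      obtain ⟨N0, hN⟩ := h.push (x := -e) (E.2.le hg.1) (fun l hl h0 => by
        rw [map_neg, hg.2 l hl h0 e he]; simp)
      refine ⟨N0, ?_⟩
      refine (LocalizedModule.smul'_mk _ _ _).trans (locmk_zero.2 ⟨mono k Q (N0 • ⟨f, F.2.le hf⟩), ⟨_, ?_, rfl⟩, ?_⟩)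
      · exact F.1.nsmul_mem hf N0
      · rw [← mono_nsmul, ← mul_smul, ← mono_add]
        have : N0 • (⟨f, F.2.le hf⟩ : Q) + N0 • a = ⟨N0 • (a + f) + -e, hN N0 le_rfl⟩ + e := by
          apply Subtype.ext
          simp [smul_add, add_comm]
        rw [this, mono_add, mul_smul, hu, smul_zero]
  · rintro F ⟨hFE, f, hf, hg⟩ w
    induction w using LocalizedModule.induction_on with
    | h m s =>
      obtain ⟨_, ⟨e, he, rfl⟩⟩ := s
      obtain ⟨N0, hN⟩ := h.push (x := -e) (E.2.le hg.1) (fun l hl h0 => by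
        rw [map_neg, hg.2 l hl h0 e he]; simp)
      refine ⟨N0, LocalizedModule.mk (mono k Q ⟨N0 • (a + f) + -e, hN N0 le_rfl⟩ • m)
        ⟨mono k Q (N0 • ⟨f, F.2.le hf⟩), _, F.1.nsmul_mem hf N0, rfl⟩, ?_⟩
      refine (liftOfLE_mk2 (SFm_mono hFE) _ _).trans (Eq.trans ?_ (LocalizedModule.smul'_mk _ _ _).symm)
      rw [LocalizedModule.mk_eq]
      refine ⟨1, ?_⟩
      rw [one_smul, one_smul, ← mono_nsmul]
      show mono k Q e • mono k Q _ • m = mono k Q (N0 • ⟨f, F.2.le hf⟩) • mono k Q _ • m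
      rw [← mul_smul, ← mul_smul, ← mono_add, ← mono_add]
      congr 2
      apply Subtype.ext
      simp [smul_add, add_comm]

lemma tors_max (h : HR Q Lam) (hQ : IsNormalAffineSemigroup Q) (hε : IsIncidence Q ε)
    (M : Type) [AddCommGroup M] [Module (kQ k Q) M] {r : kQ k Q} (hr : r ∈ maxIdeal k Q) 
    (c : ∀ F, (mShf k M).V F) (hc : dif (facePD h hε) (mShf k M) c = 0) :
    ∃ (N : ℕ) (b : ∀ F, (mShf k M).V F), dif (facePD h hε) (mShf k M) b = r ^ N • c := by
  set J : Ideal (kQ k Q) := Submodule.comap (LinearMap.toSpanSingleton (kQ k Q) (∀ F, (mShf k M).V F) c)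
    (LinearMap.range (dif (facePD h hε) (mShf k M)))
  have : maxIdeal k Q ≤ J.radical := by
    refine Ideal.span_le.2 ?_
    rintro _ ⟨q, hq, rfl⟩
    obtain ⟨N, b, -, hb⟩ := tors_TEx h hQ hε M q hq c (fun F hF => absurd (Set.mem_univ F) hF) (fun F _ => by rw [hc]; rfl)
    exact ⟨N, b, funext fun F => hb F trivial⟩
  obtain ⟨N, b, hb⟩ := this hr
  exact ⟨N, b, hb⟩

end Mono

end B5


section B6
/-! ### Depth in terms of the complex of localisations -/

open RingTheory.Sequence

variable {k} {Q}

lemma mem_span_mono {p : Q → Prop} (hp : ∀ q, p q → ∀ r, p (r + q)) {x : kQ k Q} :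
    x ∈ Ideal.span {m | ∃ q : Q, p q ∧ m = mono k Q q} ↔ ∀ q ∈ x.coeff.support, p q := by
  have : {m | ∃ q : Q, p q ∧ m = mono k Q q} = AddMonoidAlgebra.of' k Q '' {q | p q} := by
    ext m
    constructor
    · rintro ⟨q, hq, rfl⟩
      exact ⟨q, hq, rfl⟩
    · rintro ⟨q, hq, rfl⟩
      exact ⟨q, hq, rfl⟩
  rw [this, AddMonoidAlgebra.mem_ideal_span_of'_image]
  refine forall₂_congr fun q _ => ?_
  constructor
  · rintro ⟨m, hm, r, rfl⟩
    exact hp _ hm r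
  · intro h
    exact ⟨q, h, 0, by simp⟩

lemma mem_maxIdeal (hQ : IsNormalAffineSemigroup Q) {x : kQ k Q} :
    x ∈ maxIdeal k Q ↔ ∀ q ∈ x.coeff.support, (q : L d) ≠ 0 := by
  refine mem_span_mono (p := fun q : Q => (q : L d) ≠ 0) ?_
  intro q hq r h
  apply hq
  have h' : (r : L d) + q = 0 := h
  exact hQ.pointed _ q.2 (by rw [← eq_neg_of_add_eq_zero_left h']; exact r.2)

lemma one_notMem_maxIdeal (hQ : IsNormalAffineSemigroup Q) : (1 : kQ k Q) ∉ maxIdeal k Q := by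
  intro h
  refine (mem_maxIdeal hQ).1 h 0 ?_ rfl
  rw [Finsupp.mem_support_iff]
  have : (1 : kQ k Q).coeff 0 = 1 := by
    rw [AddMonoidAlgebra.one_def, AddMonoidAlgebra.coeff_single, Finsupp.single_eq_same]
  rw [this]
  exact one_ne_zero

lemma noeth_kQ (hQ : IsNormalAffineSemigroup Q) : IsNoetherianRing (kQ k Q) := by
  have : AddMonoid.FG Q := (AddMonoid.fg_iff_addSubmonoid_fg Q).2 hQ.fg
  exact Algebra.FiniteType.isNoetherianRing k _

lemma faceDim_bot : faceDim (⊥ : AddSubmonoid (L d)) = 0 := by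
  unfold faceDim
  have : AddSubgroup.closure ((⊥ : AddSubmonoid (L d)) : Set (L d)) = ⊥ := by
    rw [AddSubgroup.closure_eq_bot_iff]
    intro x hx
    exact hx
  rw [this]
  exact Module.finrank_zero_of_subsingleton

variable {Lam : Finset (L d →ₗ[ℤ] ℤ)} {ε : AddSubmonoid (L d) → AddSubmonoid (L d) → ℤ} [Fintype (Face Q)]

lemma socle_zero (h : HR Q Lam) (hQ : IsNormalAffineSemigroup Q) (hε : IsIncidence Q ε)
    (M : Type) [AddCommGroup M] [Module (kQ k Q) M] {n : ℕ} (hn : Pn (facePD h hε) (mShf k M) (n + 1))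
    {m : M} (hm : ∀ q : Q, (q : L d) ≠ 0 → mono k Q q • m = 0) : m = 0 := by
  let B : Face Q := ⟨⊥, h.isFace_zero hQ⟩
  let c : ∀ F, (mShf k M).V F := Pi.single B (LocalizedModule.mk m (1 : SFm k B))
  have hc : ∀ F, F ≠ B → c F = 0 := fun F hF => Pi.single_eq_of_ne hF _
  have hcB : c B = LocalizedModule.mk m (1 : SFm k B) := Pi.single_eq_same _ _
  obtain ⟨b, hb, hdb⟩ := Pn_iff.1 hn 0 (by omega) c (fun F hF => hc F (by
      rintro rfl
      exact hF faceDim_bot)) (by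
      funext G
      rw [dif_apply]
      refine Finset.sum_eq_zero fun F _ => ?_
      split_ifs with hcov
      · by_cases hF : F = B
        · subst hF
          rw [hcB]
          have hlt := (hcov : IsFacetOf Q _ _).lt
          obtain ⟨x, hx, hx0⟩ := SetLike.exists_of_lt hlt
          have : (mShf k M).rho ((facePD h hε).cov_le hcov) (LocalizedModule.mk m (1 : SFm k B)) = 0 := by
            refine (liftOfLE_mk2 (SFm_mono ((facePD h hε).cov_le hcov)) m 1).trans (locmk_zero.2 ⟨mono k Q ⟨x, G.2.le hx⟩, ⟨_, hx, rfl⟩, hm _ ?_⟩)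
            intro h0
            apply hx0
            show x ∈ (⊥ : AddSubmonoid (L d))
            exact h0
          rw [this, smul_zero]
        · rw [hc F hF, map_zero, smul_zero]
      · rfl)
  have : b = 0 := funext fun F => hb F (by omega)
  rw [this, map_zero] at hdb
  have h1 : LocalizedModule.mk m (1 : SFm k B) = 0 := by rw [← hcB, ← hdb]; rfl
  obtain ⟨_, ⟨q, hq, rfl⟩, hu⟩ := locmk_zero.1 h1
  have : q = 0 := Subtype.ext hq
  rwa [this, mono_zero, one_smul] at hu

lemma exists_regular (h : HR Q Lam) (hQ : IsNormalAffineSemigroup Q) (hε : IsIncidence Q ε)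
    (M : Type) [AddCommGroup M] [Module (kQ k Q) M] [Module.Finite (kQ k Q) M] {n : ℕ}
    (hn : Pn (facePD h hε) (mShf k M) (n + 1)) : ∃ r ∈ maxIdeal k Q, IsSMulRegular M r := by
  have := noeth_kQ (k := k) hQ
  by_contra hcon
  push Not at hcon
  have hsub : ((maxIdeal k Q : Ideal (kQ k Q)) : Set (kQ k Q)) ⊆ ⋃ p ∈ associatedPrimes (kQ k Q) M, (p : Set (kQ k Q)) := by
    rw [biUnion_associatedPrimes_eq_zero_divisors]
    intro r hr
    have := hcon r hr
    rw [isSMulRegular_iff_right_eq_zero_of_smul] at this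
    push Not at this
    obtain ⟨x, h1, h2⟩ := this
    exact ⟨x, h2, h1⟩
  obtain ⟨p, hp, hle⟩ := (Ideal.subset_union_prime_finite (associatedPrimes.finite (kQ k Q) M) (f := id) 0 0
    fun _ h _ _ => h.isPrime).1 hsub
  obtain ⟨hpr, x, hx⟩ := isAssociatedPrime_iff.1 hp
  have hx0 : x = 0 := socle_zero h hQ hε M hn (fun q hq => by
    have : mono k Q q ∈ p := hle (Ideal.subset_span ⟨q, hq, rfl⟩)
    rw [hx, Submodule.mem_colon_singleton] at this
    simpa using this)
  apply hpr.ne_top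
  rw [hx, hx0, Ideal.eq_top_iff_one, Submodule.mem_colon_singleton]
  simp

lemma Pn_iff_depth (h : HR Q Lam) (hQ : IsNormalAffineSemigroup Q) (hε : IsIncidence Q ε) (n : ℕ) :
    ∀ (M : Type) [AddCommGroup M] [Module (kQ k Q) M] [Module.Finite (kQ k Q) M],
    Pn (facePD h hε) (mShf k M) n ↔ ∃ rs : List (kQ k Q), (∀ r ∈ rs, r ∈ maxIdeal k Q) ∧
      IsWeaklyRegular M rs ∧ rs.length = n := by
  induction n with
  | zero =>
    intro M _ _ _
    constructor
    · intro _
      exact ⟨[], by simp, by simp, rfl⟩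
    · intro _ i hi
      omega
  | succ n ih =>
    intro M _ _ _
    constructor
    · intro hP
      obtain ⟨r, hr, hreg⟩ := exists_regular h hQ hε M hP
      have h1 := (locSES (SF := SFm k) (hSF := SFm_mono) r hreg).Pn_quot hP
      obtain ⟨rs, h2, h3, h4⟩ := (ih (QuotSMulTop r M)).1 h1
      refine ⟨r :: rs, ?_, ?_, ?_⟩
      · intro s hs
        rcases List.mem_cons.1 hs with rfl | hs
        · exact hr
        · exact h2 s hs
      · rw [isWeaklyRegular_cons_iff]
        exact ⟨hreg, h3⟩
      · simp [h4]
    · rintro ⟨rs, h2, h3, h4⟩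
      cases rs with
      | nil => simp at h4
      | cons r rs =>
        rw [isWeaklyRegular_cons_iff] at h3
        have hr := h2 r (by simp)
        have h1 := (ih (QuotSMulTop r M)).2 ⟨rs, fun s hs => h2 s (by simp [hs]), h3.2, by simpa using h4⟩
        exact (locSES (SF := SFm k) (hSF := SFm_mono) r h3.1).Pn_of_quot h1 (tors_max h hQ hε M hr)

lemma Pn_iff_ring (h : HR Q Lam) (hQ : IsNormalAffineSemigroup Q) (hε : IsIncidence Q ε) (n : ℕ)
    {I : Ideal (kQ k Q)} (hI : I ≤ maxIdeal k Q) :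
    Pn (facePD h hε) (mShf k (kQ k Q ⧸ I)) n ↔ ∃ rs : List (kQ k Q ⧸ I),
    (∀ r ∈ rs, r ∈ (maxIdeal k Q).map (Ideal.Quotient.mk I)) ∧
    RingTheory.Sequence.IsRegular (kQ k Q ⧸ I) rs ∧ rs.length = n := by
  rw [Pn_iff_depth h hQ hε n]
  constructor
  · rintro ⟨rs, h1, h2, h3⟩
    have hrs : ∀ r ∈ rs.map (algebraMap (kQ k Q) (kQ k Q ⧸ I)), r ∈ (maxIdeal k Q).map (Ideal.Quotient.mk I) := by
      intro r hr
      obtain ⟨s, hs, rfl⟩ := List.mem_map.1 hr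
      exact Ideal.mem_map_of_mem _ (h1 s hs)
    refine ⟨rs.map (algebraMap (kQ k Q) (kQ k Q ⧸ I)), hrs,
      ⟨(isWeaklyRegular_map_algebraMap_iff _ _ _).2 h2, ?_⟩, by simpa using h3⟩
    intro htop
    have hle : Ideal.ofList (rs.map (algebraMap (kQ k Q) (kQ k Q ⧸ I))) ≤ (maxIdeal k Q).map (Ideal.Quotient.mk I) :=
      Ideal.span_le.2 hrs
    have h1m : (1 : kQ k Q ⧸ I) ∈ (maxIdeal k Q).map (Ideal.Quotient.mk I) := by
      apply hle
      have : (1 : kQ k Q ⧸ I) ∈ (⊤ : Submodule (kQ k Q ⧸ I) (kQ k Q ⧸ I)) := trivial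
      rw [htop] at this
      simpa using this
    obtain ⟨x, hx, hx1⟩ := (Ideal.mem_map_iff_of_surjective _ Ideal.Quotient.mk_surjective).1 h1m
    rw [← map_one (Ideal.Quotient.mk I), Ideal.Quotient.eq] at hx1
    apply one_notMem_maxIdeal (k := k) hQ
    have := sub_mem hx (hI hx1)
    simpa using this
  · rintro ⟨rs, h1, h2, h3⟩
    have : ∃ rs' : List (kQ k Q), (∀ r ∈ rs', r ∈ maxIdeal k Q) ∧ rs'.map (algebraMap (kQ k Q) (kQ k Q ⧸ I)) = rs := by
      clear h2 h3
      induction rs with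
      | nil => exact ⟨[], by simp, rfl⟩
      | cons r rs ih =>
        obtain ⟨rs', h4, h5⟩ := ih (fun s hs => h1 s (by simp [hs]))
        obtain ⟨x, hx, hx1⟩ := (Ideal.mem_map_iff_of_surjective _ Ideal.Quotient.mk_surjective).1 (h1 r (by simp))
        refine ⟨x :: rs', ?_, ?_⟩
        · intro s hs
          rcases List.mem_cons.1 hs with rfl | hs
          · exact hx
          · exact h4 s hs
        · rw [List.map_cons, h5, ← hx1]
          rfl
    obtain ⟨rs', h4, rfl⟩ := this
    exact ⟨rs', h4, (isWeaklyRegular_map_algebraMap_iff _ _ _).1 h2.1, by simpa using h3⟩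

end B6


section B7
/-! ### Decomposition into degrees -/

section Dec

variable {P : Type} [Fintype P] [PartialOrder P] {A : Type} [CommRing A]

/-- A decomposition of a functor into one-dimensional pieces. -/
structure Dec (V : Shf A P) (D : Type) (X : D → Set P) where
  p : ∀ F, D → V.V F →+ k
  e : ∀ F, D → k →+ V.V F
  p_out : ∀ F a x, F ∉ X a → p F a x = 0
  e_out : ∀ F a y, F ∉ X a → e F a y = 0
  pe : ∀ F a y, F ∈ X a → p F a (e F a y) = y
  fin : ∀ F x, ∃ s : Finset D, (∀ a, a ∉ s → p F a x = 0) ∧ x = ∑ a ∈ s, e F a (p F a x)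
  natp : ∀ {F G} (h : F ≤ G) a x, G ∈ X a → p G a (V.rho h x) = p F a x
  nate : ∀ {F G} (h : F ≤ G) a y, F ∈ X a → V.rho h (e F a y) = e G a y

variable {k} {S : PD P} {V : Shf A P} {D : Type} {X : D → Set P}

lemma Dec.p_dif (T : Dec k V D X) (c : ∀ F, V.V F) {a : D} {G : P} (hG : G ∈ X a) :
    T.p G a (dif S V c G) = dif S (constShf P k k) (fun F => T.p F a (c F)) G := by
  rw [dif_apply, dif_apply, map_sum]
  refine Finset.sum_congr rfl fun F _ => ?_
  split_ifs with h
  · rw [map_zsmul, T.natp _ _ _ hG]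
    rfl
  · simp

lemma Dec.e_dif (T : Dec k V D X) (b : P → k) {a : D} (hb : ∀ F, F ∉ X a → b F = 0) (G : P) :
    dif S V (fun F => T.e F a (b F)) G = T.e G a (dif S (constShf P k k) b G) := by
  rw [dif_apply, dif_apply, map_sum]
  refine Finset.sum_congr rfl fun F _ => ?_
  split_ifs with h
  · rw [map_zsmul]
    congr 1
    by_cases hF : F ∈ X a
    · exact T.nate _ _ _ hF
    · show V.rho _ (T.e F a (b F)) = T.e G a (b F)
      rw [hb F hF, map_zero, map_zero, map_zero]
  · simp

lemma Dec.Pn_iff (T : Dec k V D X) (n : ℕ) :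
    Pn S V n ↔ ∀ i < n, ∀ a, TExD S (constShf P k k) 1 (X a) i := by
  rw [ZMS.Pn_iff]
  refine forall₂_congr fun i hi => ?_
  constructor
  · intro h a c hc hci hdc
    obtain ⟨b, hb, hdb⟩ := h (fun F => T.e F a (c F)) (fun F hF => by
        show T.e F a (c F) = 0
        rw [hci F hF, map_zero]) (funext fun G => by
        rw [T.e_dif c hc]
        by_cases hG : G ∈ X a
        · rw [hdc G hG, map_zero]; rfl
        · rw [T.e_out _ _ _ hG]; rfl)
    refine ⟨0, fun F => T.p F a (b F), fun F hF => T.p_out _ _ _ hF, fun F hF => ?_, fun F hF => ?_⟩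
    · show T.p F a (b F) = 0
      rw [hb F hF, map_zero]
    · rw [← T.p_dif b hF, hdb, T.pe _ _ _ hF, pow_zero, one_smul]
  · intro h c hc hdc
    have h' : ∀ a, ∃ b : P → k, (∀ F, F ∉ X a → b F = 0) ∧ (∀ F, S.dim F + 1 ≠ i → b F = 0) ∧
        ∀ F ∈ X a, dif S (constShf P k k) b F = T.p F a (c F) := by
      intro a
      obtain ⟨N, b, h1, h2, h3⟩ := h a (fun F => T.p F a (c F)) (fun F hF => T.p_out _ _ _ hF) (fun F hF => by
        show T.p F a (c F) = 0
        rw [hc F hF, map_zero]) (fun F hF => by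
        rw [← T.p_dif c hF, hdc]
        exact map_zero _)
      exact ⟨b, h1, h2, fun F hF => by rw [h3 F hF, one_pow, one_smul]⟩
    choose b h1 h2 h3 using h'
    choose s hs hcs using fun F => T.fin F (c F)
    set t : Finset D := Finset.univ.biUnion s with ht
    refine ⟨fun F => ∑ a ∈ t, T.e F a (b a F), fun F hF => ?_, ?_⟩
    · refine Finset.sum_eq_zero fun a _ => ?_
      rw [h2 a F hF, map_zero]
    · have : (fun F => ∑ a ∈ t, T.e F a (b a F)) = ∑ a ∈ t, (fun F => T.e F a (b a F)) := by
        funext F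
        rw [Finset.sum_apply]
      rw [this, map_sum]
      funext G
      rw [Finset.sum_apply, hcs G]
      rw [Finset.sum_subset (Finset.subset_biUnion_of_mem s (Finset.mem_univ G)) (fun a _ ha => by rw [hs G a ha, map_zero])]
      refine Finset.sum_congr rfl fun a _ => ?_
      rw [T.e_dif (b a) (h1 a)]
      by_cases hG : G ∈ X a
      · rw [h3 a G hG]
      · rw [T.e_out _ _ _ hG, T.e_out _ _ _ hG]

end Dec

end B7


section B8
/-! ### Degrees of the localisations of `k[Q]/I_Δ` -/

variable {k} {Q}

/-- Coefficient of a monomial with arbitrary lattice exponent. -/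
def coef (x : kQ k Q) (b : L d) : k := if h : b ∈ Q then x.coeff ⟨b, h⟩ else 0

lemma coef_add (x y : kQ k Q) (b : L d) : coef (x + y) b = coef x b + coef y b := by
  unfold coef
  split_ifs
  · rw [AddMonoidAlgebra.coeff_add, Finsupp.add_apply]
  · simp

lemma coef_single (q : Q) (y : k) (b : L d) : coef (AddMonoidAlgebra.single q y : kQ k Q) b = if (q : L d) = b then y else 0 := by
  unfold coef
  split_ifs with h1 h2 h2
  · subst h2
    rw [AddMonoidAlgebra.coeff_single, Finsupp.single_eq_same]
  · rw [AddMonoidAlgebra.coeff_single, Finsupp.single_eq_of_ne]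
    intro h
    exact h2 (by rw [← h])
  · exact absurd (h2 ▸ q.2) h1
  · rfl

lemma coef_zero (b : L d) : coef (0 : kQ k Q) b = 0 := by
  have := coef_add (0 : kQ k Q) 0 b
  rw [add_zero] at this
  simpa using this

lemma mono_mul_single (q p : Q) (y : k) : mono k Q q * AddMonoidAlgebra.single p y = AddMonoidAlgebra.single (q + p) y := by
  rw [mono, AddMonoidAlgebra.single_mul_single, one_mul]

lemma coef_mono_mul (q : Q) (x : kQ k Q) (b : L d) : coef (mono k Q q * x) (b + q) = coef x b := by
  induction x using AddMonoidAlgebra.induction_linear with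
  | zero => rw [mul_zero, coef_zero, coef_zero]
  | add f g hf hg => rw [mul_add, coef_add, coef_add, hf, hg]
  | single p y =>
    rw [mono_mul_single, coef_single, coef_single]
    congr 1
    rw [AddSubmonoid.coe_add, add_comm, add_right_cancel_iff]

lemma mono_inj {p q : Q} (h : mono k Q p = mono k Q q) : p = q := by
  have h1 := congrArg (fun z => coef z (q : L d)) h
  simp only [mono, coef_single, if_true] at h1
  by_contra hne
  rw [if_neg (fun h => hne (Subtype.ext h))] at h1
  exact zero_ne_one h1

variable (Δ : Finset (AddSubmonoid (L d)))

/-- The support of the complex. -/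
def sD (b : L d) : Prop := ∃ E ∈ Δ, b ∈ E

variable {Δ}

lemma mem_complexIdeal (hΔ : IsPolyhedralComplex Q Δ) {x : kQ k Q} :
    x ∈ complexIdeal k Q Δ ↔ ∀ b, sD Δ b → coef x b = 0 := by
  rw [complexIdeal, mem_span_mono (p := fun q : Q => ∀ F ∈ Δ, (q : L d) ∉ F)]
  · constructor
    · rintro h b ⟨E, hE, hb⟩
      unfold coef
      split_ifs with hbQ
      · by_contra hne
        exact h ⟨b, hbQ⟩ (Finsupp.mem_support_iff.2 hne) E hE hb
      · rfl
    · intro h q hq E hE hqE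
      refine Finsupp.mem_support_iff.1 hq ?_
      have := h q ⟨E, hE, hqE⟩
      unfold coef at this
      rwa [dif_pos q.2] at this
  · intro q hq r F hF hrq
    exact hq F hF ((hΔ.1 F hF).right r.2 q.2 hrq)

/-- Coefficients in `k[Q]/I_Δ`. -/
def gam (b : L d) (r : kQ k Q ⧸ complexIdeal k Q Δ) : k := if sD Δ b then coef (Quotient.out r) b else 0

lemma gam_mk (hΔ : IsPolyhedralComplex Q Δ) (b : L d) (x : kQ k Q) :
    gam b (Ideal.Quotient.mk (complexIdeal k Q Δ) x) = if sD Δ b then coef x b else 0 := by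
  unfold gam
  split_ifs with h
  · have : Ideal.Quotient.mk (complexIdeal k Q Δ) (Quotient.out (Ideal.Quotient.mk (complexIdeal k Q Δ) x)) =
        Ideal.Quotient.mk (complexIdeal k Q Δ) x := Quotient.out_eq _
    rw [Ideal.Quotient.eq, mem_complexIdeal hΔ] at this
    have h1 := this b h
    have h2 := coef_add (Quotient.out (Ideal.Quotient.mk (complexIdeal k Q Δ) x) - x) x b
    rw [h1, zero_add, sub_add_cancel] at h2
    exact h2
  · rfl

lemma gam_add (hΔ : IsPolyhedralComplex Q Δ) (b : L d) (r r' : kQ k Q ⧸ complexIdeal k Q Δ) :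
    gam b (r + r') = gam b r + gam b r' := by
  obtain ⟨x, rfl⟩ := Ideal.Quotient.mk_surjective r
  obtain ⟨y, rfl⟩ := Ideal.Quotient.mk_surjective r'
  rw [← map_add, gam_mk hΔ, gam_mk hΔ, gam_mk hΔ, coef_add]
  split_ifs <;> simp

lemma smul_mk (x y : kQ k Q) (I : Ideal (kQ k Q)) : x • Ideal.Quotient.mk I y = Ideal.Quotient.mk I (x * y) := rfl

lemma gam_mono (hΔ : IsPolyhedralComplex Q Δ) {b : L d} {q : Q} (hb : sD Δ (b + q)) (r : kQ k Q ⧸ complexIdeal k Q Δ) :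
    gam (b + (q : L d)) (mono k Q q • r) = gam b r := by
  obtain ⟨x, rfl⟩ := Ideal.Quotient.mk_surjective r
  rw [smul_mk, gam_mk hΔ, gam_mk hΔ, if_pos hb, coef_mono_mul]
  split_ifs with h
  · rfl
  · unfold coef
    split_ifs with hbQ
    · exfalso
      obtain ⟨E, hE, hbE⟩ := hb
      exact h ⟨E, hE, (hΔ.1 E hE).left hbQ q.2 hbE⟩
    · rfl

/-- The monomial elements of `k[Q]/I_Δ`. -/
def ems (q : Q) (y : k) : kQ k Q ⧸ complexIdeal k Q Δ := Ideal.Quotient.mk _ (AddMonoidAlgebra.single q y)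

lemma gam_ems (hΔ : IsPolyhedralComplex Q Δ) (b : L d) (q : Q) (y : k) :
    gam b (ems (Δ := Δ) q y) = if sD Δ b ∧ (q : L d) = b then y else 0 := by
  rw [ems, gam_mk hΔ, coef_single]
  split_ifs with h1 h2 h3 h4 h5 <;> simp_all

lemma ems_add (q : Q) (y z : k) : ems (Δ := Δ) q (y + z) = ems q y + ems q z := by
  rw [ems, ems, ems, ← map_add, AddMonoidAlgebra.single_add]

lemma mono_ems (q p : Q) (y : k) : mono k Q q • ems (Δ := Δ) p y = ems (q + p) y := by
  rw [ems, ems, smul_mk, mono_mul_single]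

lemma ems_zero (hΔ : IsPolyhedralComplex Q Δ) {q : Q} (hq : ¬ sD Δ q) (y : k) : ems (Δ := Δ) q y = 0 := by
  rw [ems, Ideal.Quotient.eq_zero_iff_mem, mem_complexIdeal hΔ]
  intro b hb
  rw [coef_single, if_neg]
  rintro rfl
  exact hq hb

variable (Δ) in
/-- Degrees occurring in the localisation at `F`, as sets of faces. -/
def XD (a : L d) : Set (Face Q) := {F | ∃ E ∈ Δ, F.1 ≤ E ∧ ∃ f ∈ F.1, a + f ∈ E}

/-- The exponent of an element of `SFm`. -/
def expo {F : Face Q} (s : SFm k F) : Q := s.2.choose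

lemma expo_mem {F : Face Q} (s : SFm k F) : (expo s : L d) ∈ F.1 := s.2.choose_spec.1

lemma expo_eq {F : Face Q} (s : SFm k F) : s.1 = mono k Q (expo s) := s.2.choose_spec.2

variable (k) in
/-- Monomial as an element of `SFm`. -/
def toS (F : Face Q) (f : Q) (hf : (f : L d) ∈ F.1) : SFm k F := ⟨mono k Q f, f, hf, rfl⟩

lemma expo_toS (F : Face Q) (f : Q) (hf : (f : L d) ∈ F.1) : expo (toS k F f hf) = f :=
  (mono_inj (expo_eq (toS k F f hf))).symm

lemma toS_expo {F : Face Q} (s : SFm k F) : toS k F (expo s) (expo_mem s) = s := Subtype.ext (expo_eq s).symm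

variable {F : Face Q}

lemma gam_wd (hΔ : IsPolyhedralComplex Q Δ) {a : L d} {E : AddSubmonoid (L d)} (hE : E ∈ Δ) (hFE : F.1 ≤ E)
    {f : Q} (hf : (f : L d) ∈ F.1) (haf : a + f ∈ E) {s s' u f' : Q} (hs : (s : L d) ∈ F.1) (hs' : (s' : L d) ∈ F.1)
    (hu : (u : L d) ∈ F.1) {E' : AddSubmonoid (L d)} (hE' : E' ∈ Δ) (hFE' : F.1 ≤ E') 
    (hf' : (f' : L d) ∈ F.1) (haf' : a + f' ∈ E') {r r' : kQ k Q ⧸ complexIdeal k Q Δ}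
    (h : mono k Q u • mono k Q s' • r = mono k Q u • mono k Q s • r') :
    gam (a + (s : L d) + (f : L d)) (mono k Q f • r) = gam (a + (s' : L d) + (f' : L d)) (mono k Q f' • r') := by
  rw [← gam_mono hΔ (q := u + s' + f'), ← gam_mono hΔ (q := u + s + f) (b := a + (s' : L d) + (f' : L d))]
  · congr 1
    · simp only [AddSubmonoid.coe_add]
      abel
    · rw [mono_add, mono_add, mono_add, mono_add]
      calc (mono k Q u * mono k Q s' * mono k Q f') • mono k Q f • r 
          = (mono k Q f * mono k Q f') • mono k Q u • mono k Q s' • r := by simp only [← mul_smul]; congr 1; ring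
        _ = (mono k Q f * mono k Q f') • mono k Q u • mono k Q s • r' := by rw [h]
        _ = _ := by simp only [← mul_smul]; congr 1; ring
  · refine ⟨E', hE', ?_⟩
    have : a + s' + f' + ((u + s + f : Q) : L d) = (a + f') + (s' + (u + s + f)) := by
      simp only [AddSubmonoid.coe_add]; abel
    rw [this]
    exact add_mem haf' (add_mem (hFE' hs') (add_mem (add_mem (hFE' hu) (hFE' hs)) (hFE' hf)))
  · refine ⟨E, hE, ?_⟩
    have : a + s + f + ((u + s' + f' : Q) : L d) = (a + f) + (s + (u + s' + f')) := by
      simp only [AddSubmonoid.coe_add]; abel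
    rw [this]
    exact add_mem haf (add_mem (hFE hs) (add_mem (add_mem (hFE hu) (hFE hs')) (hFE hf')))

/-- Pick a face and an exponent witnessing `F ∈ XD Δ a`. -/
lemma XD_pick {a : L d} (h : F ∈ XD Δ a) : ∃ f : Q, (f : L d) ∈ F.1 ∧ ∃ E ∈ Δ, F.1 ≤ E ∧ a + f ∈ E := by
  obtain ⟨E, hE, hFE, f, hf, haf⟩ := h
  exact ⟨⟨f, F.2.le hf⟩, hf, E, hE, hFE, haf⟩

/-- Coordinate function in degree `a`. -/
def pfun (hΔ : IsPolyhedralComplex Q Δ) (F : Face Q) (a : L d)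
    (x : LocalizedModule (SFm k F) (kQ k Q ⧸ complexIdeal k Q Δ)) : k :=
  if h : F ∈ XD Δ a then
    x.liftOn (fun m => gam (a + (expo m.2 : L d) + ((XD_pick h).choose : L d)) (mono k Q (XD_pick h).choose • m.1)) (by
      rintro ⟨r, s⟩ ⟨r', s'⟩ ⟨u, hu⟩
      obtain ⟨hf, E, hE, hFE, haf⟩ := (XD_pick h).choose_spec
      refine gam_wd hΔ hE hFE hf haf (expo_mem s) (expo_mem s') (expo_mem u) hE hFE hf haf ?_
      rw [← expo_eq, ← expo_eq, ← expo_eq]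
      exact hu)
  else 0

lemma pfun_mk (hΔ : IsPolyhedralComplex Q Δ) {a : L d} {E : AddSubmonoid (L d)} (hE : E ∈ Δ) (hFE : F.1 ≤ E)
    {f : Q} (hf : (f : L d) ∈ F.1) (haf : a + f ∈ E) {s : Q} (hs : (s : L d) ∈ F.1) 
    (r : kQ k Q ⧸ complexIdeal k Q Δ) : pfun hΔ F a (LocalizedModule.mk r (toS k F s hs)) =
      gam (a + (s : L d) + (f : L d)) (mono k Q f • r) := by
  have h : F ∈ XD Δ a := ⟨E, hE, hFE, f, hf, haf⟩
  unfold pfun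
  rw [dif_pos h, LocalizedModule.liftOn_mk, expo_toS]
  obtain ⟨hf', E', hE', hFE', haf'⟩ := (XD_pick h).choose_spec
  exact gam_wd hΔ hE' hFE' hf' haf' hs hs F.1.zero_mem hE hFE hf haf (u := 0) rfl

lemma pfun_out (hΔ : IsPolyhedralComplex Q Δ) {a : L d} (h : F ∉ XD Δ a)
    (x : LocalizedModule (SFm k F) (kQ k Q ⧸ complexIdeal k Q Δ)) : pfun hΔ F a x = 0 := by
  unfold pfun
  rw [dif_neg h]

lemma loc_ind {F : Face Q} {M : Type} [AddCommGroup M] [Module (kQ k Q) M] {p : LocalizedModule (SFm k F) M → Prop}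
    (h : ∀ r (s : Q) (hs : (s : L d) ∈ F.1), p (LocalizedModule.mk r (toS k F s hs))) (x) : p x := by
  induction x using LocalizedModule.induction_on with
  | h m s =>
    rw [← toS_expo s]
    exact h _ _ _

lemma toS_mul {s s' : Q} (hs : (s : L d) ∈ F.1) (hs' : (s' : L d) ∈ F.1) :
    toS k F s hs * toS k F s' hs' = toS k F (s + s') (add_mem hs hs') := Subtype.ext (mono_add s s').symm

lemma pfun_add (hΔ : IsPolyhedralComplex Q Δ) {a : L d} 
    (x y : LocalizedModule (SFm k F) (kQ k Q ⧸ complexIdeal k Q Δ)) : pfun hΔ F a (x + y) = pfun hΔ F a x + pfun hΔ F a y := by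
  by_cases h : F ∈ XD Δ a
  · obtain ⟨f, hf, E, hE, hFE, haf⟩ := XD_pick h
    induction x using loc_ind with
    | h r s hs =>
    induction y using loc_ind with
    | h r' s' hs' =>
    rw [LocalizedModule.mk_add_mk, toS_mul, pfun_mk hΔ hE hFE hf haf, pfun_mk hΔ hE hFE hf haf, pfun_mk hΔ hE hFE hf haf]
    rw [smul_add, gam_add hΔ]
    have key : ∀ (t t' : Q) (ht : (t : L d) ∈ F.1) (ht' : (t' : L d) ∈ F.1) (r : kQ k Q ⧸ complexIdeal k Q Δ),
        gam (a + ((t + t' : Q) : L d) + (f : L d)) (mono k Q f • toS k F t' ht' • r) = gam (a + (t : L d) + (f : L d)) (mono k Q f • r) := by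
      intro t t' ht ht' r
      rw [← gam_mono hΔ (q := t') (b := a + (t : L d) + (f : L d))]
      · congr 1
        · simp only [AddSubmonoid.coe_add]; abel
        · exact smul_comm _ _ _
      · refine ⟨E, hE, ?_⟩
        have : a + t + f + t' = (a + f) + (t + t') := by abel
        rw [this]
        exact add_mem haf (add_mem (hFE ht) (hFE ht'))
    rw [key s s' hs hs', add_comm s s', key s' s hs' hs]
  · rw [pfun_out hΔ h, pfun_out hΔ h, pfun_out hΔ h, add_zero]

/-- Homogeneous element of degree `a`. -/
def efun (hΔ : IsPolyhedralComplex Q Δ) (F : Face Q) (a : L d) (y : k) :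
    LocalizedModule (SFm k F) (kQ k Q ⧸ complexIdeal k Q Δ) :=
  if h : ∃ f : Q, (f : L d) ∈ F.1 ∧ a + f ∈ Q then
    LocalizedModule.mk (ems ⟨a + (h.choose : L d), h.choose_spec.2⟩ y) (toS k F h.choose h.choose_spec.1)
  else 0

lemma efun_eq (hΔ : IsPolyhedralComplex Q Δ) {a : L d} {f : Q} (hf : (f : L d) ∈ F.1) (haf : a + f ∈ Q) (y : k) :
    efun hΔ F a y = LocalizedModule.mk (ems ⟨a + (f : L d), haf⟩ y) (toS k F f hf) := by
  have h : ∃ f : Q, (f : L d) ∈ F.1 ∧ a + f ∈ Q := ⟨f, hf, haf⟩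
  unfold efun
  rw [dif_pos h, LocalizedModule.mk_eq]
  refine ⟨1, ?_⟩
  rw [one_smul, one_smul]
  show mono k Q _ • ems (Δ := Δ) (Q := Q) _ y = mono k Q _ • ems (Δ := Δ) (Q := Q) _ y
  rw [mono_ems, mono_ems]
  congr 1
  apply Subtype.ext
  simp only [AddSubmonoid.coe_add]
  abel

lemma efun_out (hΔ : IsPolyhedralComplex Q Δ) {Lam : Finset (L d →ₗ[ℤ] ℤ)} (hR : HR Q Lam) {a : L d} (h : F ∉ XD Δ a) (y : k) :
    efun hΔ F a y = 0 := by
  by_cases h' : ∃ f : Q, (f : L d) ∈ F.1 ∧ a + f ∈ Q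
  · obtain ⟨f, hf, haf⟩ := h'
    rw [efun_eq hΔ hf haf]
    obtain ⟨g, hg⟩ := hR.exists_gen F.2
    refine locmk_zero.2 ⟨mono k Q ⟨g, F.2.le hg.1⟩, ⟨_, hg.1, rfl⟩, ?_⟩
    rw [mono_ems]
    refine ems_zero hΔ ?_ y
    rintro ⟨E, hE, hgE⟩
    have hEf := hΔ.1 E hE
    refine h ⟨E, hE, hR.le_of_gen F.2 hEf hg (hEf.left (F.2.le hg.1) haf hgE), f, hf, hEf.right (F.2.le hg.1) haf hgE⟩
  · unfold efun
    rw [dif_neg h']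

lemma efun_add (hΔ : IsPolyhedralComplex Q Δ) (a : L d) (y z : k) : efun hΔ F a (y + z) = efun hΔ F a y + efun hΔ F a z := by
  by_cases h' : ∃ f : Q, (f : L d) ∈ F.1 ∧ a + f ∈ Q
  · obtain ⟨f, hf, haf⟩ := h'
    rw [efun_eq hΔ hf haf, efun_eq hΔ hf haf, efun_eq hΔ hf haf, ems_add, LocalizedModule.mk_add_mk, ← smul_add,
      LocalizedModule.mk_cancel_common_left]
  · unfold efun
    rw [dif_neg h', dif_neg h', dif_neg h', add_zero]

lemma pfun_efun (hΔ : IsPolyhedralComplex Q Δ) {Lam : Finset (L d →ₗ[ℤ] ℤ)} (hR : HR Q Lam) {a b : L d} (h : F ∈ XD Δ b) (y : k) :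
    pfun hΔ F b (efun hΔ F a y) = if a = b then y else 0 := by
  by_cases ha : F ∈ XD Δ a
  · obtain ⟨f, hf, E, hE, hFE, hbf⟩ := XD_pick h
    obtain ⟨f', hf', E', hE', hFE', haf'⟩ := XD_pick ha
    rw [efun_eq hΔ hf' ((hΔ.1 E' hE').le haf'), pfun_mk hΔ hE hFE hf hbf hf', mono_ems, gam_ems hΔ]
    congr 1
    simp only [AddSubmonoid.coe_add, eq_iff_iff]
    constructor
    · rintro ⟨-, h2⟩
      have : a + (f + f' : L d) = b + (f + f') := by
        rw [add_comm (f : L d) f', ← add_assoc, ← add_assoc, ← h2]; abel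
      exact add_right_cancel this
    · rintro rfl
      refine ⟨⟨E, hE, ?_⟩, by abel⟩
      have : a + f' + f = (a + f : L d) + f' := by abel
      rw [this]
      exact add_mem hbf (hFE hf')
  · rw [efun_out hΔ hR ha, if_neg (fun hab : a = b => ha (hab ▸ h))]
    have := pfun_add hΔ (F := F) (a := b) (0 : LocalizedModule (SFm k F) (kQ k Q ⧸ complexIdeal k Q Δ)) 0
    rw [add_zero] at this
    simpa using this

end B8


section B9
/-! ### The degree decomposition of the complex of localisations of `k[Q]/I_Δ` -/

variable {k} {Q} {Δ : Finset (AddSubmonoid (L d))} {F : Face Q}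

lemma efun_ind (hΔ : IsPolyhedralComplex Q Δ) {p : LocalizedModule (SFm k F) (kQ k Q ⧸ complexIdeal k Q Δ) → Prop}
    (h0 : p 0) (hadd : ∀ x y, p x → p y → p (x + y)) (he : ∀ a y, p (efun hΔ F a y)) (x) : p x := by
  induction x using loc_ind with
  | h r s hs =>
    obtain ⟨x, rfl⟩ := Ideal.Quotient.mk_surjective r
    induction x using AddMonoidAlgebra.induction_linear with
    | zero =>
      rw [map_zero, LocalizedModule.zero_mk]
      exact h0
    | add f g hf hg =>
      have : LocalizedModule.mk (Ideal.Quotient.mk (complexIdeal k Q Δ) (f + g)) (toS k F s hs) =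
          LocalizedModule.mk (Ideal.Quotient.mk (complexIdeal k Q Δ) f) (toS k F s hs) +
          LocalizedModule.mk (Ideal.Quotient.mk (complexIdeal k Q Δ) g) (toS k F s hs) := by
        rw [LocalizedModule.mk_add_mk, ← smul_add, LocalizedModule.mk_cancel_common_left, map_add]
      rw [this]
      exact hadd _ _ hf hg
    | single q y =>
      have hq : (q : L d) - s + s ∈ Q := by rw [sub_add_cancel]; exact q.2
      have := he ((q : L d) - s) y
      rw [efun_eq hΔ (f := s) hs hq] at this
      have h2 : (⟨(q : L d) - s + s, hq⟩ : Q) = q := Subtype.ext (sub_add_cancel _ _)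
      rw [h2] at this
      exact this

lemma rho_efun (hΔ : IsPolyhedralComplex Q Δ) {F G : Face Q} (h : F ≤ G) {a : L d} (ha : F ∈ XD Δ a) (y : k) :
    (mShf k (kQ k Q ⧸ complexIdeal k Q Δ)).rho h (efun hΔ F a y) = efun hΔ G a y := by
  obtain ⟨f, hf, E, hE, hFE, haf⟩ := XD_pick ha
  rw [efun_eq hΔ hf ((hΔ.1 E hE).le haf), efun_eq hΔ (h hf) ((hΔ.1 E hE).le haf)]
  exact liftOfLE_mk2 (SFm_mono h) _ _

lemma efun_zero' (hΔ : IsPolyhedralComplex Q Δ) (a : L d) : efun hΔ F a (0 : k) = 0 :=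
  map_zero (AddMonoidHom.mk' (efun hΔ F a) (efun_add hΔ a))

lemma pfun_zero' (hΔ : IsPolyhedralComplex Q Δ) (a : L d) :
    pfun hΔ F a (0 : LocalizedModule (SFm k F) (kQ k Q ⧸ complexIdeal k Q Δ)) = 0 :=
  map_zero (AddMonoidHom.mk' (pfun hΔ F a) (pfun_add hΔ))

lemma fin_efun (hΔ : IsPolyhedralComplex Q Δ) {Lam : Finset (L d →ₗ[ℤ] ℤ)} (hR : HR Q Lam)
    (x : LocalizedModule (SFm k F) (kQ k Q ⧸ complexIdeal k Q Δ)) :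
    ∃ s : Finset (L d), (∀ a, a ∉ s → pfun hΔ F a x = 0) ∧ x = ∑ a ∈ s, efun hΔ F a (pfun hΔ F a x) := by
  induction x using efun_ind hΔ with
  | h0 => exact ⟨∅, fun a _ => pfun_zero' hΔ a, by simp⟩
  | hadd x y hx hy =>
    obtain ⟨s, hs, hxs⟩ := hx
    obtain ⟨t, ht, hyt⟩ := hy
    have key : ∀ (u v : Finset (L d)) (z : LocalizedModule (SFm k F) (kQ k Q ⧸ complexIdeal k Q Δ)), u ⊆ v →
        (∀ a, a ∉ u → pfun hΔ F a z = 0) →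
        z = ∑ a ∈ u, efun hΔ F a (pfun hΔ F a z) →
        z = ∑ a ∈ v, efun hΔ F a (pfun hΔ F a z) := by
      intro u v z huv hu hz
      refine hz.trans (Finset.sum_subset huv fun a _ ha => ?_)
      rw [hu a ha, efun_zero']
    refine ⟨s ∪ t, fun a ha => ?_, ?_⟩
    · rw [Finset.mem_union, not_or] at ha
      rw [pfun_add, hs a ha.1, ht a ha.2, add_zero]
    · have h1 := key s (s ∪ t) x Finset.subset_union_left hs hxs
      have h2 := key t (s ∪ t) y Finset.subset_union_right ht hyt
      refine (congrArg₂ (· + ·) h1 h2).trans ?_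
      rw [← Finset.sum_add_distrib]
      refine Finset.sum_congr rfl fun a _ => ?_
      rw [pfun_add, efun_add]
  | he b y =>
    refine ⟨{b}, fun a ha => ?_, ?_⟩
    · by_cases hF : F ∈ XD Δ a
      · refine (pfun_efun hΔ hR hF y).trans (if_neg ?_)
        rintro rfl
        simp at ha
      · exact pfun_out hΔ hF _
    · rw [Finset.sum_singleton]
      by_cases hF : F ∈ XD Δ b
      · rw [pfun_efun hΔ hR hF, if_pos rfl]
      · rw [efun_out hΔ hR hF, efun_out hΔ hR hF]

/-- The decomposition. -/
def decD [Fintype (Face Q)] (hΔ : IsPolyhedralComplex Q Δ) {Lam : Finset (L d →ₗ[ℤ] ℤ)} (hR : HR Q Lam) :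
    Dec k (mShf k (kQ k Q ⧸ complexIdeal k Q Δ)) (L d) (XD (Q := Q) Δ) where
  p := fun F a => AddMonoidHom.mk' (pfun hΔ F a) (pfun_add hΔ)
  e := fun F a => AddMonoidHom.mk' (efun hΔ F a) (efun_add hΔ a)
  p_out := fun F a x h => pfun_out hΔ h x
  e_out := fun F a x h => efun_out hΔ hR h x
  pe := fun F a y h => (pfun_efun hΔ hR h y).trans (if_pos rfl)
  fin := fun F x => fin_efun hΔ hR x
  natp := by
    intro F G h a x hG
    induction x using efun_ind hΔ with
    | h0 =>
      have h0 : (mShf k (kQ k Q ⧸ complexIdeal k Q Δ)).rho h 0 = 0 := map_zero _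
      refine (congrArg _ h0).trans ?_
      exact (map_zero _).trans (map_zero (AddMonoidHom.mk' (pfun hΔ F a) (pfun_add hΔ))).symm
    | hadd x y hx hy =>
      have h0 := map_add ((mShf k (kQ k Q ⧸ complexIdeal k Q Δ)).rho h) x y
      refine (congrArg _ h0).trans ?_
      refine (map_add _ _ _).trans ?_
      refine (congrArg₂ (· + ·) hx hy).trans ?_
      exact (map_add (AddMonoidHom.mk' (pfun hΔ F a) (pfun_add hΔ)) x y).symm
    | he b y =>
      by_cases hb : F ∈ XD Δ b
      · refine (congrArg _ (rho_efun hΔ h hb y)).trans ?_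
        refine (pfun_efun hΔ hR hG y).trans ?_
        by_cases ha : F ∈ XD Δ a
        · exact (pfun_efun hΔ hR ha y).symm
        · rw [if_neg (by rintro rfl; exact ha hb)]
          exact (pfun_out hΔ ha _).symm
      · rw [efun_out hΔ hR hb]
        have h0 : (mShf k (kQ k Q ⧸ complexIdeal k Q Δ)).rho h 0 = 0 := map_zero _
        refine (congrArg _ h0).trans ?_
        exact (map_zero _).trans (map_zero (AddMonoidHom.mk' (pfun hΔ F a) (pfun_add hΔ))).symm
  nate := fun h a y hF => rho_efun hΔ h hF y

end B9


section B10
/-! ### Comparison with the local cohomology of `Δ` -/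

variable {k} {Q} {Δ : Finset (AddSubmonoid (L d))}
  {ε : AddSubmonoid (L d) → AddSubmonoid (L d) → ℤ} {Lam : Finset (L d →ₗ[ℤ] ℤ)} [Fintype (Face Q)]

lemma XD_cvx (hΔ : IsPolyhedralComplex Q Δ) (a : L d) : Cvx (XD (Q := Q) Δ a) := by
  rintro F ⟨E, hE, hFE, f, hf, haf⟩ H ⟨E', hE', hHE, g, hg, hag⟩ G hFG hGH
  refine ⟨E', hE', le_trans hGH hHE, f, hFG hf, ?_⟩
  refine (hΔ.1 E' hE').left (y := g) ((hΔ.1 E hE).le haf) (H.2.le hg) ?_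
  have : a + f + g = (a + g) + f := by abel
  rw [this]
  exact add_mem hag (hHE (hGH (hFG hf)))

lemma TEx_XD (h : HR Q Lam) (hQ : IsNormalAffineSemigroup Q) (hε : IsIncidence Q ε) (hΔ : IsPolyhedralComplex Q Δ)
    {a : L d} (ha : ¬ sD Δ (-a)) : TEx (facePD h hε) (constShf (Face Q) k k) 1 (XD Δ a) := by
  refine h.TEx_union (a := a) (XD_cvx hΔ a) ?_
  rintro F ⟨E, hE, hFE, f, hf, haf⟩
  obtain ⟨E', hE', hmin⟩ := h.exists_YE hf ((hΔ.1 E hE).le haf)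
  have hle : E'.1 ≤ E := hmin ⟨E, hΔ.1 E hE⟩ hFE haf
  refine ⟨E', hE', ?_, h.acyclicY hQ hε _ _ _ fun hc => ha ⟨E, hE, hle hc⟩⟩
  rintro G ⟨hG, g, hg, hgg⟩
  exact ⟨E, hE, le_trans hG hle, g, hg, hle hgg.1⟩

lemma XD_gen (h : HR Q Lam) (hΔ : IsPolyhedralComplex Q Δ) {G : AddSubmonoid (L d)} (hG : G ∈ Δ) {b : L d} (hb : Gen Lam G b) :
    XD (Q := Q) Δ (-b) = {F | F.1 ∈ Δ ∧ G ≤ F.1} := by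
  ext F
  constructor
  · rintro ⟨E, hE, hFE, f, hf, haf⟩
    refine ⟨hΔ.2 E hE _ F.2 hFE, h.le_of_gen (hΔ.1 G hG) F.2 hb ?_⟩
    refine F.2.right (x := -b + f) ((hΔ.1 E hE).le haf) ((hΔ.1 G hG).le hb.1) ?_
    have : -b + f + b = f := by abel
    rwa [this]
  · rintro ⟨hF, hGF⟩
    exact ⟨F.1, hF, le_rfl, b, hGF hb.1, by rw [neg_add_cancel]; exact zero_mem _⟩

/-- Restriction of cochains. -/
def rst (hΔ : IsPolyhedralComplex Q Δ) (G : AddSubmonoid (L d)) (p : ℕ) (x : Face Q → k) : cochain k Δ G p :=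
  fun F => x ⟨F.1.1, hΔ.1 _ F.1.2⟩

/-- Extension of cochains. -/
def xtd (Q : AddSubmonoid (L d)) (G : AddSubmonoid (L d)) (p : ℕ) (c : cochain k Δ G p) : Face Q → k :=
  fun F => if h : F.1 ∈ Δ ∧ G ≤ F.1 ∧ faceDim F.1 = p then c ⟨⟨F.1, h.1⟩, h.2⟩ else 0

lemma rst_xtd (hΔ : IsPolyhedralComplex Q Δ) (G : AddSubmonoid (L d)) (p : ℕ) (c : cochain k Δ G p) :
    rst hΔ G p (xtd Q G p c) = c := by
  funext F
  simp only [rst, xtd]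
  rw [dif_pos ⟨F.1.2, F.2⟩]

lemma diff_rst (h : HR Q Lam) (hε : IsIncidence Q ε) (hΔ : IsPolyhedralComplex Q Δ) {G : AddSubmonoid (L d)} {p : ℕ}
    {x : Face Q → k} (hx : ∀ F : Face Q, ¬ (F.1 ∈ Δ ∧ G ≤ F.1) → x F = 0) :
    cochainDiff k Q Δ ε G p (rst hΔ G p x) = rst hΔ G (p + 1) (dif (facePD h hε) (constShf (Face Q) k k) x) := by
  funext F'
  simp only [cochainDiff, LinearMap.pi_apply, LinearMap.sum_apply, LinearMap.smul_apply, LinearMap.proj_apply]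
  show _ = dif (facePD h hε) (constShf (Face Q) k k) x ⟨F'.1.1, hΔ.1 _ F'.1.2⟩
  rw [dif_apply]
  refine Fintype.sum_of_injective (fun F : cofaces Δ G p => (⟨F.1.1, hΔ.1 _ F.1.2⟩ : Face Q)) ?_ _ _ ?_ ?_
  · intro F F1 hFF
    have h1 : F.1.1 = F1.1.1 := congrArg (Subtype.val (p := fun E => IsFace Q E)) hFF
    exact Subtype.ext (Subtype.ext h1)
  · intro F hF
    split_ifs with hc
    · have : x F = 0 := by
        refine hx F fun hF' => hF ⟨⟨⟨F.1, hF'.1⟩, hF'.2, ?_⟩, rfl⟩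
        have h1 : faceDim F.1 + 1 = faceDim F'.1.1 := hc.2.2.2
        have h2 := F'.2.2
        exact Nat.succ_injective (h1.trans h2)
      rw [this]
      simp
    · rfl
  · intro F
    by_cases hc : IsFacetOf Q F.1.1 F'.1.1
    · have hc' : (facePD h hε).cov ⟨F.1.1, hΔ.1 _ F.1.2⟩ ⟨F'.1.1, hΔ.1 _ F'.1.2⟩ := hc
      rw [if_pos hc, dif_pos hc']
      simp only [LinearMap.id_coe, id_eq, zsmul_eq_mul, smul_eq_mul]
      rfl
    · have hc' : ¬ (facePD h hε).cov ⟨F.1.1, hΔ.1 _ F.1.2⟩ ⟨F'.1.1, hΔ.1 _ F'.1.2⟩ := hc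
      rw [if_neg hc, dif_neg hc', zero_smul]

lemma TExD_iff (h : HR Q Lam) (hε : IsIncidence Q ε) (hΔ : IsPolyhedralComplex Q Δ) (G : AddSubmonoid (L d)) (i : ℕ) :
    TExD (facePD h hε) (constShf (Face Q) k k) 1 {F | F.1 ∈ Δ ∧ G ≤ F.1} i ↔ Subsingleton (Hloc k Q Δ ε G i) := by
  rw [Submodule.Quotient.subsingleton_iff, Submodule.comap_subtype_eq_top]
  constructor
  · intro H c hc
    have hout : ∀ F : Face Q, ¬ (F.1 ∈ Δ ∧ G ≤ F.1) → xtd Q G i c F = 0 := by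
      intro F hF
      rw [xtd, dif_neg fun h => hF ⟨h.1, h.2.1⟩]
    have hdim : ∀ F : Face Q, faceDim F.1 ≠ i → xtd Q G i c F = 0 := by
      intro F hF
      rw [xtd, dif_neg fun h => hF h.2.2]
    have hd := diff_rst (p := i) h hε hΔ hout
    rw [rst_xtd, LinearMap.mem_ker.1 hc] at hd
    obtain ⟨N, b, hb, hbd, hdb⟩ := H (xtd Q G i c) hout hdim (by
      intro F hF
      by_cases hFi : faceDim F.1 = i + 1
      · exact (congrFun hd ⟨⟨F.1, hF.1⟩, hF.2, hFi⟩).symm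
      · refine dif_zero_of _ _ fun F' hc => hdim F' ?_
        have := hc.2.2.2
        omega)
    cases i with
    | zero =>
      have hb0 : b = 0 := funext fun F => hbd F (Nat.succ_ne_zero _)
      show c = 0
      rw [← rst_xtd hΔ G 0 c]
      funext F
      have := hdb ⟨F.1.1, hΔ.1 _ F.1.2⟩ ⟨F.1.2, F.2.1⟩
      rw [hb0, map_zero, one_pow, one_smul] at this
      exact this.symm
    | succ p =>
      refine ⟨rst hΔ G p b, ?_⟩
      rw [diff_rst h hε hΔ hb]
      conv_rhs => rw [← rst_xtd hΔ G (p + 1) c]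
      funext F
      have := hdb ⟨F.1.1, hΔ.1 _ F.1.2⟩ ⟨F.1.2, F.2.1⟩
      rw [one_pow, one_smul] at this
      exact this
  · intro H c hc hci hdc
    have hmem : rst hΔ G i c ∈ cocycles k Q Δ ε G i := by
      refine LinearMap.mem_ker.2 ?_
      rw [diff_rst h hε hΔ hc]
      funext F
      exact hdc _ ⟨F.1.2, F.2.1⟩
    have := H hmem
    cases i with
    | zero =>
      have h0 : rst hΔ G 0 c = 0 := this
      refine ⟨0, 0, fun _ _ => rfl, fun _ _ => rfl, fun F hF => ?_⟩
      have hcF : c F = 0 := by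
        by_cases hF0 : faceDim F.1 = 0
        · exact congrFun h0 ⟨⟨F.1, hF.1⟩, hF.2, hF0⟩
        · exact hci F hF0
      rw [map_zero, hcF, smul_zero]
      rfl
    | succ p =>
      obtain ⟨b, hb⟩ := this
      have hout : ∀ F : Face Q, ¬ (F.1 ∈ Δ ∧ G ≤ F.1) → xtd Q G p b F = 0 := by
        intro F hF
        rw [xtd, dif_neg fun h => hF ⟨h.1, h.2.1⟩]
      have hdim : ∀ F : Face Q, faceDim F.1 ≠ p → xtd Q G p b F = 0 := by
        intro F hF
        rw [xtd, dif_neg fun h => hF h.2.2]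
      refine ⟨0, xtd Q G p b, hout, fun F hF => hdim F fun h => hF (congrArg (· + 1) h), fun F hF => ?_⟩
      rw [one_pow, one_smul]
      have hd := diff_rst (p := p) h hε hΔ hout
      rw [rst_xtd, hb] at hd
      by_cases hFi : faceDim F.1 = p + 1
      · exact (congrFun hd ⟨⟨F.1, hF.1⟩, hF.2, hFi⟩).symm
      · rw [hci F hFi]
        refine dif_zero_of _ _ fun F' hc => hdim F' ?_
        have := hc.2.2.2
        omega

lemma Pn_iff_Hloc (h : HR Q Lam) (hQ : IsNormalAffineSemigroup Q) (hε : IsIncidence Q ε) (hΔ : IsPolyhedralComplex Q Δ) (n : ℕ) :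
    Pn (facePD h hε) (mShf k (kQ k Q ⧸ complexIdeal k Q Δ)) n ↔
      ∀ G ∈ Δ, ∀ i : ℕ, i < n → Subsingleton (Hloc k Q Δ ε G i) := by
  rw [(decD hΔ h).Pn_iff n]
  constructor
  · intro H G hG i hi
    obtain ⟨b, hb⟩ := h.exists_gen (hΔ.1 G hG)
    have := H i hi (-b)
    rw [XD_gen h hΔ hG hb] at this
    exact (TExD_iff h hε hΔ G i).1 this
  · intro H i hi a
    by_cases ha : sD Δ (-a)
    · obtain ⟨E, hE, haE⟩ := ha
      obtain ⟨G, hG, hgen⟩ := h.exists_face_gen ((hΔ.1 E hE).le haE)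
      have hGΔ : G ∈ Δ := hΔ.2 E hE G hG (h.le_of_gen hG (hΔ.1 E hE) hgen haE)
      have := (TExD_iff (k := k) h hε hΔ G i).2 (H G hGΔ i hi)
      rw [← XD_gen h hΔ hGΔ hgen, neg_neg] at this
      exact this
    · exact (TEx_XD h hQ hε hΔ ha).deg i

lemma bot_mem_complex (h : HR Q Lam) (hQ : IsNormalAffineSemigroup Q) (hΔ : IsPolyhedralComplex Q Δ) (hne : Δ.Nonempty) :
    (⊥ : AddSubmonoid (L d)) ∈ Δ := by
  obtain ⟨E, hE⟩ := hne
  exact hΔ.2 E hE _ (h.isFace_zero hQ) bot_le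

lemma complexIdeal_le_max (hne : Δ.Nonempty) :
    complexIdeal k Q Δ ≤ maxIdeal k Q := by
  apply Ideal.span_mono
  rintro m ⟨q, hq, rfl⟩
  refine ⟨q, fun h0 => ?_, rfl⟩
  obtain ⟨E, hE⟩ := hne
  exact hq E hE (h0 ▸ zero_mem _)

end B10


section B11
/-! ### Krull dimension -/

variable {k} {Q} {Δ : Finset (AddSubmonoid (L d))}

lemma mem_facePrime {E : AddSubmonoid (L d)} (hE : IsFace Q E) {x : kQ k Q} :
    x ∈ facePrime k Q E ↔ ∀ q ∈ x.coeff.support, (q : L d) ∉ E :=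
  mem_span_mono (p := fun q : Q => (q : L d) ∉ E) fun q hq r hrq => hq (hE.right r.2 q.2 hrq)

lemma kQ_domain : IsDomain (kQ k Q) := by
  have : UniqueSums Q := UniqueSums.of_injective_addHom (Q.subtype : Q →ₙ+ L d) Subtype.val_injective inferInstance
  infer_instance

/-- The endomorphism of `k[Q]` killing all monomials outside a face. -/
def killHom {E : AddSubmonoid (L d)} (hE : IsFace Q E) : kQ k Q →ₐ[k] kQ k Q :=
  AddMonoidAlgebra.lift k (kQ k Q) Q
    { toFun := fun q => if ((Multiplicative.toAdd q : Q) : L d) ∈ E then mono k Q (Multiplicative.toAdd q) else 0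
      map_one' := by
        rw [if_pos (by exact zero_mem _)]
        rfl
      map_mul' := by
        intro q r
        by_cases h : ((Multiplicative.toAdd (q * r) : Q) : L d) ∈ E
        · rw [if_pos h, if_pos (hE.left q.toAdd.2 r.toAdd.2 h), if_pos (hE.right q.toAdd.2 r.toAdd.2 h)]
          exact mono_add _ _
        · rw [if_neg h]
          by_cases h1 : ((Multiplicative.toAdd q : Q) : L d) ∈ E
          · rw [if_neg (c := ((Multiplicative.toAdd r : Q) : L d) ∈ E) fun h2 => h (add_mem h1 h2), mul_zero]
          · rw [if_neg h1, zero_mul] }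

lemma killHom_single {E : AddSubmonoid (L d)} (hE : IsFace Q E) (q : Q) (y : k) :
    killHom (k := k) hE (AddMonoidAlgebra.single q y) = if (q : L d) ∈ E then AddMonoidAlgebra.single q y else 0 := by
  rw [killHom, AddMonoidAlgebra.lift_single]
  show y • (if (q : L d) ∈ E then mono k Q q else 0) = _
  split_ifs
  · rw [mono, AddMonoidAlgebra.smul_single, smul_eq_mul, mul_one]
  · rw [smul_zero]

lemma killHom_coef {E : AddSubmonoid (L d)} (hE : IsFace Q E) (x : kQ k Q) (b : L d) :
    coef (killHom (k := k) hE x) b = if b ∈ E then coef x b else 0 := by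
  induction x using AddMonoidAlgebra.induction_linear with
  | zero => rw [map_zero, coef_zero, ite_self]
  | add f g hf hg =>
    rw [map_add, coef_add, hf, hg, coef_add]
    split_ifs <;> simp
  | single p y =>
    rw [killHom_single, coef_single]
    by_cases h : (p : L d) = b
    · subst h
      rw [if_pos rfl]
      split_ifs
      · rw [coef_single, if_pos rfl]
      · rw [coef_zero]
    · rw [if_neg h, ite_self]
      split_ifs
      · rw [coef_single, if_neg h]
      · rw [coef_zero]

lemma facePrime_eq_ker {E : AddSubmonoid (L d)} (hE : IsFace Q E) :
    facePrime k Q E = RingHom.ker (killHom (k := k) hE) := by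
  ext x
  rw [mem_facePrime hE, RingHom.mem_ker]
  constructor
  · intro h
    ext q
    have := killHom_coef hE x q
    unfold coef at this
    rw [dif_pos q.2, dif_pos q.2] at this
    refine this.trans ?_
    split_ifs with hq
    · by_contra hne
      exact h q (Finsupp.mem_support_iff.2 hne) hq
    · rfl
  · intro h q hq hqE
    have := killHom_coef hE x q
    rw [h, coef_zero, if_pos hqE, coef, dif_pos q.2] at this
    exact Finsupp.mem_support_iff.1 hq this.symm

lemma facePrime_isPrime {E : AddSubmonoid (L d)} (hE : IsFace Q E) : (facePrime k Q E).IsPrime := by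
  have := kQ_domain (k := k) (Q := Q)
  rw [facePrime_eq_ker hE]
  exact RingHom.ker_isPrime _

lemma mono_mem_facePrime {E : AddSubmonoid (L d)} (hE : IsFace Q E) (q : Q) :
    mono k Q q ∈ facePrime k Q E ↔ (q : L d) ∉ E := by
  constructor
  · intro h
    refine (mem_facePrime hE).1 h q (Finsupp.mem_support_iff.2 ?_)
    rw [mono, AddMonoidAlgebra.coeff_single, Finsupp.single_eq_same]
    exact one_ne_zero
  · intro h
    exact Ideal.subset_span ⟨q, h, rfl⟩

lemma facePrime_lt {E F : AddSubmonoid (L d)} (hF : IsFace Q F) (hE : IsFace Q E) (h : E < F) :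
    facePrime k Q F < facePrime k Q E := by
  refine lt_of_le_of_ne (facePrime_mono k Q h.le) fun heq => ?_
  obtain ⟨x, hxF, hxE⟩ := SetLike.exists_of_lt h
  have := (mono_mem_facePrime (k := k) hE ⟨x, hF.le hxF⟩).2 hxE
  rw [← heq, mono_mem_facePrime hF] at this
  exact this hxF

lemma complexIdeal_le_facePrime {E : AddSubmonoid (L d)} (hE : E ∈ Δ) : complexIdeal k Q Δ ≤ facePrime k Q E := by
  apply Ideal.span_mono
  rintro m ⟨q, hq, rfl⟩
  exact ⟨q, hq E hE, rfl⟩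

lemma inf_facePrime_le (hΔ : IsPolyhedralComplex Q Δ) : Δ.inf (facePrime k Q) ≤ complexIdeal k Q Δ := by
  intro x hx
  rw [mem_complexIdeal hΔ]
  rintro b ⟨E, hE, hb⟩
  have h1 : x ∈ facePrime k Q E := (Finset.inf_le hE : Δ.inf (facePrime k Q) ≤ facePrime k Q E) hx
  rw [mem_facePrime (hΔ.1 E hE)] at h1
  unfold coef
  split_ifs with hbQ
  · by_contra hne
    exact h1 ⟨b, hbQ⟩ (Finsupp.mem_support_iff.2 hne) hb
  · rfl

lemma dim_lower (hQ : IsNormalAffineSemigroup Q) {Lam : Finset (L d →ₗ[ℤ] ℤ)} (h : HR Q Lam) (hΔ : IsPolyhedralComplex Q Δ) :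
    ∀ (n : ℕ) (F : AddSubmonoid (L d)), ∀ hF : F ∈ Δ, faceDim F = n →
      ∃ s : LTSeries (PrimeSpectrum.zeroLocus (complexIdeal k Q Δ : Set (kQ k Q))), s.length = n ∧
        s.head = ⟨⟨facePrime k Q F, facePrime_isPrime (hΔ.1 F hF)⟩, complexIdeal_le_facePrime hF⟩ := by
  have := finite_face hQ.fg
  intro n
  induction n with
  | zero =>
    intro F hF _
    exact ⟨RelSeries.singleton _ ⟨⟨facePrime k Q F, facePrime_isPrime (hΔ.1 F hF)⟩, complexIdeal_le_facePrime hF⟩, rfl, rfl⟩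
  | succ n ih =>
    intro F hF hd
    have hlt : (⊥ : AddSubmonoid (L d)) < F := by
      refine bot_lt_iff_ne_bot.2 ?_
      rintro rfl
      rw [faceDim_bot] at hd
      omega
    obtain ⟨G, -, hG⟩ := h.exists_facet (h.isFace_zero hQ) (hΔ.1 F hF) hlt
    have hGΔ : G ∈ Δ := hΔ.2 F hF G hG.1 hG.2.2.1
    obtain ⟨s, hs, hhead⟩ := ih G hGΔ (by have := hG.2.2.2; omega)
    have hrel : (⟨⟨facePrime k Q F, facePrime_isPrime (hΔ.1 F hF)⟩, complexIdeal_le_facePrime hF⟩ :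
        PrimeSpectrum.zeroLocus (complexIdeal k Q Δ : Set (kQ k Q))) < s.head := by
      rw [hhead]
      exact facePrime_lt (hΔ.1 F hF) hG.1 (IsFacetOf.lt hG)
    exact ⟨RelSeries.cons s _ hrel, by simp [hs], by simp⟩

end B11


section B12

variable {k} {Q} {Δ : Finset (AddSubmonoid (L d))}

lemma krullDim_le_of_integral {A B : Type} [CommRing A] [CommRing B] (g : A →+* B) (hg : g.IsIntegral) :
    ringKrullDim B ≤ ringKrullDim A := by
  algebraize [g]
  have : Algebra.IsIntegral A B := ⟨hg⟩
  refine Order.krullDim_le_of_strictMono (PrimeSpectrum.comap g) fun p q hpq => ?_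
  exact Ideal.IsIntegral.comap_lt_comap (R := A) (I := p.asIdeal) (J := q.asIdeal) hpq

/-- Monomials in the face ring. -/
def fm (E : AddSubmonoid (L d)) (q : Q) : kQ k Q ⧸ facePrime k Q E := Ideal.Quotient.mk _ (mono k Q q)

lemma fm_add (E : AddSubmonoid (L d)) (q r : Q) : fm (k := k) E (q + r) = fm E q * fm E r := by
  rw [fm, mono_add, map_mul]; rfl

lemma fm_zero (E : AddSubmonoid (L d)) : fm (k := k) (Q := Q) E 0 = 1 := by
  rw [fm, mono_zero, map_one]

lemma fm_nsmul (E : AddSubmonoid (L d)) (q : Q) (n : ℕ) : fm (k := k) E (n • q) = fm E q ^ n := by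
  induction n with
  | zero => rw [zero_nsmul, pow_zero, fm_zero]
  | succ n ih => rw [succ_nsmul, fm_add, ih, pow_succ]

lemma linInd_of_algInd {E : AddSubmonoid (L d)} {ι : Type} {x : ι → kQ k Q ⧸ facePrime k Q E}
    (hx : AlgebraicIndependent k x) (q : ι → Q) (hq : ∀ i, x i = fm E (q i)) :
    LinearIndependent ℤ (fun i => (q i : L d)) := by
  have key : ∀ m : ι →₀ ℕ, MvPolynomial.aeval x (MvPolynomial.monomial m (1 : k)) = fm E (m.sum fun i n => n • q i) := by
    intro m
    induction m using Finsupp.induction_linear with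
    | zero => 
      rw [Finsupp.sum_zero_index, fm_zero]
      simp
    | add f g hf hg =>
      rw [Finsupp.sum_add_index' (h := fun i (n : ℕ) => n • q i) (fun i => zero_nsmul _) (fun i a b => add_nsmul _ _ _), fm_add, ← hf, ← hg, ← map_mul,
        MvPolynomial.monomial_mul, one_mul]
    | single i n =>
      rw [Finsupp.sum_single_index (h := fun i (n : ℕ) => n • q i) (zero_nsmul _), fm_nsmul, MvPolynomial.aeval_monomial, map_one, one_mul,
        Finsupp.prod_single_index (h := fun i (n : ℕ) => x i ^ n) (pow_zero _), hq]
  rw [linearIndependent_iff']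
  intro s g hg i hi
  set mp : ι →₀ ℕ := Finsupp.onFinset s (fun i => if i ∈ s then (g i).toNat else 0) (by intro a ha; by_contra h; simp [h] at ha)
    with hmp
  set mn : ι →₀ ℕ := Finsupp.onFinset s (fun i => if i ∈ s then (-g i).toNat else 0) (by intro a ha; by_contra h; simp [h] at ha)
    with hmn
  have hsum : (mp.sum fun i n => n • q i) = (mn.sum fun i n => n • q i) := by
    rw [hmp, hmn, Finsupp.onFinset_sum (g := fun i (n : ℕ) => n • q i) _ (fun i => zero_nsmul _), Finsupp.onFinset_sum (g := fun i (n : ℕ) => n • q i) _ (fun i => zero_nsmul _)]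
    apply Subtype.ext
    rw [AddSubmonoid.coe_finsetSum, AddSubmonoid.coe_finsetSum, ← sub_eq_zero, ← Finset.sum_sub_distrib, ← hg]
    refine Finset.sum_congr rfl fun j hj => ?_
    rw [if_pos hj, if_pos hj, AddSubmonoidClass.coe_nsmul, AddSubmonoidClass.coe_nsmul, ← natCast_zsmul, ← natCast_zsmul, ← sub_smul]
    congr 1
    omega
  have hinj := hx ((key mp).trans ((congrArg (fm E) hsum).trans (key mn).symm))
  have := MvPolynomial.monomial_left_injective (one_ne_zero (α := k)) hinj
  have hi2 := DFunLike.congr_fun this i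
  rw [hmp, hmn, Finsupp.onFinset_apply, Finsupp.onFinset_apply, if_pos hi, if_pos hi] at hi2
  omega

lemma adjoin_fm {E : AddSubmonoid (L d)} (hE : IsFace Q E) :
    Algebra.adjoin k {x : kQ k Q ⧸ facePrime k Q E | ∃ q : Q, (q : L d) ∈ E ∧ x = fm E q} = ⊤ := by
  rw [eq_top_iff]
  rintro x -
  obtain ⟨x, rfl⟩ := Ideal.Quotient.mk_surjective x
  induction x using AddMonoidAlgebra.induction_linear with
  | zero => rw [map_zero]; exact zero_mem _
  | add f g hf hg => rw [map_add]; exact add_mem hf hg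
  | single q y =>
    have : (AddMonoidAlgebra.single q y : kQ k Q) = y • mono k Q q := by
      rw [mono, AddMonoidAlgebra.smul_single, smul_eq_mul, mul_one]
    rw [this]
    have h2 : Ideal.Quotient.mk (facePrime k Q E) (y • mono k Q q) = y • fm E q := rfl
    rw [h2]
    refine Subalgebra.smul_mem _ ?_ y
    by_cases hq : (q : L d) ∈ E
    · exact Algebra.subset_adjoin ⟨q, hq, rfl⟩
    · have : fm (k := k) E q = 0 := Ideal.Quotient.eq_zero_iff_mem.2 ((mono_mem_facePrime hE q).2 hq)
      rw [this]
      exact zero_mem _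

lemma dim_face_le (hQ : IsNormalAffineSemigroup Q) {E : AddSubmonoid (L d)} (hE : IsFace Q E) :
    ringKrullDim (kQ k Q ⧸ facePrime k Q E) ≤ (faceDim E : ℕ) := by
  have hprime := facePrime_isPrime (k := k) hE
  have hFG : AddMonoid.FG Q := (AddMonoid.fg_iff_addSubmonoid_fg Q).2 hQ.fg
  obtain ⟨s, g, hinj, hint⟩ := exists_integral_inj_algHom_of_fg k (kQ k Q ⧸ facePrime k Q E)
  refine (krullDim_le_of_integral g.toRingHom hint).trans ?_
  rw [MvPolynomial.ringKrullDim_of_isNoetherianRing, ringKrullDim_eq_zero_of_field, zero_add, Nat.card_fin]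
  set T : Set (kQ k Q ⧸ facePrime k Q E) := {x | ∃ q : Q, (q : L d) ∈ E ∧ x = fm E q} with hT
  have halg : Algebra.IsAlgebraic (Algebra.adjoin k T) (kQ k Q ⧸ facePrime k Q E) := by
    refine ⟨fun x => ?_⟩
    have hx : x ∈ Algebra.adjoin k T := by rw [adjoin_fm hE]; trivial
    exact isAlgebraic_algebraMap (⟨x, hx⟩ : Algebra.adjoin k T)
  obtain ⟨t, htT, ht⟩ := exists_isTranscendenceBasis_subset (R := k) T
  have hs : AlgebraicIndependent k (fun i => g (MvPolynomial.X i)) := by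
    show Function.Injective _
    have : (MvPolynomial.aeval fun i => g (MvPolynomial.X i)) = g := by
      ext i
      simp
    rw [this]
    exact hinj
  have h1 := hs.cardinalMk_le_trdeg
  rw [← ht.cardinalMk_eq_trdeg] at h1
  choose q hqE hq using fun x : t => htT x.2
  have hlin := linInd_of_algInd ht.1 q hq
  have hlin2 : LinearIndependent ℤ (fun i : t => (⟨(q i : L d), Submodule.subset_span (hqE i)⟩ :
      Submodule.span ℤ (E : Set (L d)))) := by
    refine LinearIndependent.of_comp (Submodule.subtype _) ?_
    exact hlin
  have h2 := h1.trans hlin2.cardinal_le_rank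
  rw [← Module.finrank_eq_rank, ← faceDim_eq, Cardinal.mk_fin] at h2
  exact_mod_cast h2

lemma krullDim_complex (hQ : IsNormalAffineSemigroup Q) {Lam : Finset (L d →ₗ[ℤ] ℤ)} (h : HR Q Lam)
    (hΔ : IsPolyhedralComplex Q Δ) (hne : Δ.Nonempty) :
    ringKrullDim (kQ k Q ⧸ complexIdeal k Q Δ) = (cxDim Δ : ℕ) := by
  apply le_antisymm
  · rw [ringKrullDim_quotient]
    refine iSup_le fun p => ?_
    obtain ⟨E, hE, hle⟩ := (p.head.1.2.inf_le').1 ((inf_facePrime_le hΔ).trans p.head.2)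
    have h1 := dim_face_le (k := k) hQ (hΔ.1 E hE)
    rw [ringKrullDim_quotient] at h1
    have h2 : ((p.length : ℕ) : WithBot ℕ∞) ≤ Order.krullDim (PrimeSpectrum.zeroLocus (facePrime k Q E : Set (kQ k Q))) := by
      rw [Order.le_krullDim_iff]
      refine ⟨⟨p.length, fun i => ⟨(p i).1, ?_⟩, fun i => p.step i⟩, rfl⟩
      exact hle.trans (p.head_le i)
    refine h2.trans (h1.trans ?_)
    exact_mod_cast Finset.le_sup (f := faceDim) hE
  · obtain ⟨E, hE, hsup⟩ := Finset.exists_mem_eq_sup Δ hne faceDim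
    obtain ⟨s, hs, -⟩ := dim_lower (k := k) hQ h hΔ _ E hE rfl
    rw [ringKrullDim_quotient, cxDim, hsup, Order.le_krullDim_iff]
    exact ⟨s, hs⟩

lemma main_aux (hQ : IsNormalAffineSemigroup Q) (Δ : Finset (AddSubmonoid (L d)))
    (ε : AddSubmonoid (L d) → AddSubmonoid (L d) → ℤ)
    (hΔ : IsPolyhedralComplex Q Δ) (hne : Δ.Nonempty) (hε : IsIncidence Q ε) :
    (∀ G ∈ Δ, ∀ i : ℕ, i < cxDim Δ → Subsingleton (Hloc k Q Δ ε G i)) ↔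
      RingIsCM k Q (complexIdeal k Q Δ) := by
  obtain ⟨Lam, h⟩ := exists_HR Q hQ
  have := finite_face hQ.fg
  have := Fintype.ofFinite (Face Q)
  rw [← Pn_iff_Hloc h hQ hε hΔ, Pn_iff_ring h hQ hε _ (complexIdeal_le_max hne), RingIsCM, krullDim_complex hQ h hΔ hne]
  refine exists_congr fun rs => and_congr_right fun _ => and_congr_right fun _ => ?_
  exact Nat.cast_inj.symm

end B12


/-- **Statement 12.**  The polyhedral complex `Δ` is Cohen--Macaulay over `k`
(its local cohomology `H^i_G(Δ)` vanishes for all `G ∈ Δ` and `i < dim Δ`) if and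
only if `k[Q]/I_Δ` is a Cohen--Macaulay ring. -/
theorem complex_CM_iff_quotient_ring_CM
    (hQ : IsNormalAffineSemigroup Q) (Δ : Finset (AddSubmonoid (L d)))
    (ε : AddSubmonoid (L d) → AddSubmonoid (L d) → ℤ)
    (hΔ : IsPolyhedralComplex Q Δ) (hne : Δ.Nonempty) (hε : IsIncidence Q ε) :
    (∀ G ∈ Δ, ∀ i : ℕ, i < cxDim Δ → Subsingleton (Hloc k Q Δ ε G i)) ↔
      RingIsCM k Q (complexIdeal k Q Δ) := by
  exact main_aux hQ Δ ε hΔ hne hε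


end ZMS
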